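/- Let k ∈ ℕ ∪ {0}, let Ω ⊂ ℝ^d be a bounded domain, and let p ∈ (1, ∞). Suppose u ∈ W^{2,p}(Ω) and f ∈ W^{k,p}(Ω) satisfy Δu = f in Ω. Then for every subdomain Ω' compactly contained in Ω, u ∈ W^{k+2,p}(Ω') and there exists C (depending on d, k, p, Ω, Ω') such that ‖D^{k+2} u‖_{L^p(Ω')} ≤ C ( ‖u‖_{L^p(Ω)} + ‖f‖_{W^{k,p}(Ω)} ). -/

import Mathlib

open MeasureTheory Filter Topology
open scoped ENNReal NNReal

noncomputable section

/-- Euclidean space `ℝ^d`. -/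
abbrev Euc (d : ℕ) := EuclideanSpace ℝ (Fin d)

variable {d : ℕ}

/-- `φ` is a test function on `Ω`, i.e. `φ ∈ C_c^∞(Ω)`. -/
def IsTestFun (Ω : Set (Euc d)) (φ : Euc d → ℝ) : Prop :=
  ContDiff ℝ (⊤ : ℕ∞) φ ∧ HasCompactSupport φ ∧ tsupport φ ⊆ Ω

/-- Classical partial derivative in the `i`-th coordinate direction. -/
def pd (i : Fin d) (f : Euc d → ℝ) (x : Euc d) : ℝ :=
  fderiv ℝ f x (EuclideanSpace.single i 1)

/-- Classical Laplacian. -/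
def lap (f : Euc d → ℝ) (x : Euc d) : ℝ := ∑ i, pd i (pd i f) x

/-- Iterated classical partial derivatives along a multi-index. -/
def iterPD : {m : ℕ} → (Fin m → Fin d) → (Euc d → ℝ) → Euc d → ℝ
  | 0, _, f => f
  | _ + 1, a, f => iterPD (fun i => a i.succ) (pd (a 0) f)

/-- `v` is the family of `m`-th order weak partial derivatives of `u` on `Ω`. -/
def HasWeakDerivs (Ω : Set (Euc d)) (m : ℕ) (u : Euc d → ℝ)
    (v : (Fin m → Fin d) → Euc d → ℝ) : Prop :=
  ∀ a : Fin m → Fin d, ∀ φ : Euc d → ℝ, IsTestFun Ω φ →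
    ∫ x in Ω, u x * iterPD a φ x = (-1 : ℝ) ^ m * ∫ x in Ω, v a x * φ x

/-- Membership in the Sobolev space `W^{k,p}(Ω)`. -/
def MemW (Ω : Set (Euc d)) (p : ℝ≥0∞) (k : ℕ) (u : Euc d → ℝ) : Prop :=
  ∀ m : ℕ, m ≤ k → ∃ v, HasWeakDerivs Ω m u v ∧
    ∀ a, MemLp (v a) p (volume.restrict Ω)

/-- Pointwise magnitude of a family of `m`-th order derivatives. -/
def Dmag {m : ℕ} (v : (Fin m → Fin d) → Euc d → ℝ) (x : Euc d) : ℝ :=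
  ∑ a : Fin m → Fin d, |v a x|

/-- `L^p(Ω)` norm of a family of `m`-th order derivatives. -/
def DkNorm (Ω : Set (Euc d)) (p : ℝ≥0∞) {m : ℕ}
    (v : (Fin m → Fin d) → Euc d → ℝ) : ℝ≥0∞ :=
  eLpNorm (Dmag v) p (volume.restrict Ω)

/-- Membership in `W^{1,p}_0(Ω)`: there is a weak gradient, and `u` is approximated
together with its gradient by test functions in the `L^p` norm. -/
def MemW10 (Ω : Set (Euc d)) (p : ℝ≥0∞) (u : Euc d → ℝ) : Prop :=
  ∃ v : Fin d → Euc d → ℝ,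
    HasWeakDerivs Ω 1 u (fun a => v (a 0)) ∧
    (∀ i, MemLp (v i) p (volume.restrict Ω)) ∧
    ∃ φ : ℕ → Euc d → ℝ, (∀ n, IsTestFun Ω (φ n)) ∧
      Tendsto (fun n =>
        eLpNorm (fun x => u x - φ n x) p (volume.restrict Ω) +
        ∑ i : Fin d, eLpNorm (fun x => v i x - pd i (φ n) x) p (volume.restrict Ω))
        atTop (𝓝 0)

/-- `Δu = f` holds weakly (in the distributional sense) in `Ω`. -/
def IsWeakLap (Ω : Set (Euc d)) (u f : Euc d → ℝ) : Prop :=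
  ∀ φ : Euc d → ℝ, IsTestFun Ω φ →
    ∫ x in Ω, u x * lap φ x = ∫ x in Ω, f x * φ x

/-- `Ω` is a bounded domain. -/
def IsBoundedDomain (Ω : Set (Euc d)) : Prop :=
  IsOpen Ω ∧ IsConnected Ω ∧ Bornology.IsBounded Ω

/-- `Ω` has a `C^k` boundary, described by local level sets of `C^k` defining
functions with nonvanishing gradient. -/
def HasCkBoundary (Ω : Set (Euc d)) (k : ℕ∞) : Prop :=
  ∀ x ∈ frontier Ω, ∃ (U : Set (Euc d)) (ρ : Euc d → ℝ),
    IsOpen U ∧ x ∈ U ∧ ContDiffOn ℝ k ρ U ∧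
    (∀ y ∈ U, fderiv ℝ ρ y ≠ 0) ∧
    Ω ∩ U = {y ∈ U | ρ y < 0} ∧ frontier Ω ∩ U = {y ∈ U | ρ y = 0}

/-- `L^p(Ω)` norm of the (classical) `m`-th order derivatives of `f`. -/
def cDNorm (Ω : Set (Euc d)) (p : ℝ≥0∞) (m : ℕ) (f : Euc d → ℝ) : ℝ≥0∞ :=
  eLpNorm (fun x => ‖iteratedFDeriv ℝ m f x‖) p (volume.restrict Ω)

/-- `u` is the solution of the heat equation on `Ω` with Dirichlet boundary
condition and initial data `u₀`: it is continuous up to the parabolic boundary,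
smooth in space for positive times, satisfies `∂ₜ u = Δu` in `Ω`, vanishes on
`∂Ω`, and starts from `u₀`. -/
def IsHeatSol (Ω : Set (Euc d)) (u₀ : Euc d → ℝ) (u : ℝ → Euc d → ℝ) : Prop :=
  ContinuousOn (fun q : ℝ × Euc d => u q.1 q.2) (Set.Ici 0 ×ˢ closure Ω) ∧
  (∀ t, 0 < t → ContDiffOn ℝ (⊤ : ℕ∞) (u t) Ω) ∧
  (∀ t, 0 < t → ∀ x ∈ Ω, HasDerivAt (fun s => u s x) (lap (u t) x) t) ∧
  (∀ t, 0 < t → ∀ x ∈ frontier Ω, u t x = 0) ∧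
  (∀ x, u 0 x = u₀ x)

/-- The quantity `N[u](t,x) = |u| + t^{1/2}|∇u| + t|∇²u| + t|∂ₜ u|`. -/
def Nfun (u : ℝ → Euc d → ℝ) (t : ℝ) (x : Euc d) : ℝ :=
  |u t x| + Real.sqrt t * ‖fderiv ℝ (u t) x‖ + t * ‖iteratedFDeriv ℝ 2 (u t) x‖ +
    t * |deriv (fun s => u s x) t|

/-- The upper half space `ℝ^{d+1}_+`. -/
def halfSpace (d : ℕ) : Set (Euc (d+1)) := {x | 0 < x (Fin.last d)}

/-- The cube of side length `t^{1/2}` centered at `t^{1/2} n`, `n ∈ ℤ^d`. -/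
def cube (t : ℝ) (n : Fin d → ℤ) : Set (Euc d) :=
  {x | ∀ i, |x i - Real.sqrt t * (n i : ℝ)| ≤ Real.sqrt t / 2}

end


section


/-! ### Part 1: a Bellman function -/

lemma bm_support2 {φ φ' : ℝ → ℝ} {s2 : ℝ} (h1 : ∀ᶠ t in 𝓝 (0:ℝ), HasDerivAt φ (φ' t) t)
    (h2 : HasDerivAt φ' s2 0) (hs : 0 < s2) :
    ∀ᶠ t in 𝓝 (0:ℝ), φ 0 + φ' 0 * t ≤ φ t := by
  have hd : ∀ᶠ t in 𝓝 (0:ℝ), HasDerivAt (fun t => φ t - φ' 0 * t) (φ' t - φ' 0) t := by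
    filter_upwards [h1] with t ht
    exact (ht.sub ((hasDerivAt_id t).const_mul (φ' 0))).congr_deriv (by simp)
  have hd0 := hd.self_of_nhds
  have he : deriv (fun t => φ t - φ' 0 * t) =ᶠ[𝓝 0] fun t => φ' t - φ' 0 := by
    filter_upwards [hd] with t ht using ht.deriv
  have hmin : IsLocalMin (fun t => φ t - φ' 0 * t) 0 := by
    apply isLocalMin_of_deriv_deriv_pos
    · rw [he.deriv_eq]
      have := (h2.sub_const (φ' 0)).deriv
      rw [this]; exact hs
    · rw [hd0.deriv]; ring
    · exact hd0.continuousAt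
  filter_upwards [hmin] with t ht
  simp at ht
  linarith

lemma bm_convex_of_support {U : ℝ × ℝ → ℝ} (hc : Continuous U)
    (h : ∀ a w, ∃ s, ∀ᶠ t in 𝓝 (0:ℝ), U a + s * t ≤ U (a + t • w)) :
    ConvexOn ℝ Set.univ U := by
  refine ⟨convex_univ, fun a _ b _ α β hα hβ hαβ => ?_⟩
  by_contra hcon
  push Not at hcon
  set ψ : ℝ → ℝ := fun t => U (a + t • (b - a)) - (U a + t * (U b - U a)) with hψ
  have hψc : Continuous ψ := by fun_prop
  have hψ0 : ψ 0 = 0 := by simp [hψ]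
  have hψ1 : ψ 1 = 0 := by simp [hψ]
  have hψβ : 0 < ψ β := by
    have e : α • a + β • b = a + β • (b - a) := by
      have : α = 1 - β := by linarith
      subst this
      module
    rw [e] at hcon
    have : α = 1 - β := by linarith
    subst this
    simp only [smul_eq_mul] at hcon
    simp only [hψ]
    linarith
  obtain ⟨t1, ht1, hmax⟩ := isCompact_Icc.exists_isMaxOn (s := Set.Icc (0:ℝ) 1) ⟨0, by simp⟩
    hψc.continuousOn
  have hM : 0 < ψ t1 := lt_of_lt_of_le hψβ (hmax ⟨hβ, by linarith⟩)
  set S := Set.Icc (0:ℝ) 1 ∩ ψ ⁻¹' {ψ t1} with hS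
  have hSc : IsCompact S := isCompact_Icc.inter_right (isClosed_singleton.preimage hψc)
  obtain ⟨t0, ht0, hgr⟩ := hSc.exists_isGreatest ⟨t1, ht1, rfl⟩
  have ht0M : ψ t0 = ψ t1 := ht0.2
  have h0 : 0 < t0 := by
    rcases eq_or_lt_of_le ht0.1.1 with h | h
    · rw [← h, hψ0] at ht0M; linarith
    · exact h
  have h1 : t0 < 1 := by
    rcases eq_or_lt_of_le ht0.1.2 with h | h
    · rw [h, hψ1] at ht0M; linarith
    · exact h
  obtain ⟨s, hs⟩ := h (a + t0 • (b - a)) (b - a)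
  set σ := s - (U b - U a) with hσ
  have hs' : ∀ᶠ t in 𝓝 (0:ℝ), ψ t0 + σ * t ≤ ψ (t0 + t) ∧ t0 + t ∈ Set.Icc (0:ℝ) 1 := by
    have hI : ∀ᶠ t in 𝓝 (0:ℝ), t0 + t ∈ Set.Icc (0:ℝ) 1 := by
      have : Tendsto (fun t : ℝ => t0 + t) (𝓝 0) (𝓝 t0) := by
        have : Continuous (fun t : ℝ => t0 + t) := by fun_prop
        simpa using this.tendsto 0
      exact this (Icc_mem_nhds h0 h1)
    filter_upwards [hs, hI] with t ht hI
    refine ⟨?_, hI⟩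
    have e : a + (t0 + t) • (b - a) = a + t0 • (b - a) + t • (b - a) := by module
    simp only [hψ, e, hσ]
    linarith
  obtain ⟨ε, hε, hball⟩ := Metric.eventually_nhds_iff.1 hs'
  have k1 := hball (y := ε/2) (by simp [abs_of_pos hε]; linarith)
  have k2 := hball (y := -(ε/2)) (by simp [abs_of_pos hε]; linarith)
  have m1 : ψ (t0 + ε/2) ≤ ψ t1 := hmax k1.2
  have m2 : ψ (t0 + -(ε/2)) ≤ ψ t1 := hmax k2.2
  have hσ0 : σ = 0 := by nlinarith [k1.1, k2.1]
  have : ψ (t0 + ε/2) = ψ t1 := by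
    apply le_antisymm m1
    have := k1.1
    rw [hσ0] at this; linarith
  have := hgr ⟨k1.2, this⟩
  linarith

/-- the Bellman function for `p > 2` -/
noncomputable def bmQ (p q : ℝ) (x y : ℝ) : ℝ :=
  if |x| ≤ |y| ^ (q - 1) then (1 + 5 * (p - 1)) * |y| ^ q + x ^ 2 * |y| ^ (2 - q)
  else (1 + 5 * (p - 1)) * |y| ^ q + ((2 / p) * |x| ^ p + (1 - 2 / p) * |y| ^ q)

lemma bmQ_neg_left (p q x y : ℝ) : bmQ p q (-x) y = bmQ p q x y := by simp [bmQ]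
lemma bmQ_neg_right (p q x y : ℝ) : bmQ p q x (-y) = bmQ p q x y := by simp [bmQ]

section
variable {p q : ℝ}

lemma bm_q1 (hp : 2 < p) (hpq : p⁻¹ + q⁻¹ = 1) : 1 < q ∧ q < 2 ∧ (p - 1) * (q - 1) = 1 ∧ p * (q - 1) = q := by
  have hp0 : 0 < p := by linarith
  have hpi : 0 < p⁻¹ := by positivity
  have hpi2 : p⁻¹ < 2⁻¹ := by
    apply inv_strictAnti₀ <;> linarith
  have hqi : 2⁻¹ < q⁻¹ := by linarith
  have hqi1 : q⁻¹ < 1 := by linarith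
  have hq0 : 0 < q := by
    rw [← inv_pos]; linarith
  have h1 : p * (q - 1) = q := by
    field_simp at hpq
    linarith
  refine ⟨?_, ?_, by linarith, h1⟩
  · by_contra h
    push Not at h
    have := (one_le_inv₀ hq0).2 h
    linarith
  · by_contra h
    push Not at h
    have := inv_anti₀ (by norm_num) h
    linarith

lemma bm_young (hp : 2 < p) (hpq : p⁻¹ + q⁻¹ = 1) (x y : ℝ) : x ^ 2 * |y| ^ (2 - q) ≤ (2 / p) * |x| ^ p + (1 - 2 / p) * |y| ^ q := by
  obtain ⟨h1, h2, h3, h4⟩ := bm_q1 hp hpq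
  have hp0 : 0 < p := by linarith
  have hw : 0 ≤ 1 - 2 / p := by
    rw [sub_nonneg, div_le_one hp0]; linarith
  have := Real.geom_mean_le_arith_mean2_weighted (w₁ := 2 / p) (w₂ := 1 - 2 / p)
    (p₁ := |x| ^ p) (p₂ := |y| ^ q) (by positivity) hw (by positivity) (by positivity) (by ring)
  rw [← Real.rpow_mul (abs_nonneg _), ← Real.rpow_mul (abs_nonneg _)] at this
  have e1 : p * (2 / p) = 2 := by field_simp
  have e2 : q * (1 - 2 / p) = 2 - q := by
    have : q = p * (q - 1) := h4.symm
    field_simp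
    nlinarith
  rw [e1, e2] at this
  simpa using this

lemma bmQ_ge (hp : 2 < p) (hpq : p⁻¹ + q⁻¹ = 1) (x y : ℝ) :
    (1 + 5 * (p - 1)) * |y| ^ q + x ^ 2 * |y| ^ (2 - q) ≤ bmQ p q x y := by
  unfold bmQ
  split_ifs
  · exact le_rfl
  · linarith [bm_young hp hpq x y]

lemma bmQ_nonneg (hp : 2 < p) (hpq : p⁻¹ + q⁻¹ = 1) (x y : ℝ) : 0 ≤ bmQ p q x y := by
  refine le_trans ?_ (bmQ_ge hp hpq x y)
  have : 0 ≤ p - 1 := by linarith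
  positivity

lemma bmQ_le (hp : 2 < p) (hpq : p⁻¹ + q⁻¹ = 1) (x y : ℝ) : bmQ p q x y ≤ (2 + 5 * (p - 1)) * (|x| ^ p + |y| ^ q) := by
  have hx : 0 ≤ |x| ^ p := by positivity
  have hy : 0 ≤ |y| ^ q := by positivity
  have h : bmQ p q x y ≤
    (1 + 5 * (p - 1)) * |y| ^ q + ((2 / p) * |x| ^ p + (1 - 2 / p) * |y| ^ q) := by
    unfold bmQ
    split_ifs
    · linarith [bm_young hp hpq x y]
    · exact le_rfl
  have hp0 : 0 < p := by linarith
  have h1 : 2 / p ≤ 1 := by rw [div_le_one hp0]; linarith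
  have h2 : 0 ≤ 2 / p := by positivity
  have h3 : 0 ≤ p - 1 := by linarith
  nlinarith [mul_nonneg h2 hx, mul_nonneg h2 hy, mul_nonneg h3 hx, mul_nonneg h3 hy,
    mul_nonneg (sub_nonneg.2 h1) hx]

lemma bmQ_cont (hp : 2 < p) (hpq : p⁻¹ + q⁻¹ = 1) : Continuous (fun z : ℝ × ℝ => bmQ p q z.1 z.2) := by
  obtain ⟨h1, h2, h3, h4⟩ := bm_q1 hp hpq
  unfold bmQ
  have c1 : Continuous (fun z : ℝ × ℝ => |z.2| ^ q) :=
    (continuous_snd.abs).rpow_const (fun _ => Or.inr (by linarith))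
  have c2 : Continuous (fun z : ℝ × ℝ => |z.2| ^ (2 - q)) :=
    (continuous_snd.abs).rpow_const (fun _ => Or.inr (by linarith))
  have c3 : Continuous (fun z : ℝ × ℝ => |z.2| ^ (q - 1)) :=
    (continuous_snd.abs).rpow_const (fun _ => Or.inr (by linarith))
  have c4 : Continuous (fun z : ℝ × ℝ => |z.1| ^ p) :=
    (continuous_fst.abs).rpow_const (fun _ => Or.inr (by linarith))
  refine Continuous.if_le (by fun_prop) (by fun_prop) (by fun_prop) c3 ?_
  rintro ⟨x, y⟩ hxy
  simp only at hxy ⊢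
  congr 1
  have hp0 : 0 < p := by linarith
  have e1 : |x| ^ p = |y| ^ q := by
    rw [hxy, ← Real.rpow_mul (abs_nonneg _)]
    congr 1; linarith
  have e2 : x ^ 2 * |y| ^ (2 - q) = |y| ^ q := by
    rw [← sq_abs, hxy, ← Real.rpow_natCast, ← Real.rpow_mul (abs_nonneg _)]
    rcases eq_or_lt_of_le (abs_nonneg y) with h | h
    · rw [← h, Real.zero_rpow (by linarith : 2 - q ≠ 0), Real.zero_rpow (by linarith : q ≠ 0),
        mul_zero]
    · rw [← Real.rpow_add h]; congr 1; push_cast; ring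
  rw [e1, e2]; ring

/-- region 1 -/
lemma bm_supp1 (hp : 2 < p) (hpq : p⁻¹ + q⁻¹ = 1) {x y a b c : ℝ} (hx : 0 ≤ x) (hy : 0 < y) (hxy : x ≤ y ^ (q - 1)) (hc : |c| ≤ 1) :
    ∃ s, ∀ᶠ t in 𝓝 (0:ℝ), bmQ p q x y + c * x * y + s * t ≤
      bmQ p q (x + t * a) (y + t * b) + c * (x + t * a) * (y + t * b) := by
  obtain ⟨h1, h2, h3, h4⟩ := bm_q1 hp hpq
  by_cases hab : a = 0 ∧ b = 0
  · refine ⟨0, ?_⟩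
    simp [hab.1, hab.2]
  set A := 1 + 5 * (p - 1) with hA
  set φ : ℝ → ℝ := fun t => A * (y + t * b) ^ q + (x + t * a) ^ 2 * (y + t * b) ^ (2 - q)
    + c * (x + t * a) * (y + t * b) with hφ
  set φ' : ℝ → ℝ := fun t => A * (b * q * (y + t * b) ^ (q - 1)) +
    (2 * (x + t * a) * a * (y + t * b) ^ (2 - q)
      + (x + t * a) ^ 2 * (b * (2 - q) * (y + t * b) ^ (2 - q - 1)))
    + (c * a * (y + t * b) + c * (x + t * a) * b) with hφ'
  have hpos : ∀ᶠ t in 𝓝 (0:ℝ), 0 < y + t * b := by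
    have : ContinuousAt (fun t : ℝ => y + t * b) 0 := by fun_prop
    exact this.eventually (lt_mem_nhds (by simpa using hy))
  have hlin : ∀ (u v t : ℝ), HasDerivAt (fun t : ℝ => u + t * v) v t := by
    intro u v t
    simpa using ((hasDerivAt_id t).mul_const v).const_add u
  have hder : ∀ᶠ t in 𝓝 (0:ℝ), HasDerivAt φ (φ' t) t := by
    filter_upwards [hpos] with t ht
    have r1 := ((hlin y b t).rpow_const (p := q) (Or.inl ht.ne')).const_mul A
    have r2 := (hlin y b t).rpow_const (p := 2 - q) (Or.inl ht.ne')
    have r3 := (hlin x a t).pow 2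
    have r4 := ((hlin x a t).const_mul c).mul (hlin y b t)
    have := (r1.add (r3.mul r2)).add r4
    exact this.congr_deriv (by simp [hφ'])
  have hder2 : HasDerivAt φ' (A * (b * q * (b * (q - 1) * y ^ (q - 1 - 1))) +
      ((2 * a * a) * y ^ (2 - q) + 2 * x * a * (b * (2 - q) * y ^ (2 - q - 1)) +
      (2 * x * a * (b * (2 - q) * y ^ (2 - q - 1)) +
        x ^ 2 * (b * (2 - q) * (b * (2 - q - 1) * y ^ (2 - q - 1 - 1)))))
      + (c * a * b + c * a * b)) 0 := by
    have r1 := (((hlin y b 0).rpow_const (p := q - 1) (Or.inl (by simpa using hy.ne'))).const_mul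
      (b * q)).const_mul A
    have r2 := (hlin y b 0).rpow_const (p := 2 - q) (Or.inl (by simpa using hy.ne'))
    have r2' := ((hlin y b 0).rpow_const (p := 2 - q - 1) (Or.inl (by simpa using hy.ne'))).const_mul
      (b * (2 - q))
    have r3 := (hlin x a 0).pow 2
    have r3' := ((hlin x a 0).const_mul 2).mul_const a
    have r4 := ((hlin y b 0).const_mul (c * a)).add (((hlin x a 0).const_mul c).mul_const b)
    have := (r1.add ((r3'.mul r2).add (r3.mul r2'))).add r4
    exact this.congr_deriv (by simp)
  have hs2 : 0 < (A * (b * q * (b * (q - 1) * y ^ (q - 1 - 1))) +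
      ((2 * a * a) * y ^ (2 - q) + 2 * x * a * (b * (2 - q) * y ^ (2 - q - 1)) +
      (2 * x * a * (b * (2 - q) * y ^ (2 - q - 1)) +
        x ^ 2 * (b * (2 - q) * (b * (2 - q - 1) * y ^ (2 - q - 1 - 1)))))
      + (c * a * b + c * a * b)) := by
    set s := y ^ (2 - q) with hs
    have hs0 : 0 < s := by positivity
    set r := x * y ^ (2 - q - 1) with hr
    have hr0 : 0 ≤ r := by positivity
    have hr1 : r ≤ 1 := by
      calc r ≤ y ^ (q - 1) * y ^ (2 - q - 1) :=
            mul_le_mul_of_nonneg_right hxy (by positivity)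
        _ = 1 := by
          rw [← Real.rpow_add hy]; ring_nf; simp
    have e1 : y ^ (q - 1 - 1) = s⁻¹ := by
      rw [hs, ← Real.rpow_neg hy.le]; congr 1; ring
    have e2 : x ^ 2 * y ^ (2 - q - 1 - 1) = r ^ 2 * s⁻¹ := by
      rw [hr, hs, ← Real.rpow_neg hy.le, mul_pow, ← Real.rpow_natCast (y ^ (2 - q - 1)),
        ← Real.rpow_mul hy.le, mul_assoc, ← Real.rpow_add hy]
      congr 2
      push_cast; ring
    have e : (A * (b * q * (b * (q - 1) * y ^ (q - 1 - 1))) +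
      ((2 * a * a) * s + 2 * x * a * (b * (2 - q) * y ^ (2 - q - 1)) +
      (2 * x * a * (b * (2 - q) * y ^ (2 - q - 1)) +
        x ^ 2 * (b * (2 - q) * (b * (2 - q - 1) * y ^ (2 - q - 1 - 1)))))
      + (c * a * b + c * a * b)) = s⁻¹ * (2 * (a * s) ^ 2 + (4 * (2 - q) * r + 2 * c) * (a * s) * b
        + (q - 1) * (A * q - (2 - q) * r ^ 2) * b ^ 2) := by
      rw [e1]
      have : x ^ 2 * (b * (2 - q) * (b * (2 - q - 1) * y ^ (2 - q - 1 - 1)))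
        = (r ^ 2 * s⁻¹) * (b * (2 - q) * (b * (2 - q - 1))) := by rw [← e2]; ring
      rw [this]
      have : 2 * x * a * (b * (2 - q) * y ^ (2 - q - 1)) = 2 * a * b * (2 - q) * r := by
        rw [hr]; ring
      rw [this]
      field_simp
      ring
    rw [e]
    apply mul_pos (by positivity)
    set α := a * s with hα
    have hαb : α ≠ 0 ∨ b ≠ 0 := by
      by_cases hb : b = 0
      · left
        have ha : a ≠ 0 := fun h => hab ⟨h, hb⟩
        exact mul_ne_zero ha hs0.ne'
      · right; exact hb
    have k1 : 5 ≤ (q - 1) * (A * q - (2 - q) * r ^ 2) := by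
      have : (2 - q) * r ^ 2 ≤ 1 := by
        have : r ^ 2 ≤ 1 := by nlinarith
        nlinarith
      have hA1 : 0 < A := by rw [hA]; linarith
      have : A - 1 ≤ A * q - (2 - q) * r ^ 2 := by nlinarith
      have h5 : (q - 1) * (A - 1) = 5 := by
        rw [hA]; linear_combination 5 * h3
      nlinarith
    have k2 : |4 * (2 - q) * r + 2 * c| ≤ 6 := by
      rw [abs_le] at hc ⊢
      have g1 : 0 ≤ (2 - q) * r := mul_nonneg (by linarith) hr0
      have g2 : (2 - q) * r ≤ 1 := mul_le_one₀ (by linarith) hr0 hr1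
      obtain ⟨hc1, hc2⟩ := hc
      constructor
      · linarith
      · linarith
    have k3 : -(6 * |α * b|) ≤ (4 * (2 - q) * r + 2 * c) * α * b := by
      have h6 := neg_abs_le ((4 * (2 - q) * r + 2 * c) * (α * b))
      rw [abs_mul] at h6
      have : |4 * (2 - q) * r + 2 * c| * |α * b| ≤ 6 * |α * b| := by gcongr
      have e9 : (4 * (2 - q) * r + 2 * c) * α * b = (4 * (2 - q) * r + 2 * c) * (α * b) := by ring
      rw [e9]
      linarith
    have k4 : 5 * b ^ 2 ≤ (q - 1) * (A * q - (2 - q) * r ^ 2) * b ^ 2 := by gcongr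
    have k5 : 0 < 2 * α ^ 2 - 6 * |α * b| + 5 * b ^ 2 := by
      rw [abs_mul, ← sq_abs α, ← sq_abs b]
      have : 0 < |α| ∨ 0 < |b| := hαb.imp abs_pos.2 abs_pos.2
      have e : 2 * |α| ^ 2 - 6 * (|α| * |b|) + 5 * |b| ^ 2 =
        (|α| - 2 * |b|) ^ 2 + (|α| - |b|) ^ 2 := by ring
      rw [e]
      by_contra hcon
      have q1 := sq_nonneg (|α| - 2 * |b|)
      have q2 := sq_nonneg (|α| - |b|)
      have z1 : |α| - 2 * |b| = 0 := by
        apply pow_eq_zero_iff (two_ne_zero) |>.1; linarith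
      have z2 : |α| - |b| = 0 := by
        apply pow_eq_zero_iff (two_ne_zero) |>.1; linarith
      rcases this with h | h <;> linarith
    linarith
  refine ⟨φ' 0, ?_⟩
  filter_upwards [bm_support2 hder hder2 hs2, hpos] with t ht htpos
  have hQ0 : bmQ p q x y = A * y ^ q + x ^ 2 * y ^ (2 - q) := by
    unfold bmQ
    rw [abs_of_nonneg hx, abs_of_pos hy, if_pos hxy]
  have hQt := bmQ_ge hp hpq (x + t * a) (y + t * b)
  rw [abs_of_pos htpos] at hQt
  simp only [hφ] at ht
  simp only [zero_mul, add_zero] at ht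
  rw [hQ0]
  linarith

/-- region 2, `y > 0` -/
lemma bm_supp2 (hp : 2 < p) (hpq : p⁻¹ + q⁻¹ = 1) {x y a b c : ℝ} (hy : 0 < y) (hxy : y ^ (q - 1) < x) (hc : |c| ≤ 1) :
    ∃ s, ∀ᶠ t in 𝓝 (0:ℝ), bmQ p q x y + c * x * y + s * t ≤
      bmQ p q (x + t * a) (y + t * b) + c * (x + t * a) * (y + t * b) := by
  obtain ⟨h1, h2, h3, h4⟩ := bm_q1 hp hpq
  by_cases hab : a = 0 ∧ b = 0
  · refine ⟨0, ?_⟩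
    simp [hab.1, hab.2]
  have hp0 : 0 < p := by linarith
  have hx : 0 < x := lt_of_le_of_lt (by positivity) hxy
  set A := 1 + 5 * (p - 1) with hA
  set B := A + (1 - 2 / p) with hB
  have hB1 : 1 ≤ B := by
    have : 2 / p ≤ 1 := by rw [div_le_one hp0]; linarith
    rw [hB, hA]; linarith
  set φ : ℝ → ℝ := fun t => B * (y + t * b) ^ q + (2 / p) * (x + t * a) ^ p
    + c * (x + t * a) * (y + t * b) with hφ
  set φ' : ℝ → ℝ := fun t => B * (b * q * (y + t * b) ^ (q - 1)) +
    (2 / p) * (a * p * (x + t * a) ^ (p - 1))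
    + (c * a * (y + t * b) + c * (x + t * a) * b) with hφ'
  have hpos : ∀ᶠ t in 𝓝 (0:ℝ), 0 < y + t * b := by
    have : ContinuousAt (fun t : ℝ => y + t * b) 0 := by fun_prop
    exact this.eventually (lt_mem_nhds (by simpa using hy))
  have hposx : ∀ᶠ t in 𝓝 (0:ℝ), 0 < x + t * a := by
    have : ContinuousAt (fun t : ℝ => x + t * a) 0 := by fun_prop
    exact this.eventually (lt_mem_nhds (by simpa using hx))
  have hreg : ∀ᶠ t in 𝓝 (0:ℝ), (y + t * b) ^ (q - 1) < x + t * a := by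
    have c1 : ContinuousAt (fun t : ℝ => x + t * a) 0 := by fun_prop
    have c2 : ContinuousAt (fun t : ℝ => (y + t * b) ^ (q - 1)) 0 :=
      ContinuousAt.rpow_const (by fun_prop) (Or.inr (by linarith))
    exact c2.eventually_lt c1 (by simpa using hxy)
  have hlin : ∀ (u v t : ℝ), HasDerivAt (fun t : ℝ => u + t * v) v t := by
    intro u v t
    simpa using ((hasDerivAt_id t).mul_const v).const_add u
  have hder : ∀ᶠ t in 𝓝 (0:ℝ), HasDerivAt φ (φ' t) t := by
    filter_upwards [hpos, hposx] with t ht htx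
    have r1 := ((hlin y b t).rpow_const (p := q) (Or.inl ht.ne')).const_mul B
    have r2 := ((hlin x a t).rpow_const (p := p) (Or.inl htx.ne')).const_mul (2 / p)
    have r4 := ((hlin x a t).const_mul c).mul (hlin y b t)
    exact (r1.add r2).add r4
  have hder2 : HasDerivAt φ' (B * (b * q * (b * (q - 1) * y ^ (q - 1 - 1))) +
      (2 / p) * (a * p * (a * (p - 1) * x ^ (p - 1 - 1)))
      + (c * a * b + c * a * b)) 0 := by
    have r1 := (((hlin y b 0).rpow_const (p := q - 1) (Or.inl (by simpa using hy.ne'))).const_mul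
      (b * q)).const_mul B
    have r2 := (((hlin x a 0).rpow_const (p := p - 1) (Or.inl (by simpa using hx.ne'))).const_mul
      (a * p)).const_mul (2 / p)
    have r4 := ((hlin y b 0).const_mul (c * a)).add (((hlin x a 0).const_mul c).mul_const b)
    have := (r1.add r2).add r4
    exact this.congr_deriv (by simp)
  have hs2 : 0 < (B * (b * q * (b * (q - 1) * y ^ (q - 1 - 1))) +
      (2 / p) * (a * p * (a * (p - 1) * x ^ (p - 1 - 1)))
      + (c * a * b + c * a * b)) := by
    set s := y ^ (2 - q) with hs
    have hs0 : 0 < s := by positivity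
    have e1 : y ^ (q - 1 - 1) = s⁻¹ := by
      rw [hs, ← Real.rpow_neg hy.le]; congr 1; ring
    have e2 : s ≤ x ^ (p - 1 - 1) := by
      calc s = (y ^ (q - 1)) ^ (p - 1 - 1) := by
            rw [← Real.rpow_mul hy.le, hs]; congr 1; linarith
        _ ≤ _ := Real.rpow_le_rpow (by positivity) hxy.le (by linarith)
    set X := x ^ (p - 1 - 1) with hX
    have e : (B * (b * q * (b * (q - 1) * y ^ (q - 1 - 1))) +
      (2 / p) * (a * p * (a * (p - 1) * X)) + (c * a * b + c * a * b)) =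
      s⁻¹ * (B * q * (q - 1) * b ^ 2 + 2 * (p - 1) * a ^ 2 * (X * s) + 2 * c * (a * s) * b) := by
      rw [e1]; field_simp; ring
    rw [e]
    apply mul_pos (by positivity)
    have g1 : 2 * (p - 1) * a ^ 2 * (s * s) ≤ 2 * (p - 1) * a ^ 2 * (X * s) := by
      have : 0 ≤ 2 * (p - 1) * a ^ 2 := by
        have : 0 ≤ p - 1 := by linarith
        positivity
      gcongr
    have g2 : (q - 1) * b ^ 2 ≤ B * q * (q - 1) * b ^ 2 := by
      have : 1 ≤ B * q := by nlinarith
      have h7 : 0 ≤ (q - 1) * b ^ 2 := mul_nonneg (by linarith) (sq_nonneg _)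
      nlinarith
    set α := a * s with hα
    have hαb : α ≠ 0 ∨ b ≠ 0 := by
      by_cases hb : b = 0
      · left
        have ha : a ≠ 0 := fun h => hab ⟨h, hb⟩
        exact mul_ne_zero ha hs0.ne'
      · right; exact hb
    have g3 : -(2 * |α * b|) ≤ 2 * c * α * b := by
      have h6 := neg_abs_le (c * (α * b))
      rw [abs_mul] at h6
      have : |c| * |α * b| ≤ 1 * |α * b| := by gcongr
      nlinarith
    have g4 : 0 < (q - 1) * b ^ 2 + 2 * (p - 1) * α ^ 2 - 2 * |α * b| := by
      rw [abs_mul, ← sq_abs α, ← sq_abs b]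
      have hp1 : 0 < p - 1 := by linarith
      have hq1 : q - 1 = 1 / (p - 1) := by field_simp; linarith
      rw [hq1]
      have e : 1 / (p - 1) * |b| ^ 2 + 2 * (p - 1) * |α| ^ 2 - 2 * (|α| * |b|) =
        1 / (p - 1) * (|b| - (p - 1) * |α|) ^ 2 + (p - 1) * |α| ^ 2 := by
        field_simp; ring
      rw [e]
      by_cases hα0 : α = 0
      · have hb : b ≠ 0 := by tauto
        simp only [hα0, abs_zero, mul_zero, sub_zero]
        have := abs_pos.2 hb
        positivity
      · have := abs_pos.2 hα0
        positivity
    have : 2 * (p - 1) * a ^ 2 * (s * s) = 2 * (p - 1) * α ^ 2 := by rw [hα]; ring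
    linarith
  refine ⟨φ' 0, ?_⟩
  filter_upwards [bm_support2 hder hder2 hs2, hpos, hposx, hreg] with t ht htpos htx hr
  have hQ0 : bmQ p q x y = B * y ^ q + (2 / p) * x ^ p := by
    unfold bmQ
    rw [abs_of_pos hx, abs_of_pos hy, if_neg (not_le.2 hxy)]
    rw [hB]; ring
  have hQt : bmQ p q (x + t * a) (y + t * b) = B * (y + t * b) ^ q + (2 / p) * (x + t * a) ^ p := by
    unfold bmQ
    rw [abs_of_pos htx, abs_of_pos htpos, if_neg (not_le.2 hr)]
    rw [hB]; ring
  simp only [hφ] at ht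
  simp only [zero_mul, add_zero] at ht
  rw [hQ0, hQt]
  linarith

/-- `y = 0`, `x > 0` -/
lemma bm_supp3 (hp : 2 < p) (hpq : p⁻¹ + q⁻¹ = 1) {x a b c : ℝ} (hx : 0 < x) (hc : |c| ≤ 1) :
    ∃ s, ∀ᶠ t in 𝓝 (0:ℝ), bmQ p q x 0 + c * x * 0 + s * t ≤
      bmQ p q (x + t * a) (0 + t * b) + c * (x + t * a) * (0 + t * b) := by
  obtain ⟨h1, h2, h3, h4⟩ := bm_q1 hp hpq
  have hp0 : 0 < p := by linarith
  set A := 1 + 5 * (p - 1) with hA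
  set B := A + (1 - 2 / p) with hB
  have hB1 : 1 ≤ B := by
    have : 2 / p ≤ 1 := by rw [div_le_one hp0]; linarith
    rw [hB, hA]; linarith
  have hposx : ∀ᶠ t in 𝓝 (0:ℝ), 0 < x + t * a := by
    have : ContinuousAt (fun t : ℝ => x + t * a) 0 := by fun_prop
    exact this.eventually (lt_mem_nhds (by simpa using hx))
  have hreg : ∀ᶠ t in 𝓝 (0:ℝ), |t * b| ^ (q - 1) < x + t * a := by
    have c1 : ContinuousAt (fun t : ℝ => x + t * a) 0 := by fun_prop
    have c2 : ContinuousAt (fun t : ℝ => |t * b| ^ (q - 1)) 0 :=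
      ContinuousAt.rpow_const (by fun_prop) (Or.inr (by linarith))
    refine c2.eventually_lt c1 ?_
    simp [Real.zero_rpow (by linarith : q - 1 ≠ 0), hx]
  have hsmall : b ≠ 0 → ∀ᶠ t in 𝓝 (0:ℝ), |a| * |t * b| ^ (2 - q) ≤ |b| := by
    intro hb
    have c1 : ContinuousAt (fun t : ℝ => |a| * |t * b| ^ (2 - q)) 0 :=
      ContinuousAt.mul continuousAt_const
        (ContinuousAt.rpow_const (by fun_prop) (Or.inr (by linarith)))
    have : ∀ᶠ t in 𝓝 (0:ℝ), |a| * |t * b| ^ (2 - q) < |b| := by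
      refine c1.eventually (gt_mem_nhds ?_)
      simp [Real.zero_rpow (by linarith : 2 - q ≠ 0), hb]
    filter_upwards [this] with t ht using ht.le
  have hsmall' : ∀ᶠ t in 𝓝 (0:ℝ), b ≠ 0 → |a| * |t * b| ^ (2 - q) ≤ |b| := by
    by_cases hb : b = 0
    · simp [hb]
    · filter_upwards [hsmall hb] with t ht _ using ht
  have htan : ∀ t, 0 < x + t * a → x ^ p + p * x ^ (p - 1) * (t * a) ≤ (x + t * a) ^ p := by
    intro t ht
    have := one_add_mul_self_le_rpow_one_add (s := t * a / x) (p := p) (by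
      rw [le_div_iff₀ hx]; linarith) (by linarith)
    have e : x + t * a = x * (1 + t * a / x) := by field_simp
    rw [e, Real.mul_rpow hx.le (by
      have : 0 < x * (1 + t * a / x) := by rw [← e]; exact ht
      exact (pos_of_mul_pos_right this hx.le).le)]
    calc x ^ p + p * x ^ (p - 1) * (t * a) = x ^ p * (1 + p * (t * a / x)) := by
          rw [Real.rpow_sub_one hx.ne']; field_simp
      _ ≤ _ := by gcongr
  refine ⟨(2 / p) * (p * x ^ (p - 1) * a) + c * x * b, ?_⟩
  filter_upwards [hposx, hreg, hsmall'] with t htx hr hsm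
  have hQ0 : bmQ p q x 0 = (2 / p) * x ^ p := by
    unfold bmQ
    rw [abs_of_pos hx, abs_zero, Real.zero_rpow (by linarith), if_neg (not_le.2 hx),
      Real.zero_rpow (by linarith)]
    ring
  have hQt : bmQ p q (x + t * a) (0 + t * b) = B * |t * b| ^ q + (2 / p) * (x + t * a) ^ p := by
    unfold bmQ
    rw [abs_of_pos htx, zero_add, if_neg (not_le.2 hr)]
    rw [hB]; ring
  rw [hQ0, hQt]
  have k1 : (2 / p) * (x ^ p + p * x ^ (p - 1) * (t * a)) ≤ (2 / p) * (x + t * a) ^ p := by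
    have := htan t htx
    gcongr
  have k2 : |c * (t * a) * (t * b)| ≤ |t * b| ^ q := by
    rw [abs_mul, abs_mul, abs_mul t a]
    rcases eq_or_ne (t * b) 0 with h0 | h0
    · rw [h0, abs_zero, mul_zero, Real.zero_rpow (by linarith)]
    · have hb : 0 < |t * b| := abs_pos.2 h0
      have e : |t * b| ^ q * |t * b| ^ (2 - q) = |t * b| ^ 2 := by
        rw [← Real.rpow_add hb]; rw [← Real.rpow_natCast]; congr 1; push_cast; ring
      have e' : |t * b| = |t| * |b| := abs_mul _ _
      have hb1 : b ≠ 0 := fun h => h0 (by rw [h, mul_zero])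
      have hb0 : 0 < |b| := abs_pos.2 hb1
      have hsm' := hsm hb1
      have hTq : 0 < |t * b| ^ q := by positivity
      have k : |b| * (|t| * |a| * |t * b|) ≤ |b| * |t * b| ^ q := by
        calc |b| * (|t| * |a| * |t * b|) = |a| * |t * b| ^ 2 := by rw [e']; ring
          _ = (|a| * |t * b| ^ (2 - q)) * |t * b| ^ q := by rw [← e]; ring
          _ ≤ |b| * |t * b| ^ q := by gcongr
      have k' := le_of_mul_le_mul_left k hb0
      calc |c| * (|t| * |a|) * |t * b| ≤ 1 * (|t| * |a|) * |t * b| := by gcongr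
        _ ≤ _ := by rw [one_mul]; exact k'
  have k3 : |t * b| ^ q ≤ B * |t * b| ^ q := by
    have : 0 ≤ |t * b| ^ q := by positivity
    nlinarith
  have k4 := neg_abs_le (c * (t * a) * (t * b))
  nlinarith

/-- general support -/
lemma bm_supp (hp : 2 < p) (hpq : p⁻¹ + q⁻¹ = 1) {c : ℝ} (hc : |c| ≤ 1) (x y a b : ℝ) :
    ∃ s, ∀ᶠ t in 𝓝 (0:ℝ), bmQ p q x y + c * x * y + s * t ≤
      bmQ p q (x + t * a) (y + t * b) + c * (x + t * a) * (y + t * b) := by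
  have key : ∀ {c : ℝ} (hc : |c| ≤ 1) (x y a b : ℝ), 0 ≤ x → 0 ≤ y →
      ∃ s, ∀ᶠ t in 𝓝 (0:ℝ), bmQ p q x y + c * x * y + s * t ≤
        bmQ p q (x + t * a) (y + t * b) + c * (x + t * a) * (y + t * b) := by
    intro c hc x y a b hx hy
    obtain ⟨h1, h2, h3, h4⟩ := bm_q1 hp hpq
    rcases eq_or_lt_of_le hy with hy | hy
    · subst hy
      rcases eq_or_lt_of_le hx with hx | hx
      · subst hx
        refine ⟨0, Eventually.of_forall fun t => ?_⟩
        have h0 : bmQ p q 0 0 = 0 := by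
          unfold bmQ
          simp [Real.zero_rpow (by linarith : q ≠ 0), Real.zero_rpow (by linarith : q - 1 ≠ 0)]
        rw [h0]
        have hge := bmQ_ge hp hpq (0 + t * a) (0 + t * b)
        simp only [zero_add] at hge ⊢
        set X := t * a
        set Y := t * b
        suffices h : -(c * X * Y) ≤ (1 + 5 * (p - 1)) * |Y| ^ q + X ^ 2 * |Y| ^ (2 - q) by linarith
        have k1 : -(c * X * Y) ≤ |X| * |Y| := by
          have h6 := neg_abs_le (c * X * Y)
          rw [abs_mul, abs_mul] at h6
          have : |c| * |X| * |Y| ≤ 1 * |X| * |Y| := by gcongr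
          linarith
        refine k1.trans ?_
        rcases eq_or_lt_of_le (abs_nonneg Y) with h0 | h0
        · rw [← h0, mul_zero]
          have : 0 ≤ p - 1 := by linarith
          positivity
        · have e : |Y| ^ q * |Y| ^ (2 - q) = |Y| ^ 2 := by
            rw [← Real.rpow_add h0]; rw [← Real.rpow_natCast]; congr 1; push_cast; ring
          rw [← sq_abs X]
          set u := |Y| ^ q
          set v := |Y| ^ (2 - q)
          have hu : 0 < u := by positivity
          have hv : 0 < v := by positivity
          have hX := abs_nonneg X
          have : (|X| * |Y|) ^ 2 ≤ (u + |X| ^ 2 * v) ^ 2 := by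
            rw [mul_pow, ← e]
            have := sq_nonneg (u - |X| ^ 2 * v)
            have : 0 ≤ u * (|X| ^ 2 * v) := by positivity
            nlinarith
          have := le_of_sq_le_sq this (by positivity)
          have h9 : 0 ≤ 5 * (p - 1) * u := by
            have : 0 ≤ p - 1 := by linarith
            positivity
          linarith
      · exact bm_supp3 hp hpq hx hc
    · by_cases hxy : x ≤ y ^ (q - 1)
      · exact bm_supp1 hp hpq hx hy hxy hc
      · exact bm_supp2 hp hpq hy (not_le.1 hxy) hc
  have hc' : |(-c)| ≤ 1 := by rwa [abs_neg]
  rcases le_total 0 x with hx | hx <;> rcases le_total 0 y with hy | hy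
  · exact key hc x y a b hx hy
  · obtain ⟨s, hs⟩ := key hc' x (-y) a (-b) hx (by linarith)
    refine ⟨s, ?_⟩
    filter_upwards [hs] with t ht
    have e : -y + t * -b = -(y + t * b) := by ring
    rw [e, bmQ_neg_right, bmQ_neg_right] at ht
    linarith
  · obtain ⟨s, hs⟩ := key hc' (-x) y (-a) b (by linarith) hy
    refine ⟨s, ?_⟩
    filter_upwards [hs] with t ht
    have e : -x + t * -a = -(x + t * a) := by ring
    rw [e, bmQ_neg_left, bmQ_neg_left] at ht
    linarith
  · obtain ⟨s, hs⟩ := key hc (-x) (-y) (-a) (-b) (by linarith) (by linarith)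
    refine ⟨s, ?_⟩
    filter_upwards [hs] with t ht
    have e : -x + t * -a = -(x + t * a) := by ring
    have e' : -y + t * -b = -(y + t * b) := by ring
    rw [e, e', bmQ_neg_left, bmQ_neg_left, bmQ_neg_right, bmQ_neg_right] at ht
    linarith

lemma bmQ_convex (hp : 2 < p) (hpq : p⁻¹ + q⁻¹ = 1) {c : ℝ} (hc : |c| ≤ 1) :
    ConvexOn ℝ Set.univ (fun z : ℝ × ℝ => bmQ p q z.1 z.2 + c * z.1 * z.2) := by
  apply bm_convex_of_support
  · have := bmQ_cont hp hpq
    fun_prop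
  · rintro ⟨x, y⟩ ⟨a, b⟩
    exact bm_supp hp hpq hc x y a b

end

/-- the properties of a Bellman function -/
structure IsBellman (p q C : ℝ) (Q : ℝ → ℝ → ℝ) : Prop where
  cont : Continuous (fun z : ℝ × ℝ => Q z.1 z.2)
  nonneg : ∀ x y, 0 ≤ Q x y
  le : ∀ x y, Q x y ≤ C * (|x| ^ p + |y| ^ q)
  conv : ∀ c : ℝ, |c| ≤ 1 → ConvexOn ℝ Set.univ (fun z : ℝ × ℝ => Q z.1 z.2 + c * z.1 * z.2)

lemma exists_bellman {p q : ℝ} (hp : 1 < p) (hpq : p⁻¹ + q⁻¹ = 1) :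
    ∃ C Q, 0 < C ∧ IsBellman p q C Q := by
  rcases lt_trichotomy p 2 with h | h | h
  · have hp0 : 0 < p := by linarith
    have hq2 : 2 < q := by
      have h1 : 2⁻¹ < p⁻¹ := inv_strictAnti₀ hp0 h
      have h2 : p⁻¹ < 1 := inv_lt_one_of_one_lt₀ hp
      have h3 : 0 < q⁻¹ := by linarith
      have h4 : q⁻¹ < 2⁻¹ := by linarith
      exact (inv_lt_inv₀ (inv_pos.1 h3) (by norm_num)).1 h4
    have hpq' : q⁻¹ + p⁻¹ = 1 := by linarith
    refine ⟨2 + 5 * (q - 1), fun x y => bmQ q p y x, by linarith, ?_, ?_, ?_, ?_⟩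
    · exact (bmQ_cont hq2 hpq').comp continuous_swap
    · exact fun x y => bmQ_nonneg hq2 hpq' y x
    · intro x y
      have := bmQ_le hq2 hpq' y x
      linarith
    · intro c hc
      refine ⟨convex_univ, ?_⟩
      intro a _ b _ s t hs ht hst
      have h9 := (bmQ_convex hq2 hpq' hc).2 (x := (a.2, a.1)) (by simp) (y := (b.2, b.1))
        (by simp) hs ht hst
      simp only [Prod.fst_add,
        Prod.snd_add, Prod.smul_fst, Prod.smul_snd, smul_eq_mul] at h9 ⊢
      linarith
  · subst h
    have hq : q = 2 := by
      have : q⁻¹ = 2⁻¹ := by linarith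
      exact inv_injective this
    subst hq
    refine ⟨1, fun x y => x ^ 2 + y ^ 2, by norm_num, by fun_prop, fun x y => by positivity, ?_, ?_⟩
    · intro x y
      have e : ∀ t : ℝ, |t| ^ (2:ℝ) = t ^ 2 := by
        intro t; rw [Real.rpow_two, sq_abs]
      rw [e, e]; simp
    · intro c hc
      rw [abs_le] at hc
      refine ⟨convex_univ, ?_⟩
      rintro ⟨x, y⟩ - ⟨x', y'⟩ - α β hα hβ hαβ
      have : β = 1 - α := by linarith
      subst this
      simp only [Prod.smul_mk, Prod.mk_add_mk, smul_eq_mul]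
      have key : 0 ≤ (x - x') ^ 2 + (y - y') ^ 2 + c * (x - x') * (y - y') := by
        set X := x - x'
        set Y := y - y'
        have h1 : 0 ≤ (1 - c) * (X - Y) ^ 2 := mul_nonneg (by linarith) (sq_nonneg _)
        have h2 : 0 ≤ (1 + c) * (X + Y) ^ 2 := mul_nonneg (by linarith) (sq_nonneg _)
        nlinarith [sq_nonneg X, sq_nonneg Y]
      have := mul_nonneg (mul_nonneg hα hβ) key
      nlinarith
  · exact ⟨_, bmQ p q, by linarith, bmQ_cont h hpq, bmQ_nonneg h hpq, bmQ_le h hpq,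
      fun c hc => bmQ_convex h hpq hc⟩

end


section


/-- continuous with compact support -/
structure CC {d : ℕ} (g : Euc d → ℝ) : Prop where
  cont : Continuous g
  cs : HasCompactSupport g

namespace CC
variable {d : ℕ} {f g : Euc d → ℝ}

lemma integrable (hf : CC f) : Integrable f := hf.cont.integrable_of_hasCompactSupport hf.cs

lemma comp2 (hf : CC f) (hg : CC g) {F : ℝ → ℝ → ℝ} (hF : Continuous fun z : ℝ × ℝ => F z.1 z.2)
    (h0 : F 0 0 = 0) : CC fun x => F (f x) (g x) where
  cont := hF.comp (hf.cont.prodMk hg.cont)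
  cs := hf.cs.comp₂_left hg.cs h0

lemma comp (hf : CC f) {F : ℝ → ℝ} (hF : Continuous F) (h0 : F 0 = 0) : CC fun x => F (f x) where
  cont := hF.comp hf.cont
  cs := hf.cs.comp_left h0

lemma add (hf : CC f) (hg : CC g) : CC fun x => f x + g x :=
  hf.comp2 hg (F := fun a b => a + b) (by fun_prop) (by simp)
lemma sub (hf : CC f) (hg : CC g) : CC fun x => f x - g x :=
  hf.comp2 hg (F := fun a b => a - b) (by fun_prop) (by simp)
lemma mul (hf : CC f) (hg : CC g) : CC fun x => f x * g x :=
  hf.comp2 hg (F := fun a b => a * b) (by fun_prop) (by simp)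
lemma cmul (c : ℝ) (hf : CC f) : CC fun x => c * f x :=
  hf.comp (F := fun a => c * a) (by fun_prop) (by simp)
lemma div (hf : CC f) (c : ℝ) : CC fun x => f x / c :=
  hf.comp (F := fun a => a / c) (by fun_prop) (by simp)
lemma abs (hf : CC f) : CC fun x => |f x| :=
  hf.comp (F := fun a => |a|) (by fun_prop) (by simp)
lemma zero : CC fun _ : Euc d => (0:ℝ) := ⟨continuous_const, HasCompactSupport.zero⟩
lemma sum {ι : Type*} (s : Finset ι) {F : ι → Euc d → ℝ} (h : ∀ i, CC (F i)) :
    CC fun x => ∑ i ∈ s, F i x := by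
  classical
  induction s using Finset.induction_on with
  | empty => simpa using zero
  | insert a s ha ih =>
    simp only [Finset.sum_insert ha]
    exact (h a).add ih
lemma shift (hf : CC f) (v : Euc d) : CC fun x => f (x + v) where
  cont := hf.cont.comp (by fun_prop)
  cs := hf.cs.comp_homeomorph (Homeomorph.addRight v)
lemma shift' (hf : CC f) (v : Euc d) : CC fun x => f (x - v) := by
  simpa [sub_eq_add_neg] using hf.shift (-v)
lemma absPow (hf : CC f) {p : ℝ} (hp : 0 < p) : CC fun x => |f x| ^ p :=
  hf.comp (F := fun a => |a| ^ p) (by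
    have := Real.continuous_rpow_const hp.le
    exact this.comp continuous_abs) (by simp [hp.ne'])
end CC

lemma convex_abs_rpow {p : ℝ} (hp : 1 ≤ p) : ConvexOn ℝ Set.univ (fun t : ℝ => |t| ^ p) := by
  have hp0 : 0 < p := by linarith
  refine ⟨convex_univ, fun a _ b _ s t hs ht hst => ?_⟩
  have h2 := (convexOn_rpow hp).2 (x := |a|) (abs_nonneg a) (y := |b|) (abs_nonneg b) hs ht hst
  refine le_trans (Real.rpow_le_rpow (abs_nonneg _) ?_ hp0.le) h2
  simp only [smul_eq_mul]
  calc |s * a + t * b| ≤ |s * a| + |t * b| := abs_add_le _ _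
    _ = _ := by rw [abs_mul, abs_mul, abs_of_nonneg hs, abs_of_nonneg ht]

lemma abs_add_rpow_le {p : ℝ} (hp : 1 ≤ p) (a b : ℝ) :
    |a + b| ^ p ≤ 2 ^ (p - 1) * (|a| ^ p + |b| ^ p) := by
  have := (convex_abs_rpow hp).2 (x := a) (by simp)
      (y := b) (by simp) (by norm_num : (0:ℝ) ≤ 1/2) (by norm_num : (0:ℝ) ≤ 1/2) (by norm_num)
  simp only [smul_eq_mul] at this
  rw [← mul_add, abs_mul, Real.mul_rpow (abs_nonneg _) (abs_nonneg _), abs_of_pos (by norm_num : (0:ℝ) < 1/2)] at this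
  have h10 : (2:ℝ) ^ (p - 1) = 2 ^ p / 2 := by
    rw [Real.rpow_sub_one (by norm_num)]
  have h11 : (2:ℝ) ^ p * (1 / 2) ^ p = 1 := by
    rw [← Real.mul_rpow (by norm_num) (by norm_num)]; norm_num
  have h12 : (0:ℝ) < 2 ^ p := by positivity
  rw [h10]
  calc |a + b| ^ p = 2 ^ p * ((1/2)^p * |a + b| ^ p) := by rw [← mul_assoc, h11, one_mul]
    _ ≤ 2 ^ p * (1 / 2 * |a| ^ p + 1 / 2 * |b| ^ p) := by gcongr
    _ = _ := by ring

/-- symmetric difference -/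
noncomputable def dd {d : ℕ} (w : Euc d) (g : Euc d → ℝ) (x : Euc d) : ℝ := g (x + w) - g (x - w)

/-- averaging operator -/
noncomputable def avg {d : ℕ} {ι : Type} [Fintype ι] (v : ι → Euc d) (g : Euc d → ℝ) (x : Euc d) : ℝ :=
  ∑ l, (Fintype.card ι : ℝ)⁻¹ * ((g (x + v l) + g (x - v l)) / 2)

section
variable {d : ℕ} {f g : Euc d → ℝ} {ι : Type} [Fintype ι] (v : ι → Euc d)

lemma CC.dd (hf : CC f) (w : Euc d) : CC (dd w f) := (hf.shift w).sub (hf.shift' w)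
lemma CC.avg (hf : CC f) : CC (avg v f) :=
  CC.sum _ fun l => (((hf.shift (v l)).add (hf.shift' (v l))).div 2).cmul _
lemma CC.iter (hf : CC f) (m : ℕ) : CC ((_root_.avg v)^[m] f) := by
  induction m with
  | zero => exact hf
  | succ m ih => rw [Function.iterate_succ_apply']; exact ih.avg v

lemma int_shift (f : Euc d → ℝ) (w : Euc d) : ∫ x, f (x + w) = ∫ x, f x :=
  integral_add_right_eq_self f w
lemma int_shift' (f : Euc d → ℝ) (w : Euc d) : ∫ x, f (x - w) = ∫ x, f x :=
  integral_sub_right_eq_self f w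

lemma dd_parts (hf : CC f) (hg : CC g) (w : Euc d) :
    ∫ x, dd w f x * g x = - ∫ x, f x * dd w g x := by
  have h1 : ∫ x, f (x + w) * g x = ∫ x, f x * g (x - w) := by
    rw [← int_shift (fun x => f x * g (x - w)) w]; simp
  have h2 : ∫ x, f (x - w) * g x = ∫ x, f x * g (x + w) := by
    rw [← int_shift' (fun x => f x * g (x + w)) w]; simp
  have e1 : ∫ x, dd w f x * g x = ∫ x, f (x + w) * g x - f (x - w) * g x := by
    simp only [dd, sub_mul]
  have e2 : ∫ x, f x * dd w g x = ∫ x, f x * g (x + w) - f x * g (x - w) := by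
    simp only [dd, mul_sub]
  rw [e1, e2, integral_sub ((hf.shift w).mul hg).integrable ((hf.shift' w).mul hg).integrable,
    integral_sub (hf.mul (hg.shift w)).integrable (hf.mul (hg.shift' w)).integrable, h1, h2]
  ring

lemma avg_self (hf : CC f) (hg : CC g) :
    ∫ x, avg v f x * g x = ∫ x, f x * avg v g x := by
  simp only [avg, Finset.sum_mul, Finset.mul_sum]
  rw [integral_finsetSum _ fun l _ => (CC.mul ((((hf.shift (v l)).add (hf.shift' (v l))).div 2).cmul _) hg).integrable,
    integral_finsetSum _ fun l _ => (CC.mul hf ((((hg.shift (v l)).add (hg.shift' (v l))).div 2).cmul _)).integrable]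
  refine Finset.sum_congr rfl fun l _ => ?_
  set w := v l
  set n := (Fintype.card ι : ℝ)⁻¹
  have h1 : ∫ x, f (x + w) * g x = ∫ x, f x * g (x - w) := by
    rw [← int_shift (fun x => f x * g (x - w)) w]; simp
  have h2 : ∫ x, f (x - w) * g x = ∫ x, f x * g (x + w) := by
    rw [← int_shift' (fun x => f x * g (x + w)) w]; simp
  have e1 : ∫ x, n * ((f (x + w) + f (x - w)) / 2) * g x =
      ∫ x, (n / 2) * (f (x + w) * g x + f (x - w) * g x) := by
    congr 1; ext x; ring
  have e2 : ∫ x, f x * (n * ((g (x + w) + g (x - w)) / 2)) =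
      ∫ x, (n / 2) * (f x * g (x + w) + f x * g (x - w)) := by
    congr 1; ext x; ring
  rw [e1, e2, integral_const_mul, integral_const_mul,
    integral_add ((hf.shift w).mul hg).integrable ((hf.shift' w).mul hg).integrable,
    integral_add (hf.mul (hg.shift w)).integrable (hf.mul (hg.shift' w)).integrable, h1, h2]
  ring

lemma dd_avg (w : Euc d) (f : Euc d → ℝ) : dd w (avg v f) = avg v (dd w f) := by
  ext x
  simp only [dd, avg, ← Finset.sum_sub_distrib]
  refine Finset.sum_congr rfl fun l _ => ?_
  rw [show x + w + v l = x + v l + w by abel, show x + w - v l = x - v l + w by abel,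
    show x - w + v l = x + v l - w by abel, show x - w - v l = x - v l - w by abel]
  ring

lemma avg_sub' (f g : Euc d → ℝ) : avg v (fun x => f x - g x) = fun x => avg v f x - avg v g x := by
  ext x
  simp only [avg, ← Finset.sum_sub_distrib]
  refine Finset.sum_congr rfl fun l _ => ?_
  ring

lemma iter_sub' (f g : Euc d → ℝ) (m : ℕ) :
    (avg v)^[m] (fun x => f x - g x) = fun x => (avg v)^[m] f x - (avg v)^[m] g x := by
  induction m generalizing f g with
  | zero => rfl
  | succ m ih => rw [Function.iterate_succ_apply, avg_sub', ih]; rfl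

lemma dd_sub' (w : Euc d) (f g : Euc d → ℝ) :
    dd w (fun x => f x - g x) = fun x => dd w f x - dd w g x := by
  ext x; simp only [dd]; ring

/-- Jensen for the averaging operator, pointwise, with two-variable convex function -/
lemma bell_point [Nonempty ι] {p q C : ℝ} {Q : ℝ → ℝ → ℝ} (hQ : IsBellman p q C Q) (f g : Euc d → ℝ)
    (x : Euc d) :
    Q (avg v f x) (avg v g x) ≤ ∑ l, (Fintype.card ι : ℝ)⁻¹ *
      ((Q (f (x + v l)) (g (x + v l)) + Q (f (x - v l)) (g (x - v l))) / 2
        - 1 / 4 * |dd (v l) f x * dd (v l) g x|) := by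
  have hn : (0:ℝ) < Fintype.card ι := by exact_mod_cast Fintype.card_pos
  have h0 := (hQ.conv 0 (by simp)).map_sum_le (t := Finset.univ)
    (w := fun _ : ι => (Fintype.card ι : ℝ)⁻¹)
    (p := fun l => (((f (x + v l) + f (x - v l)) / 2), ((g (x + v l) + g (x - v l)) / 2)))
    (fun _ _ => by positivity) (by simp [hn.ne']) (by simp)
  simp only [zero_mul, add_zero, Prod.fst_sum, Prod.snd_sum, Prod.smul_fst, Prod.smul_snd,
    smul_eq_mul] at h0
  refine h0.trans (Finset.sum_le_sum fun l _ => ?_)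
  refine mul_le_mul_of_nonneg_left ?_ (by positivity)
  have key : ∀ c : ℝ, |c| ≤ 1 → Q ((f (x + v l) + f (x - v l)) / 2) ((g (x + v l) + g (x - v l)) / 2)
      ≤ (Q (f (x + v l)) (g (x + v l)) + Q (f (x - v l)) (g (x - v l))) / 2
        + c / 4 * (dd (v l) f x * dd (v l) g x) := by
    intro c hc
    have := (hQ.conv c hc).2 (x := (f (x + v l), g (x + v l))) (by simp)
      (y := (f (x - v l), g (x - v l))) (by simp) (by norm_num : (0:ℝ) ≤ 1/2) (by norm_num : (0:ℝ) ≤ 1/2) (by norm_num)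
    simp only [Prod.fst_add,
        Prod.snd_add, Prod.smul_fst, Prod.smul_snd, smul_eq_mul] at this
    rw [show 1 / 2 * f (x + v l) + 1 / 2 * f (x - v l) = (f (x + v l) + f (x - v l)) / 2 by ring,
      show 1 / 2 * g (x + v l) + 1 / 2 * g (x - v l) = (g (x + v l) + g (x - v l)) / 2 by ring] at this
    simp only [dd]
    linarith
  rcases le_total 0 (dd (v l) f x * dd (v l) g x) with h | h
  · rw [abs_of_nonneg h]; have := key (-1) (by simp); linarith
  · rw [abs_of_nonpos h]; have := key 1 (by simp); linarith

lemma bell_zero {p q C : ℝ} {Q : ℝ → ℝ → ℝ} (hQ : IsBellman p q C Q) (hp : 0 < p) (hq : 0 < q) :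
    Q 0 0 = 0 := by
  apply le_antisymm _ (hQ.nonneg _ _)
  simpa [hp.ne', hq.ne'] using hQ.le 0 0

lemma bell_step [Nonempty ι] {p q C : ℝ} {Q : ℝ → ℝ → ℝ} (hQ : IsBellman p q C Q)
    (hp : 0 < p) (hq : 0 < q) (hf : CC f) (hg : CC g) :
    (∫ x, Q (avg v f x) (avg v g x)) + (4 * (Fintype.card ι : ℝ))⁻¹ *
      ∑ l, ∫ x, |dd (v l) f x * dd (v l) g x| ≤ ∫ x, Q (f x) (g x) := by
  have hn : (0:ℝ) < Fintype.card ι := by exact_mod_cast Fintype.card_pos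
  have h00 := bell_zero hQ hp hq
  have hcc : CC fun x => Q (f x) (g x) := hf.comp2 hg hQ.cont h00
  have hcd : ∀ l, CC fun x => |dd (v l) f x * dd (v l) g x| := fun l => ((hf.dd _).mul (hg.dd _)).abs
  have h1 := integral_mono ((hf.avg v).comp2 (hg.avg v) hQ.cont h00).integrable
    (CC.sum Finset.univ fun l => ((((hcc.shift (v l)).add (hcc.shift' (v l))).div 2).sub
      ((hcd l).cmul (1/4))).cmul (Fintype.card ι : ℝ)⁻¹).integrable (fun x => bell_point v hQ f g x)
  have h2 : ∀ l, ∫ x, (Fintype.card ι : ℝ)⁻¹ *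
      ((Q (f (x + v l)) (g (x + v l)) + Q (f (x - v l)) (g (x - v l))) / 2
        - 1 / 4 * |dd (v l) f x * dd (v l) g x|) = (Fintype.card ι : ℝ)⁻¹ * ((∫ x, Q (f x) (g x))
          - 1 / 4 * ∫ x, |dd (v l) f x * dd (v l) g x|) := by
    intro l
    rw [integral_const_mul, integral_sub (((hcc.shift (v l)).add (hcc.shift' (v l))).div 2).integrable
      ((hcd l).cmul (1/4)).integrable, integral_const_mul, integral_div,
      integral_add (hcc.shift (v l)).integrable (hcc.shift' (v l)).integrable,
      int_shift (fun x => Q (f x) (g x)), int_shift' (fun x => Q (f x) (g x))]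
    ring
  rw [integral_finsetSum _ fun l _ => ((((hcc.shift (v l)).add (hcc.shift' (v l))).div 2).sub
      ((hcd l).cmul (1/4))).cmul (Fintype.card ι : ℝ)⁻¹ |>.integrable] at h1
  simp only [h2] at h1
  rw [← Finset.mul_sum, Finset.sum_sub_distrib, ← Finset.mul_sum] at h1
  simp only [Finset.sum_const, Finset.card_univ, nsmul_eq_mul] at h1
  rw [mul_sub, inv_mul_cancel_left₀ hn.ne'] at h1
  rw [mul_inv]
  linarith

lemma bell_sum [Nonempty ι] {p q C : ℝ} {Q : ℝ → ℝ → ℝ} (hQ : IsBellman p q C Q)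
    (hp : 0 < p) (hq : 0 < q) (hf : CC f) (hg : CC g) (l : ι) (M : ℕ) :
    ∑ m ∈ Finset.range M, ∫ x, |dd (v l) ((avg v)^[m] f) x * dd (v l) ((avg v)^[m] g) x| ≤
      4 * (Fintype.card ι : ℝ) * (C * ∫ x, |f x| ^ p + |g x| ^ q) := by
  have hn : (0:ℝ) < Fintype.card ι := by exact_mod_cast Fintype.card_pos
  have h00 := bell_zero hQ hp hq
  have h1 : (∫ x, Q ((avg v)^[M] f x) ((avg v)^[M] g x)) + (4 * (Fintype.card ι : ℝ))⁻¹ *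
      ∑ m ∈ Finset.range M, ∫ x, |dd (v l) ((avg v)^[m] f) x * dd (v l) ((avg v)^[m] g) x| ≤
      ∫ x, Q (f x) (g x) := by
    induction M with
    | zero => simp
    | succ M ih =>
      have h := bell_step v hQ hp hq (hf.iter v M) (hg.iter v M)
      have h2 : ∫ x, |dd (v l) ((avg v)^[M] f) x * dd (v l) ((avg v)^[M] g) x| ≤
        ∑ l, ∫ x, |dd (v l) ((avg v)^[M] f) x * dd (v l) ((avg v)^[M] g) x| :=
        Finset.single_le_sum (f := fun l => ∫ x, |dd (v l) ((avg v)^[M] f) x * dd (v l) ((avg v)^[M] g) x|)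
          (fun l _ => integral_nonneg fun x => abs_nonneg _) (Finset.mem_univ l)
      have h3 := mul_le_mul_of_nonneg_left h2 (show 0 ≤ (4 * (Fintype.card ι : ℝ))⁻¹ by positivity)
      rw [Finset.sum_range_succ, mul_add, Function.iterate_succ_apply', Function.iterate_succ_apply']
      linarith
  have h2 : 0 ≤ ∫ x, Q ((avg v)^[M] f x) ((avg v)^[M] g x) := integral_nonneg fun x => hQ.nonneg _ _
  have h3 : ∫ x, Q (f x) (g x) ≤ C * ∫ x, |f x| ^ p + |g x| ^ q := by
    rw [← integral_const_mul]
    exact integral_mono (hf.comp2 hg hQ.cont h00).integrable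
      (((hf.absPow hp).add (hg.absPow hq)).cmul C).integrable (fun x => hQ.le _ _)
  have h4 : (4 * (Fintype.card ι : ℝ))⁻¹ *
      ∑ m ∈ Finset.range M, ∫ x, |dd (v l) ((avg v)^[m] f) x * dd (v l) ((avg v)^[m] g) x| ≤
      C * ∫ x, |f x| ^ p + |g x| ^ q := by linarith
  rwa [inv_mul_le_iff₀ (by positivity)] at h4

/-- bilinear form -/
noncomputable def bil (w : Euc d) (f g : Euc d → ℝ) : ℝ := ∫ x, dd w f x * dd w g x

lemma bil_avg (hf : CC f) (hg : CC g) (w : Euc d) : bil w (avg v f) g = bil w f (avg v g) := by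
  simp only [bil, dd_avg]
  exact avg_self v (hf.dd w) (hg.dd w)

lemma bil_telescope (hf : CC f) (hg : CC g) (w : Euc d) (M : ℕ) :
    ∑ m ∈ Finset.range M, bil w ((avg v)^[m] (fun x => f x - avg v (avg v f) x)) ((avg v)^[m] g)
      = bil w f g - bil w ((avg v)^[M] f) ((avg v)^[M] g) := by
  induction M with
  | zero => simp
  | succ M ih =>
    rw [Finset.sum_range_succ, ih, iter_sub']
    have : bil w (fun x => (avg v)^[M] f x - (avg v)^[M] (avg v (avg v f)) x) ((avg v)^[M] g) =
        bil w ((avg v)^[M] f) ((avg v)^[M] g) - bil w ((avg v)^[M+1] f) ((avg v)^[M+1] g) := by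
      rw [Function.iterate_succ_apply' _ M g, ← bil_avg v (hf.iter v (M+1)) (hg.iter v M)]
      rw [← Function.iterate_succ_apply, ← Function.iterate_succ_apply, ← Function.iterate_succ_apply' (avg v)]
      simp only [bil, dd_sub', sub_mul]
      rw [integral_sub (((hf.iter v _).dd w).mul ((hg.iter v _).dd w)).integrable
        (((hf.iter v _).dd w).mul ((hg.iter v _).dd w)).integrable]
    rw [this]; ring

lemma bil_tendsto [Nonempty ι] (hf : CC f) (l : ι) :
    Tendsto (fun M => bil (v l) ((avg v)^[M] f) ((avg v)^[M] f)) atTop (𝓝 0) := by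
  obtain ⟨C, Q, hC, hQ⟩ := exists_bellman (p := 2) (q := 2) (by norm_num) (by norm_num)
  have h : Summable fun m => ∫ x, |dd (v l) ((avg v)^[m] f) x * dd (v l) ((avg v)^[m] f) x| :=
    summable_of_sum_range_le (fun m => integral_nonneg fun x => abs_nonneg _)
      (bell_sum v hQ (by norm_num) (by norm_num) hf hf l)
  have := h.tendsto_atTop_zero
  simpa only [bil, abs_mul_self] using this

lemma bil_le (hf : CC f) (hg : CC g) (w : Euc d) : |bil w f g| ≤ bil w f f + bil w g g := by
  unfold bil
  refine (abs_integral_le_integral_abs).trans ?_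
  rw [← integral_add ((hf.dd w).mul (hf.dd w)).integrable ((hg.dd w).mul (hg.dd w)).integrable]
  refine integral_mono ((hf.dd w).mul (hg.dd w)).abs.integrable
    (((hf.dd w).mul (hf.dd w)).add ((hg.dd w).mul (hg.dd w))).integrable fun x => ?_
  simp only
  rw [abs_le]
  constructor <;> nlinarith [sq_nonneg (dd w f x + dd w g x), sq_nonneg (dd w f x - dd w g x),
    sq_nonneg (dd w f x), sq_nonneg (dd w g x)]

lemma bil_tendsto2 [Nonempty ι] (hf : CC f) (hg : CC g) (l : ι) :
    Tendsto (fun M => bil (v l) ((avg v)^[M] f) ((avg v)^[M] g)) atTop (𝓝 0) := by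
  refine squeeze_zero_norm (fun M => ?_) (by simpa using (bil_tendsto v hf l).add (bil_tendsto v hg l))
  rw [Real.norm_eq_abs]
  exact bil_le (hf.iter v M) (hg.iter v M) _

lemma bil_bound [Nonempty ι] {p q C : ℝ} {Q : ℝ → ℝ → ℝ} (hQ : IsBellman p q C Q)
    (hp : 0 < p) (hq : 0 < q) (hf : CC f) (hg : CC g) (l : ι) :
    |bil (v l) f g| ≤
      4 * (Fintype.card ι : ℝ) * (C * ∫ x, |f x - avg v (avg v f) x| ^ p + |g x| ^ q) := by
  have hF : CC fun x => f x - avg v (avg v f) x := hf.sub ((hf.avg v).avg v)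
  have ht : Tendsto (fun M => |bil (v l) f g - bil (v l) ((avg v)^[M] f) ((avg v)^[M] g)|) atTop
      (𝓝 |bil (v l) f g|) := by
    simpa using (tendsto_const_nhds.sub (bil_tendsto2 v hf hg l)).abs
  refine le_of_tendsto' ht fun M => ?_
  rw [← bil_telescope v hf hg]
  refine (Finset.abs_sum_le_sum_abs _ _).trans ((Finset.sum_le_sum fun m _ => ?_).trans
    (bell_sum v hQ hp hq hF hg l M))
  exact abs_integral_le_integral_abs

/-- signed power -/
noncomputable def spow (r : ℝ) (w : ℝ) : ℝ := (max w 0) ^ r - (max (-w) 0) ^ r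

lemma spow_cont {r : ℝ} (hr : 0 < r) : Continuous (spow r) := by
  unfold spow
  have := Real.continuous_rpow_const hr.le
  exact (this.comp (by fun_prop)).sub (this.comp (by fun_prop))

lemma spow_zero {r : ℝ} : spow r 0 = 0 := by simp [spow]

lemma mul_spow {p : ℝ} (hp : 1 < p) (w : ℝ) : w * spow (p - 1) w = |w| ^ p := by
  have h0 : p - 1 ≠ 0 := by linarith
  have h1 : ∀ t : ℝ, 0 ≤ t → t * t ^ (p - 1) = t ^ p := by
    intro t ht
    rcases ht.eq_or_lt with rfl | ht
    · simp; rw [Real.zero_rpow]; linarith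
    · nth_rewrite 1 [← Real.rpow_one t]
      rw [← Real.rpow_add ht]; congr 1; ring
  rcases le_total 0 w with h | h
  · rw [spow, max_eq_left h, max_eq_right (by linarith), Real.zero_rpow h0, sub_zero, abs_of_nonneg h, h1 w h]
  · rw [spow, max_eq_right h, max_eq_left (by linarith), Real.zero_rpow h0, zero_sub, abs_of_nonpos h, ← h1 (-w) (by linarith)]
    ring

lemma abs_spow {p q : ℝ} (hp : 1 < p) (hpq : p⁻¹ + q⁻¹ = 1) (w : ℝ) :
    |spow (p - 1) w| ^ q = |w| ^ p := by
  have h0 : p - 1 ≠ 0 := by linarith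
  have hq : (p - 1) * q = p := by
    have hp0 : p ≠ 0 := by linarith
    have hq0 : q ≠ 0 := by
      rintro rfl
      simp at hpq; linarith
    field_simp at hpq
    linarith
  have h1 : |spow (p-1) w| = |w| ^ (p - 1) := by
    rcases le_total 0 w with h | h
    · rw [spow, max_eq_left h, max_eq_right (by linarith), Real.zero_rpow h0, sub_zero, abs_of_nonneg h, abs_of_nonneg (by positivity)]
    · rw [spow, max_eq_right h, max_eq_left (by linarith), Real.zero_rpow h0, zero_sub, abs_of_nonpos h, abs_neg, abs_of_nonneg]
      exact Real.rpow_nonneg (by linarith) _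
  rw [h1, ← Real.rpow_mul (abs_nonneg _), hq]

lemma dd_cmul (w : Euc d) (c : ℝ) (f : Euc d → ℝ) : dd w (fun x => c * f x) = fun x => c * dd w f x := by
  ext x; simp only [dd]; ring

lemma avg_cmul (c : ℝ) (f : Euc d → ℝ) : avg v (fun x => c * f x) = fun x => c * avg v f x := by
  ext x
  simp only [avg, Finset.mul_sum]
  refine Finset.sum_congr rfl fun l _ => ?_
  ring

lemma avg_pow_le [Nonempty ι] {p : ℝ} (hp : 1 < p) (hf : CC f) :
    ∫ x, |avg v f x| ^ p ≤ ∫ x, |f x| ^ p := by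
  have hn : (0:ℝ) < Fintype.card ι := by exact_mod_cast Fintype.card_pos
  have hp0 : 0 < p := by linarith
  have hc := hf.absPow hp0
  have hconv := convex_abs_rpow hp.le
  have hpt : ∀ x, |avg v f x| ^ p ≤ ∑ l, (Fintype.card ι : ℝ)⁻¹ *
      ((|f (x + v l)| ^ p + |f (x - v l)| ^ p) / 2) := by
    intro x
    have h0 := hconv.map_sum_le (t := Finset.univ)
      (w := fun _ : ι => (Fintype.card ι : ℝ)⁻¹) (p := fun l => (f (x + v l) + f (x - v l)) / 2)
      (fun _ _ => by positivity) (by simp [hn.ne']) (by simp)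
    simp only [smul_eq_mul] at h0
    refine h0.trans (Finset.sum_le_sum fun l _ => ?_)
    refine mul_le_mul_of_nonneg_left ?_ (by positivity)
    have := hconv.2 (x := f (x + v l)) (by simp)
      (y := f (x - v l)) (by simp) (by norm_num : (0:ℝ) ≤ 1/2) (by norm_num : (0:ℝ) ≤ 1/2) (by norm_num)
    simp only [smul_eq_mul] at this
    rw [show (f (x + v l) + f (x - v l)) / 2 = 1 / 2 * f (x + v l) + 1 / 2 * f (x - v l) by ring]
    linarith
  have hi : ∀ l, CC fun x => (Fintype.card ι : ℝ)⁻¹ * ((|f (x + v l)| ^ p + |f (x - v l)| ^ p) / 2) :=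
    fun l => (((hc.shift (v l)).add (hc.shift' (v l))).div 2).cmul _
  refine (integral_mono ((hf.avg v).absPow hp0).integrable (CC.sum Finset.univ hi).integrable hpt).trans ?_
  rw [integral_finsetSum _ fun l _ => (hi l).integrable]
  have : ∀ l, ∫ x, (Fintype.card ι : ℝ)⁻¹ * ((|f (x + v l)| ^ p + |f (x - v l)| ^ p) / 2) =
      (Fintype.card ι : ℝ)⁻¹ * ∫ x, |f x| ^ p := by
    intro l
    rw [integral_const_mul, integral_div, integral_add (hc.shift (v l)).integrable (hc.shift' (v l)).integrable,
      int_shift (fun x => |f x| ^ p), int_shift' (fun x => |f x| ^ p)]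
    ring
  simp only [this, Finset.sum_const, Finset.card_univ, nsmul_eq_mul]
  rw [mul_inv_cancel_left₀ hn.ne']

end

/-- discrete estimate -/
theorem discrete_main {p : ℝ} (hp : 1 < p) (ι : Type) [Fintype ι] [Nonempty ι] :
    ∃ C : ℝ, 0 < C ∧ ∀ (d : ℕ) (v : ι → Euc d) (u : Euc d → ℝ), CC u → ∀ l,
      ∫ x, |dd (v l) (dd (v l) u) x| ^ p ≤ C * ∫ x, |u x - avg v u x| ^ p := by
  have hn : (0:ℝ) < Fintype.card ι := by exact_mod_cast Fintype.card_pos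
  have hp0 : 0 < p := by linarith
  set q : ℝ := (1 - p⁻¹)⁻¹ with hqd
  have hpi : p⁻¹ < 1 := inv_lt_one_of_one_lt₀ hp
  have hq : 0 < q := inv_pos.2 (by linarith)
  have hpq : p⁻¹ + q⁻¹ = 1 := by rw [hqd, inv_inv]; ring
  obtain ⟨C, Q, hC, hQ⟩ := exists_bellman hp hpq
  set t : ℝ := 8 * (Fintype.card ι : ℝ) * C with ht
  have ht0 : 0 < t := by positivity
  refine ⟨t ^ p * 2 ^ p, by positivity, fun d v u hu l => ?_⟩
  set w := dd (v l) (dd (v l) u) with hw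
  have hwc : CC w := (hu.dd _).dd _
  have hφ : CC fun x => spow (p - 1) (w x) := hwc.comp (spow_cont (by linarith)) spow_zero
  have hF := hu.sub ((hu.avg v).avg v)
  have h1 := bil_bound v hQ hp0 hq (hu.cmul t) hφ l
  have h2 : bil (v l) (fun x => t * u x) (fun x => spow (p - 1) (w x)) = - (t * ∫ x, |w x| ^ p) := by
    unfold bil
    have := dd_parts ((hu.cmul t).dd (v l)) hφ (v l)
    rw [← neg_eq_iff_eq_neg] at this
    rw [← this, dd_cmul, dd_cmul, ← integral_const_mul]
    congr 2
    ext x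
    rw [mul_assoc, mul_spow hp]
  have h3 : ∫ x, |t * u x - avg v (avg v fun x => t * u x) x| ^ p + |spow (p - 1) (w x)| ^ q =
      t ^ p * (∫ x, |u x - avg v (avg v u) x| ^ p) + ∫ x, |w x| ^ p := by
    rw [← integral_const_mul, ← integral_add ((hF.absPow hp0).cmul _).integrable (hwc.absPow hp0).integrable]
    congr 1; ext x
    rw [abs_spow hp hpq, avg_cmul, avg_cmul, ← mul_sub, abs_mul, Real.mul_rpow (abs_nonneg _) (abs_nonneg _),
      abs_of_pos ht0]
  rw [h2, h3, abs_neg, abs_of_nonneg (by positivity)] at h1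
  set W := ∫ x, |w x| ^ p
  have h4 : W ≤ t ^ p * ∫ x, |u x - avg v (avg v u) x| ^ p := by
    have h5 : t * W ≤ t / 2 * (t ^ p * (∫ x, |u x - avg v (avg v u) x| ^ p) + W) := by
      refine h1.trans (le_of_eq ?_)
      rw [ht]; ring
    have h6 : t * W ≤ t * (t ^ p * ∫ x, |u x - avg v (avg v u) x| ^ p) := by linarith
    exact le_of_mul_le_mul_left h6 ht0
  refine h4.trans ?_
  rw [mul_assoc]
  refine mul_le_mul_of_nonneg_left ?_ (by positivity)
  have hG := hu.sub (hu.avg v)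
  have h7 : ∀ x, |u x - avg v (avg v u) x| ^ p ≤
      2 ^ (p - 1) * (|u x - avg v u x| ^ p + |avg v (fun y => u y - avg v u y) x| ^ p) := by
    intro x
    rw [avg_sub']
    have := abs_add_rpow_le hp.le (u x - avg v u x) (avg v u x - avg v (avg v u) x)
    rwa [sub_add_sub_cancel] at this
  have h8 := integral_mono (hF.absPow hp0).integrable
    (((hG.absPow hp0).add ((hG.avg v).absPow hp0)).cmul _).integrable h7
  rw [integral_const_mul, integral_add (hG.absPow hp0).integrable ((hG.avg v).absPow hp0).integrable] at h8
  have h9 := avg_pow_le v hp hG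
  refine h8.trans ?_
  have h10 : (2:ℝ) ^ p = 2 ^ (p - 1) * 2 := by
    rw [Real.rpow_sub_one (by norm_num)]; ring
  rw [h10, mul_assoc]
  refine mul_le_mul_of_nonneg_left ?_ (by positivity)
  linarith

end


section


/-- second derivative -/
noncomputable def hs {d : ℕ} (u : Euc d → ℝ) (x w w' : Euc d) : ℝ := fderiv ℝ (fderiv ℝ u) x w w'

section
variable {d : ℕ} {u : Euc d → ℝ}

lemma sm_fderiv (hu : ContDiff ℝ (⊤ : ℕ∞) u) : ContDiff ℝ (⊤ : ℕ∞) (fderiv ℝ u) :=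
  hu.fderiv_right (by norm_cast)

lemma sm_diff (hu : ContDiff ℝ (⊤ : ℕ∞) u) : Differentiable ℝ u :=
  hu.differentiable (by simp)

lemma hs_cont (hu : ContDiff ℝ (⊤ : ℕ∞) u) (w w' : Euc d) : Continuous fun x => hs u x w w' := by
  have h2 : Continuous (fderiv ℝ (fderiv ℝ u)) := (sm_fderiv hu).continuous_fderiv (by simp)
  unfold hs
  fun_prop

lemma line_deriv1 (hu : ContDiff ℝ (⊤ : ℕ∞) u) (x w : Euc d) (t : ℝ) :
    HasDerivAt (fun t : ℝ => u (x + t • w)) (fderiv ℝ u (x + t • w) w) t := by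
  have h1 : HasDerivAt (fun t : ℝ => x + t • w) w t := by
    simpa using ((hasDerivAt_id t).smul_const w).const_add x
  exact ((sm_diff hu) (x + t • w)).hasFDerivAt.comp_hasDerivAt t h1

lemma line_deriv2 (hu : ContDiff ℝ (⊤ : ℕ∞) u) (x w : Euc d) (t : ℝ) :
    HasDerivAt (fun t : ℝ => fderiv ℝ u (x + t • w) w) (hs u (x + t • w) w w) t := by
  have h1 : HasDerivAt (fun t : ℝ => x + t • w) w t := by
    simpa using ((hasDerivAt_id t).smul_const w).const_add x
  have h2 := (((sm_fderiv hu).differentiable (by simp)) (x + t • w)).hasFDerivAt.comp_hasDerivAt t h1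
  exact h2.clm_apply (hasDerivAt_const t w) |>.congr_deriv (by simp [hs])

lemma second_diff (hu : ContDiff ℝ (⊤ : ℕ∞) u) (x w : Euc d) {s ω : ℝ} (hs0 : 0 ≤ s)
    (H : ∀ r : ℝ, |r| ≤ s → |hs u (x + r • w) w w - hs u x w w| ≤ ω) :
    |u (x + s • w) + u (x - s • w) - 2 * u x - s ^ 2 * hs u x w w| ≤ 2 * s ^ 2 * ω := by
  set A := hs u x w w
  -- first derivative
  have h1 : ∀ t ∈ Set.Icc 0 s, |fderiv ℝ u (x + t • w) w - fderiv ℝ u (x - t • w) w - 2 * t * A| ≤ 2 * s * ω := by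
    intro t ht
    have hd : ∀ r ∈ Set.Icc (-t) t, HasDerivWithinAt (fun r : ℝ => fderiv ℝ u (x + r • w) w - r * A)
        (hs u (x + r • w) w w - A) (Set.Icc (-t) t) r := by
      intro r _
      exact ((line_deriv2 hu x w r).sub (((hasDerivAt_id r).mul_const A))).hasDerivWithinAt.congr_deriv (by simp)
    have := norm_image_sub_le_of_norm_deriv_le_segment' hd (C := ω) (fun r hr => by
      rw [Real.norm_eq_abs]
      exact H r (abs_le.2 ⟨by linarith [hr.1, ht.2], by linarith [hr.2, ht.2]⟩)) t ⟨by linarith [ht.1], le_rfl⟩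
    rw [Real.norm_eq_abs] at this
    have hω : 0 ≤ ω := (abs_nonneg _).trans (H 0 (by simpa using hs0))
    have e : fderiv ℝ u (x + t • w) w - t * A - (fderiv ℝ u (x + -t • w) w - -t * A) =
      fderiv ℝ u (x + t • w) w - fderiv ℝ u (x - t • w) w - 2 * t * A := by
      rw [neg_smul, ← sub_eq_add_neg]; ring
    rw [e] at this
    refine this.trans ?_
    nlinarith [ht.2]
  have hd : ∀ t ∈ Set.Icc 0 s, HasDerivWithinAt (fun t : ℝ => u (x + t • w) + u (x - t • w) - 2 * u x - t ^ 2 * A)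
      (fderiv ℝ u (x + t • w) w - fderiv ℝ u (x - t • w) w - 2 * t * A) (Set.Icc 0 s) t := by
    intro t _
    have e1 : HasDerivAt (fun t : ℝ => u (x - t • w)) (- fderiv ℝ u (x - t • w) w) t := by
      have := line_deriv1 hu x (-w) t
      simp only [smul_neg, ← sub_eq_add_neg, map_neg] at this
      exact this
    have e2 : HasDerivAt (fun t : ℝ => t ^ 2 * A) (2 * t * A) t := by
      exact ((hasDerivAt_pow 2 t).mul_const A).congr_deriv (by simp)
    exact ((((line_deriv1 hu x w t).add e1).sub_const (2 * u x)).sub e2).hasDerivWithinAt.congr_deriv (by ring)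
  have := norm_image_sub_le_of_norm_deriv_le_segment' hd (C := 2 * s * ω) (fun t ht => by
    rw [Real.norm_eq_abs]
    exact h1 t ⟨ht.1, ht.2.le⟩) s ⟨hs0, le_rfl⟩
  rw [Real.norm_eq_abs] at this
  have e : u (x + s • w) + u (x - s • w) - 2 * u x - s ^ 2 * A -
      (u (x + (0:ℝ) • w) + u (x - (0:ℝ) • w) - 2 * u x - 0 ^ 2 * A) =
      u (x + s • w) + u (x - s • w) - 2 * u x - s ^ 2 * A := by
    simp; ring
  rw [e] at this
  refine this.trans (le_of_eq (by ring))

lemma second_diff_tendsto (hu : ContDiff ℝ (⊤ : ℕ∞) u) (x w : Euc d) {h : ℕ → ℝ} (h0 : ∀ n, 0 < h n)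
    (ht : Tendsto h atTop (𝓝 0)) :
    Tendsto (fun n => (u (x + h n • w) + u (x - h n • w) - 2 * u x) / h n ^ 2) atTop (𝓝 (hs u x w w)) := by
  rw [Metric.tendsto_nhds]
  intro ε hε
  have hc : Continuous fun r : ℝ => hs u (x + r • w) w w :=
    (hs_cont hu w w).comp (f := fun r : ℝ => x + r • w) (by fun_prop)
  obtain ⟨δ, hδ, H⟩ := Metric.continuous_iff.1 hc 0 (ε / 4) (by linarith)
  filter_upwards [ht.eventually (gt_mem_nhds hδ)] with n hn
  have h3 := second_diff hu x w (h0 n).le (ω := ε / 4) (fun r hr => by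
    have := H r (by simpa using lt_of_le_of_lt hr hn)
    simp only [zero_smul, add_zero, Real.dist_eq] at this
    exact this.le)
  have hp : 0 < h n ^ 2 := pow_pos (h0 n) 2
  rw [Real.dist_eq, show (u (x + h n • w) + u (x - h n • w) - 2 * u x) / h n ^ 2 - hs u x w w =
    (u (x + h n • w) + u (x - h n • w) - 2 * u x - h n ^ 2 * hs u x w w) / h n ^ 2 by
      rw [sub_div _ (h n ^ 2 * hs u x w w), mul_div_cancel_left₀ _ hp.ne'], abs_div,
    abs_of_pos hp, div_lt_iff₀ hp]
  nlinarith

lemma second_diff_bound (hu : ContDiff ℝ (⊤ : ℕ∞) u) {w : Euc d} {M : ℝ} (hM : ∀ x, |hs u x w w| ≤ M) (x : Euc d)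
    {h : ℝ} (h0 : 0 < h) : |(u (x + h • w) + u (x - h • w) - 2 * u x) / h ^ 2| ≤ 5 * M := by
  have h3 := second_diff hu x w h0.le (ω := 2 * M) (fun r hr => by
    have := abs_sub (hs u (x + r • w) w w) (hs u x w w)
    linarith [hM x, hM (x + r • w)])
  have hp : 0 < h ^ 2 := pow_pos h0 2
  rw [abs_div, abs_of_pos hp, div_le_iff₀ hp]
  have := abs_add_le (u (x + h • w) + u (x - h • w) - 2 * u x - h ^ 2 * hs u x w w) (h ^ 2 * hs u x w w)
  rw [sub_add_cancel, abs_mul, abs_of_pos hp] at this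
  nlinarith [mul_le_mul_of_nonneg_left (hM x) hp.le]

lemma hs_cs (hc : HasCompactSupport u) (w w' : Euc d) : HasCompactSupport fun x => hs u x w w' := by
  have := (hc.fderiv (𝕜 := ℝ)).fderiv (𝕜 := ℝ)
  exact this.comp_left (g := fun L => L w w') (by simp)

lemma hs_CC (hu : ContDiff ℝ (⊤ : ℕ∞) u) (hc : HasCompactSupport u) (w w' : Euc d) : CC fun x => hs u x w w' :=
  ⟨hs_cont hu w w', hs_cs hc w w'⟩

lemma CC.bdd {f : Euc d → ℝ} (hf : CC f) : ∃ M, 0 ≤ M ∧ ∀ x, |f x| ≤ M := by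
  obtain ⟨M, hM⟩ := hf.cs.exists_bound_of_continuous hf.cont
  exact ⟨M, (norm_nonneg _).trans (hM 0), hM⟩

/-- convergence of the p-integrals -/
lemma int_conv {p : ℝ} (hp : 0 < p) {F : ℕ → Euc d → ℝ} {G : Euc d → ℝ} (hF : ∀ n, Continuous (F n))
    {K : Set (Euc d)} (hK : IsCompact K) (hFK : ∀ n x, x ∉ K → F n x = 0) {M : ℝ} (hM : ∀ n x, |F n x| ≤ M)
    (ht : ∀ x, Tendsto (fun n => F n x) atTop (𝓝 (G x))) :
    Tendsto (fun n => ∫ x, |F n x| ^ p) atTop (𝓝 (∫ x, |G x| ^ p)) := by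
  have hc : Continuous fun t : ℝ => |t| ^ p := (Real.continuous_rpow_const hp.le).comp continuous_abs
  refine tendsto_integral_of_dominated_convergence (K.indicator fun _ => M ^ p) ?_ ?_ ?_ ?_
  · intro n
    exact (hc.comp (hF n)).aestronglyMeasurable
  · exact (integrable_indicator_iff hK.measurableSet).2 (integrableOn_const hK.measure_lt_top.ne)
  · intro n
    refine Eventually.of_forall fun x => ?_
    rw [Real.norm_eq_abs, abs_of_nonneg (by positivity)]
    by_cases hx : x ∈ K
    · rw [Set.indicator_of_mem hx]
      exact Real.rpow_le_rpow (abs_nonneg _) (hM n x) hp.le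
    · rw [hFK n x hx]; simp [hp.ne', hx]
  · exact Eventually.of_forall fun x => (hc.tendsto _).comp (ht x)

lemma second_diff_supp (hc : HasCompactSupport u) (w : Euc d) {h : ℝ} (h0 : 0 < h) (h1 : h ≤ 2) {R : ℝ}
    (hR : ∀ x, u x ≠ 0 → ‖x‖ ≤ R) (x : Euc d) (hx : x ∉ Metric.closedBall (0 : Euc d) (R + 2 * ‖w‖)) :
    u (x + h • w) + u (x - h • w) - 2 * u x = 0 := by
  simp only [Metric.mem_closedBall, dist_zero_right, not_le] at hx
  have hw : ‖h • w‖ ≤ 2 * ‖w‖ := by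
    rw [norm_smul, Real.norm_eq_abs, abs_of_pos h0]; gcongr
  have a1 : u (x + h • w) = 0 := by
    by_contra hh
    have := hR _ hh
    have := norm_le_add_norm_add x (h • w)
    linarith
  have a2 : u (x - h • w) = 0 := by
    by_contra hh
    have := hR _ hh
    have := norm_le_norm_add_norm_sub' x (h • w)
    linarith
  have a3 : u x = 0 := by
    by_contra hh
    have := hR _ hh
    linarith [norm_nonneg w]
  rw [a1, a2, a3]; simp

end

theorem dir_main {p : ℝ} (hp : 1 < p) (ι : Type) [Fintype ι] [Nonempty ι] :
    ∃ C : ℝ, 0 < C ∧ ∀ (d : ℕ) (ε : ι → Euc d) (u : Euc d → ℝ), ContDiff ℝ (⊤ : ℕ∞) u →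
      HasCompactSupport u → ∀ i,
      ∫ x, |hs u x (ε i) (ε i)| ^ p ≤ C * ∫ x, |∑ l, hs u x (ε l) (ε l)| ^ p := by
  have hn : (0:ℝ) < Fintype.card ι := by exact_mod_cast Fintype.card_pos
  have hp0 : 0 < p := by linarith
  obtain ⟨C, hC, H⟩ := discrete_main hp ι
  refine ⟨C, hC, fun d ε u hu hc i => ?_⟩
  have hcu : CC u := ⟨hu.continuous, hc⟩
  obtain ⟨R, hR⟩ : ∃ R, ∀ x, u x ≠ 0 → ‖x‖ ≤ R := by
    obtain ⟨R, hR⟩ := hc.isCompact.isBounded.exists_norm_le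
    exact ⟨R, fun x hx => hR x (subset_tsupport u hx)⟩
  set h : ℕ → ℝ := fun n => 1 / ((n:ℝ) + 1) with hh
  have h0 : ∀ n, 0 < h n := fun n => by rw [hh]; positivity
  have h1 : ∀ n, h n ≤ 1 := fun n => by
    rw [hh]
    exact div_le_one_of_le₀ (by linarith [(Nat.cast_nonneg n : (0:ℝ) ≤ n)]) (by positivity)
  have ht : Tendsto h atTop (𝓝 0) := tendsto_one_div_add_atTop_nhds_zero_nat
  set S : ℕ → ι → Euc d → ℝ := fun n l x => (u (x + h n • ε l) + u (x - h n • ε l) - 2 * u x) / h n ^ 2 with hS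
  choose M hM0 hM using fun l => (hs_CC hu hc (ε l) (ε l)).bdd
  -- the right side
  have hSc : ∀ n l, Continuous (S n l) := fun n l =>
    ((((hcu.shift (h n • ε l)).add (hcu.shift' (h n • ε l))).sub (hcu.cmul 2)).div _).cont
  have hRt : Tendsto (fun n => ∫ x, |∑ l, S n l x| ^ p) atTop (𝓝 (∫ x, |∑ l, hs u x (ε l) (ε l)| ^ p)) := by
    refine int_conv hp0 (fun n => continuous_finsetSum _ fun l _ => hSc n l)
      (K := Metric.closedBall 0 (R + 2 * ∑ l, ‖ε l‖)) (isCompact_closedBall _ _) ?_ (M := ∑ l, 5 * M l) ?_ ?_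
    · intro n x hx
      refine Finset.sum_eq_zero fun l _ => ?_
      rw [hS]; simp only
      rw [second_diff_supp hc (ε l) (h0 n) ((h1 n).trans (by norm_num)) hR x, zero_div]
      refine fun h9 => hx (Metric.closedBall_subset_closedBall ?_ h9)
      have := Finset.single_le_sum (f := fun l => ‖ε l‖) (fun l _ => norm_nonneg _) (Finset.mem_univ l)
      linarith
    · intro n x
      exact (Finset.abs_sum_le_sum_abs _ _).trans (Finset.sum_le_sum fun l _ =>
        second_diff_bound hu (hM l) x (h0 n))
    · intro x
      exact tendsto_finsetSum _ fun l _ => second_diff_tendsto hu x (ε l) h0 ht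
  -- left side
  have h20 : ∀ n, 0 < 2 * h n := fun n => by linarith [h0 n]
  have hLt : Tendsto (fun n => ∫ x, |(u (x + (2 * h n) • ε i) + u (x - (2 * h n) • ε i) - 2 * u x) / (2 * h n) ^ 2| ^ p)
      atTop (𝓝 (∫ x, |hs u x (ε i) (ε i)| ^ p)) := by
    refine int_conv hp0 (fun n => ((((hcu.shift ((2 * h n) • ε i)).add (hcu.shift' ((2 * h n) • ε i))).sub (hcu.cmul 2)).div _).cont)
      (K := Metric.closedBall 0 (R + 2 * ‖ε i‖)) (isCompact_closedBall _ _) ?_ (M := 5 * M i) ?_ ?_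
    · intro n x hx
      rw [second_diff_supp hc (ε i) (h20 n) (by linarith [h1 n]) hR x hx, zero_div]
    · intro n x
      exact second_diff_bound hu (hM i) x (h20 n)
    · intro x
      exact second_diff_tendsto hu x (ε i) h20 (by simpa using ht.const_mul 2)
  have key : ∀ n, ∫ x, |(u (x + (2 * h n) • ε i) + u (x - (2 * h n) • ε i) - 2 * u x) / (2 * h n) ^ 2| ^ p ≤
      C * ∫ x, |∑ l, S n l x| ^ p := by
    intro n
    have hpos := h0 n
    have hp2 : 0 < h n ^ 2 := pow_pos hpos 2
    have hd := H d (fun l => h n • ε l) u hcu i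
    have e1 : ∀ x, |dd (h n • ε i) (dd (h n • ε i) u) x| ^ p =
        ((2 * h n) ^ 2) ^ p * |(u (x + (2 * h n) • ε i) + u (x - (2 * h n) • ε i) - 2 * u x) / (2 * h n) ^ 2| ^ p := by
      intro x
      rw [← Real.mul_rpow (by positivity) (abs_nonneg _)]
      congr 1
      rw [abs_div, abs_of_pos (show 0 < (2 * h n) ^ 2 by positivity), mul_div_cancel₀ _ (by positivity)]
      congr 1
      simp only [dd]
      rw [show x + h n • ε i + h n • ε i = x + (2 * h n) • ε i by module,
        show x + h n • ε i - h n • ε i = x by module, show x - h n • ε i + h n • ε i = x by module,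
        show x - h n • ε i - h n • ε i = x - (2 * h n) • ε i by module]
      ring
    have e2 : ∀ x, |u x - avg (fun l => h n • ε l) u x| ^ p ≤ (h n ^ 2) ^ p * |∑ l, S n l x| ^ p := by
      intro x
      rw [← Real.mul_rpow (by positivity) (abs_nonneg _)]
      refine Real.rpow_le_rpow (abs_nonneg _) ?_ hp0.le
      have e3 : u x - avg (fun l => h n • ε l) u x = (Fintype.card ι : ℝ)⁻¹ * (-(1/2) * (h n ^ 2 * ∑ l, S n l x)) := by
        have : u x = ∑ l : ι, (Fintype.card ι : ℝ)⁻¹ * u x := by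
          simp [hn.ne']
        rw [avg]
        nth_rewrite 1 [this]
        rw [← Finset.sum_sub_distrib, Finset.mul_sum, Finset.mul_sum, Finset.mul_sum]
        refine Finset.sum_congr rfl fun l _ => ?_
        rw [hS]; simp only
        field_simp
        ring
      rw [e3, abs_mul, abs_mul, abs_mul, abs_of_pos hp2, abs_of_pos (inv_pos.2 hn)]
      have h9 : (Fintype.card ι : ℝ)⁻¹ ≤ 1 := inv_le_one_of_one_le₀ (by exact_mod_cast Fintype.card_pos)
      have h10 : |-(1/2 : ℝ)| = 1 / 2 := by rw [abs_neg, abs_of_pos (by norm_num)]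
      rw [h10]
      have h11 : 0 ≤ h n ^ 2 * |∑ l, S n l x| := by positivity
      calc (Fintype.card ι : ℝ)⁻¹ * (1 / 2 * (h n ^ 2 * |∑ l, S n l x|)) ≤ 1 * (1 / 2 * (h n ^ 2 * |∑ l, S n l x|)) := by gcongr
        _ ≤ _ := by linarith
    have hSC : CC fun x => ∑ l, S n l x := CC.sum _ fun l =>
      (((hcu.shift (h n • ε l)).add (hcu.shift' (h n • ε l))).sub (hcu.cmul 2)).div _
    have e4 := integral_mono ((hcu.sub (hcu.avg (fun l => h n • ε l))).absPow hp0).integrable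
      ((hSC.absPow hp0).cmul _).integrable e2
    simp only [e1] at hd
    rw [integral_const_mul] at hd e4
    set I := ∫ x, |(u (x + (2 * h n) • ε i) + u (x - (2 * h n) • ε i) - 2 * u x) / (2 * h n) ^ 2| ^ p
    have hI : 0 ≤ I := integral_nonneg fun x => by positivity
    have hpp : 0 < (h n ^ 2) ^ p := by positivity
    have h12 : (h n ^ 2) ^ p ≤ ((2 * h n) ^ 2) ^ p := Real.rpow_le_rpow (by positivity) (by nlinarith) hp0.le
    refine le_of_mul_le_mul_left ?_ hpp
    calc (h n ^ 2) ^ p * I ≤ ((2 * h n) ^ 2) ^ p * I := by gcongr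
      _ ≤ _ := hd
      _ ≤ C * ((h n ^ 2) ^ p * ∫ x, |∑ l, S n l x| ^ p) := by gcongr
      _ = _ := by ring
  exact le_of_tendsto_of_tendsto' hLt (hRt.const_mul C) key

section
variable {d : ℕ} {u : Euc d → ℝ}

lemma pd_eq (i : Fin d) (u : Euc d → ℝ) : pd i u = fun x => fderiv ℝ u x (EuclideanSpace.single i 1) := rfl

lemma pd_sm (hu : ContDiff ℝ (⊤ : ℕ∞) u) (i : Fin d) : ContDiff ℝ (⊤ : ℕ∞) (pd i u) := by
  rw [pd_eq]
  exact (sm_fderiv hu).clm_apply contDiff_const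

lemma pd_cs (hc : HasCompactSupport u) (i : Fin d) : HasCompactSupport (pd i u) :=
  (hc.fderiv (𝕜 := ℝ)).comp_left (g := fun L : Euc d →L[ℝ] ℝ => L (EuclideanSpace.single i 1)) (by simp)

lemma pd_pd (hu : ContDiff ℝ (⊤ : ℕ∞) u) (i j : Fin d) (x : Euc d) :
    pd i (pd j u) x = hs u x (EuclideanSpace.single i 1) (EuclideanSpace.single j 1) := by
  rw [pd_eq j, pd, hs]
  have h := ((sm_fderiv hu).differentiable (by simp) x).hasFDerivAt
  rw [(h.clm_apply (hasFDerivAt_const (EuclideanSpace.single j (1:ℝ)) x)).fderiv]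
  simp

lemma hs_symm (hu : ContDiff ℝ (⊤ : ℕ∞) u) (x w w' : Euc d) : hs u x w w' = hs u x w' w := by
  have : IsSymmSndFDerivAt ℝ u x := (hu.contDiffAt).isSymmSndFDerivAt (by
    simp only [minSmoothness_of_isRCLikeNormedField]; norm_cast)
  exact this w w'

lemma pd_comm (hu : ContDiff ℝ (⊤ : ℕ∞) u) (i j : Fin d) : pd i (pd j u) = pd j (pd i u) := by
  ext x; rw [pd_pd hu, pd_pd hu, hs_symm hu]

lemma lap_eq (hu : ContDiff ℝ (⊤ : ℕ∞) u) (x : Euc d) :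
    lap u x = ∑ i, hs u x (EuclideanSpace.single i 1) (EuclideanSpace.single i 1) := by
  simp only [lap, pd_pd hu]

lemma hs_add (x a b c e : Euc d) : hs u x (a + b) (c + e) = hs u x a c + hs u x a e + hs u x b c + hs u x b e := by
  simp [hs]; ring
lemma hs_sub (x a b c e : Euc d) : hs u x (a - b) (c - e) = hs u x a c - hs u x a e - hs u x b c + hs u x b e := by
  simp [hs]; ring
lemma hs_smul (x a c : Euc d) (t : ℝ) : hs u x (t • a) (t • c) = t ^ 2 * hs u x a c := by
  simp [hs]; ring
end

theorem hess_main {p : ℝ} (hp : 1 < p) (d : ℕ) :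
    ∃ C : ℝ, 0 < C ∧ ∀ (u : Euc d → ℝ), ContDiff ℝ (⊤ : ℕ∞) u →
      HasCompactSupport u → ∀ i j,
      ∫ x, |pd i (pd j u) x| ^ p ≤ C * ∫ x, |lap u x| ^ p := by
  rcases Nat.eq_zero_or_pos d with rfl | hd
  · exact ⟨1, one_pos, fun u _ _ i => i.elim0⟩
  have : Nonempty (Fin d) := ⟨⟨0, hd⟩⟩
  have hp0 : 0 < p := by linarith
  obtain ⟨C, hC, H⟩ := dir_main hp (Fin d)
  refine ⟨2 ^ p * C, by positivity, fun u hu hc i j => ?_⟩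
  have hI : 0 ≤ ∫ x, |lap u x| ^ p := integral_nonneg fun x => by positivity
  have h2p : (1:ℝ) ≤ 2 ^ p := Real.one_le_rpow (by norm_num) hp0.le
  by_cases hij : i = j
  · subst hij
    have := H d (fun l => EuclideanSpace.single l 1) u hu hc i
    simp only [← lap_eq hu, ← pd_pd hu] at this
    refine this.trans ?_
    rw [mul_assoc]
    exact le_mul_of_one_le_left (by positivity) h2p
  · set e : Fin d → Euc d := fun l => EuclideanSpace.single l (1:ℝ) with he
    set r : ℝ := Real.sqrt 2 with hr
    have hr2 : r ^ 2 = 2 := Real.sq_sqrt (by norm_num)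
    set ε : Fin d → Euc d := fun l => if l = i then e i + e j else if l = j then e i - e j else r • e l with hε
    have hεi : ε i = e i + e j := by simp [hε]
    have hεj : ε j = e i - e j := by simp [hε, Ne.symm hij]
    have hsum : ∀ x, ∑ l, hs u x (ε l) (ε l) = 2 * lap u x := by
      intro x
      rw [lap_eq hu, Finset.mul_sum]
      have hji : j ∈ Finset.univ.erase i := by simp [Ne.symm hij]
      rw [← Finset.add_sum_erase _ _ (Finset.mem_univ i), ← Finset.add_sum_erase _ _ hji,
        ← Finset.add_sum_erase _ (fun l => 2 * hs u x (EuclideanSpace.single l 1) (EuclideanSpace.single l 1)) (Finset.mem_univ i),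
        ← Finset.add_sum_erase _ (fun l => 2 * hs u x (EuclideanSpace.single l 1) (EuclideanSpace.single l 1)) hji]
      have : ∑ l ∈ (Finset.univ.erase i).erase j, hs u x (ε l) (ε l) =
          ∑ l ∈ (Finset.univ.erase i).erase j, 2 * hs u x (EuclideanSpace.single l 1) (EuclideanSpace.single l 1) := by
        refine Finset.sum_congr rfl fun l hl => ?_
        simp only [Finset.mem_erase, Finset.mem_univ, and_true] at hl
        have : ε l = r • e l := by simp [hε, hl.1, hl.2]
        rw [this, hs_smul, hr2]
      rw [this, hεi, hεj, hs_add, hs_sub]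
      simp only [he]
      ring
    have hi := H d ε u hu hc i
    have hj := H d ε u hu hc j
    simp only [hsum] at hi hj
    have hL : ∫ x, |2 * lap u x| ^ p = 2 ^ p * ∫ x, |lap u x| ^ p := by
      rw [← integral_const_mul]
      congr 1; ext x
      rw [abs_mul, Real.mul_rpow (abs_nonneg _) (abs_nonneg _), abs_of_pos (by norm_num : (0:ℝ) < 2)]
    rw [hL] at hi hj
    have hpt : ∀ x, |pd i (pd j u) x| ^ p ≤ 1 / 2 * (|hs u x (ε i) (ε i)| ^ p + |hs u x (ε j) (ε j)| ^ p) := by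
      intro x
      have e1 : 4 * pd i (pd j u) x = hs u x (ε i) (ε i) + - hs u x (ε j) (ε j) := by
        rw [pd_pd hu, hεi, hεj, hs_add, hs_sub, hs_symm hu x (e j) (e i)]
        simp only [he]; ring
      have e2 := abs_add_rpow_le hp.le (hs u x (ε i) (ε i)) (- hs u x (ε j) (ε j))
      rw [← e1, abs_mul, abs_neg, Real.mul_rpow (abs_nonneg _) (abs_nonneg _), abs_of_pos (by norm_num : (0:ℝ) < 4)] at e2
      have e3 : (2:ℝ) ^ (p - 1) = 2 ^ p / 2 := Real.rpow_sub_one (by norm_num) _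
      have e4 : (4:ℝ) ^ p = 2 ^ p * 2 ^ p := by
        rw [← Real.mul_rpow (by norm_num) (by norm_num)]; norm_num
      rw [e3, e4] at e2
      have e5 : 2 ^ p * (2 ^ p * |pd i (pd j u) x| ^ p) ≤ 2 ^ p * (1 / 2 * (|hs u x (ε i) (ε i)| ^ p + |hs u x (ε j) (ε j)| ^ p)) := by
        linarith
      have e6 := le_of_mul_le_mul_left e5 (by positivity)
      refine le_trans ?_ e6
      exact le_mul_of_one_le_left (by positivity) h2p
    have c1 := (hs_CC hu hc (ε i) (ε i)).absPow hp0
    have c2 := (hs_CC hu hc (ε j) (ε j)).absPow hp0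
    have c0 : CC (pd i (pd j u)) := ⟨(pd_sm (pd_sm hu j) i).continuous, pd_cs (pd_cs hc j) i⟩
    have := integral_mono (c0.absPow hp0).integrable ((c1.add c2).cmul (1/2)).integrable hpt
    rw [integral_const_mul, integral_add c1.integrable c2.integrable] at this
    linarith

end


section


lemma eL_add {d : ℕ} {p : ℝ≥0∞} (hp1 : 1 < p) {μ : Measure (Euc d)} {f g : Euc d → ℝ} (hf : AEStronglyMeasurable f μ)
    (hg : AEStronglyMeasurable g μ) : eLpNorm (fun x => f x + g x) p μ ≤ eLpNorm f p μ + eLpNorm g p μ :=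
  eLpNorm_add_le hf hg hp1.le

lemma eL_cmul {d : ℕ} {p : ℝ≥0∞} {μ : Measure (Euc d)} (c : ℝ) (f : Euc d → ℝ) :
    eLpNorm (fun x => c * f x) p μ = ‖c‖ₑ * eLpNorm f p μ := eLpNorm_const_smul c f p μ

lemma eL_sum {d : ℕ} {p : ℝ≥0∞} (hp1 : 1 < p) {μ : Measure (Euc d)} {ι : Type*} (s : Finset ι) {F : ι → Euc d → ℝ}
    (hf : ∀ i ∈ s, AEStronglyMeasurable (F i) μ) :
    eLpNorm (fun x => ∑ i ∈ s, F i x) p μ ≤ ∑ i ∈ s, eLpNorm (F i) p μ := by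
  have := eLpNorm_sum_le (p := p) (μ := μ) hf hp1.le
  convert this using 2
  ext x; simp

/-- Minkowski/Jensen: averaging translations -/
lemma mink {d : ℕ} {p : ℝ≥0∞} (hp1 : 1 < p) (hp2 : p ≠ ⊤) {Y : Type*} [MeasurableSpace Y] (μ : Measure Y)
    [IsFiniteMeasure μ] (τ : Y → Euc d) (hτ : Measurable τ) {F : Euc d → ℝ≥0∞} (hF : Measurable F) :
    eLpNorm (fun x => ∫⁻ y, F (x + τ y) ∂μ) p volume ≤ μ Set.univ * eLpNorm F p volume := by
  have hp0 : p ≠ 0 := (zero_lt_one.trans hp1).ne'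
  set r := p.toReal with hr
  have hr1 : 1 < r := by
    rw [hr, ← ENNReal.toReal_one]; exact (ENNReal.toReal_lt_toReal (by simp) hp2).2 hp1
  have hr0 : 0 < r := by linarith
  rw [eLpNorm_eq_lintegral_rpow_enorm_toReal hp0 hp2, eLpNorm_eq_lintegral_rpow_enorm_toReal hp0 hp2]
  simp only [enorm_eq_self]
  rw [← hr]
  have hmeas2 : Measurable (fun z : Euc d × Y => F (z.1 + τ z.2)) :=
    hF.comp (measurable_fst.add (hτ.comp measurable_snd))
  have h1 : ∀ x, (∫⁻ y, F (x + τ y) ∂μ) ^ r ≤ μ Set.univ ^ (r - 1) * ∫⁻ y, F (x + τ y) ^ r ∂μ := by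
    intro x
    have hm : Measurable fun y => F (x + τ y) := hF.comp (hτ.const_add x)
    have := eLpNorm_le_eLpNorm_mul_rpow_measure_univ (μ := μ) (p := 1) (q := p) hp1.le hm.aestronglyMeasurable
    rw [eLpNorm_one_eq_lintegral_enorm, eLpNorm_eq_lintegral_rpow_enorm_toReal hp0 hp2] at this
    simp only [enorm_eq_self, ENNReal.toReal_one, ← hr] at this
    refine (ENNReal.rpow_le_rpow this hr0.le).trans (le_of_eq ?_)
    rw [ENNReal.mul_rpow_of_nonneg _ _ hr0.le, ← ENNReal.rpow_mul, ← ENNReal.rpow_mul, one_div_mul_cancel hr0.ne',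
      ENNReal.rpow_one, mul_comm]
    congr 2
    field_simp
  have h2 : ∫⁻ x, (∫⁻ y, F (x + τ y) ∂μ) ^ r ≤ μ Set.univ ^ r * ∫⁻ x, F x ^ r := by
    calc ∫⁻ x, (∫⁻ y, F (x + τ y) ∂μ) ^ r ≤ ∫⁻ x, μ Set.univ ^ (r - 1) * ∫⁻ y, F (x + τ y) ^ r ∂μ := lintegral_mono h1
      _ = μ Set.univ ^ (r - 1) * ∫⁻ x, ∫⁻ y, F (x + τ y) ^ r ∂μ := by
        rw [lintegral_const_mul]
        exact (hmeas2.pow_const r).lintegral_prod_right'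
      _ = μ Set.univ ^ (r - 1) * ∫⁻ y, (∫⁻ x, F (x + τ y) ^ r) ∂μ := by
        rw [lintegral_lintegral_swap]
        exact (hmeas2.pow_const r).aemeasurable
      _ = μ Set.univ ^ (r - 1) * ((∫⁻ x, F x ^ r) * μ Set.univ) := by
        congr 1
        rw [← lintegral_const]
        refine lintegral_congr fun y => ?_
        exact lintegral_add_right_eq_self (fun x => F x ^ r) (τ y)
      _ = _ := by
        by_cases hμ : μ Set.univ = 0
        · rw [hμ, ENNReal.zero_rpow_of_pos hr0]; simp
        have : μ Set.univ ^ r = μ Set.univ ^ (r - 1) * μ Set.univ := by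
          nth_rewrite 3 [← ENNReal.rpow_one (μ Set.univ)]
          rw [← ENNReal.rpow_add _ _ hμ (measure_ne_top _ _)]
          congr 1; ring
        rw [this]; ring
  refine (ENNReal.rpow_le_rpow h2 (by positivity)).trans (le_of_eq ?_)
  rw [ENNReal.mul_rpow_of_nonneg _ _ (by positivity), ← ENNReal.rpow_mul, mul_one_div_cancel hr0.ne', ENNReal.rpow_one]

section
variable {d : ℕ} {u : Euc d → ℝ}

lemma interp_point (hu : ContDiff ℝ (⊤ : ℕ∞) u) (i : Fin d) {h : ℝ} (hh : 0 < h) (x : Euc d) :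
    ‖pd i u x‖ₑ ≤ ENNReal.ofReal h⁻¹ * ‖u (x + h • EuclideanSpace.single i 1)‖ₑ + ENNReal.ofReal h⁻¹ * ‖u x‖ₑ +
      ∫⁻ s in Set.Ioc 0 h, ‖pd i (pd i u) (x + s • EuclideanSpace.single i 1)‖ₑ := by
  set e : Euc d := EuclideanSpace.single i 1 with he
  obtain ⟨ξ, hξ, hξe⟩ := exists_hasDerivAt_eq_slope (fun t : ℝ => u (x + t • e)) (fun t => fderiv ℝ u (x + t • e) e) hh
    (fun t _ => (line_deriv1 hu x e t).continuousAt.continuousWithinAt) (fun t _ => line_deriv1 hu x e t)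
  simp only [zero_smul, add_zero, sub_zero] at hξe
  have hc : Continuous fun s : ℝ => hs u (x + s • e) e e :=
    (hs_cont hu e e).comp (f := fun r : ℝ => x + r • e) (by fun_prop)
  have h2 : ∫ s in (0:ℝ)..ξ, hs u (x + s • e) e e = fderiv ℝ u (x + ξ • e) e - fderiv ℝ u (x + (0:ℝ) • e) e :=
    intervalIntegral.integral_eq_sub_of_hasDerivAt (fun t _ => line_deriv2 hu x e t) (hc.intervalIntegrable _ _)
  simp only [zero_smul, add_zero] at h2
  have h3 : pd i u x = h⁻¹ * u (x + h • e) + (-(h⁻¹ * u x)) + (- ∫ s in (0:ℝ)..ξ, hs u (x + s • e) e e) := by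
    rw [h2, hξe, pd]; ring
  rw [h3]
  refine (enorm_add_le _ _).trans (add_le_add ((enorm_add_le _ _).trans (add_le_add ?_ ?_)) ?_)
  · rw [enorm_mul, Real.enorm_of_nonneg (inv_nonneg.2 hh.le)]
  · rw [enorm_neg, enorm_mul, Real.enorm_of_nonneg (inv_nonneg.2 hh.le)]
  · rw [enorm_neg, intervalIntegral.integral_of_le hξ.1.le]
    refine (enorm_integral_le_lintegral_enorm _).trans ?_
    simp only [pd_pd hu]
    exact lintegral_mono_set (Set.Ioc_subset_Ioc_right hξ.2.le)

lemma interp {p : ℝ≥0∞} (hp1 : 1 < p) (hp2 : p ≠ ⊤) (hu : ContDiff ℝ (⊤ : ℕ∞) u) (i : Fin d) {h : ℝ} (hh : 0 < h) :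
    eLpNorm (pd i u) p volume ≤ ENNReal.ofReal (2 * h⁻¹) * eLpNorm u p volume +
      ENNReal.ofReal h * eLpNorm (pd i (pd i u)) p volume := by
  set e : Euc d := EuclideanSpace.single i 1 with he
  have m0 : Measurable fun x => ‖u x‖ₑ := hu.continuous.measurable.enorm
  have m1 : Measurable fun x => ‖u (x + h • e)‖ₑ := m0.comp (measurable_id.add_const _)
  have m2 : Measurable fun x => ‖pd i (pd i u) x‖ₑ := (pd_sm (pd_sm hu i) i).continuous.measurable.enorm
  set μ : Measure ℝ := volume.restrict (Set.Ioc 0 h)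
  have m3 : Measurable fun x => ∫⁻ s, ‖pd i (pd i u) (x + s • e)‖ₑ ∂μ := by
    have : Measurable (fun z : Euc d × ℝ => ‖pd i (pd i u) (z.1 + z.2 • e)‖ₑ) :=
      m2.comp (measurable_fst.add (measurable_snd.smul_const e))
    exact this.lintegral_prod_right'
  have hfin : IsFiniteMeasure μ := ⟨by simp [μ]⟩
  have hμ : μ Set.univ = ENNReal.ofReal h := by simp [μ]
  have key := mink hp1 hp2 μ (fun s : ℝ => s • e) (measurable_id.smul_const e) m2
  rw [hμ] at key
  have hcE : ∀ F : Euc d → ℝ≥0∞, eLpNorm (fun x => ENNReal.ofReal h⁻¹ * F x) p volume ≤ ENNReal.ofReal h⁻¹ * eLpNorm F p volume := by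
    intro F
    have hp0 : p ≠ 0 := (zero_lt_one.trans hp1).ne'
    have hr0 : 0 < p.toReal := ENNReal.toReal_pos hp0 hp2
    rw [eLpNorm_eq_lintegral_rpow_enorm_toReal hp0 hp2, eLpNorm_eq_lintegral_rpow_enorm_toReal hp0 hp2]
    simp only [enorm_eq_self, ENNReal.mul_rpow_of_nonneg _ _ hr0.le]
    rw [lintegral_const_mul' _ _ (by simp), ENNReal.mul_rpow_of_nonneg _ _ (by positivity), ← ENNReal.rpow_mul,
      mul_one_div_cancel hr0.ne', ENNReal.rpow_one]
  have n0 : eLpNorm (fun x => ‖u x‖ₑ) p volume = eLpNorm u p volume := eLpNorm_enorm u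
  have n1 : eLpNorm (fun x => ‖u (x + h • e)‖ₑ) p volume = eLpNorm u p volume := by
    rw [eLpNorm_enorm (fun x => u (x + h • e))]
    exact eLpNorm_comp_measurePreserving (g := u) hu.continuous.aestronglyMeasurable (measurePreserving_add_right volume (h • e))
  have n2 : eLpNorm (fun x => ‖pd i (pd i u) x‖ₑ) p volume = eLpNorm (pd i (pd i u)) p volume := eLpNorm_enorm _
  rw [n2] at key
  calc eLpNorm (pd i u) p volume ≤ eLpNorm ((fun x => ENNReal.ofReal h⁻¹ * ‖u (x + h • e)‖ₑ) +
        (fun x => ENNReal.ofReal h⁻¹ * ‖u x‖ₑ) + fun x => ∫⁻ s, ‖pd i (pd i u) (x + s • e)‖ₑ ∂μ) p volume := by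
        refine eLpNorm_mono_enorm fun x => ?_
        simp only [enorm_eq_self, Pi.add_apply]
        exact interp_point hu i hh x
    _ ≤ _ := eLpNorm_add_le ((m1.const_mul _).add (m0.const_mul _)).aestronglyMeasurable m3.aestronglyMeasurable hp1.le
    _ ≤ _ := add_le_add (eLpNorm_add_le (m1.const_mul _).aestronglyMeasurable (m0.const_mul _).aestronglyMeasurable hp1.le) le_rfl
    _ ≤ ENNReal.ofReal h⁻¹ * eLpNorm u p volume + ENNReal.ofReal h⁻¹ * eLpNorm u p volume +
      ENNReal.ofReal h * eLpNorm (pd i (pd i u)) p volume := by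
        refine add_le_add (add_le_add ?_ ?_) key
        · rw [← n1]; exact hcE _
        · rw [← n0]; exact hcE _
    _ = _ := by
      rw [ENNReal.ofReal_mul (by norm_num), ENNReal.ofReal_ofNat]; ring

/-- `hess_main` in eLpNorm form -/
lemma CC.eL {f : Euc d → ℝ} (hf : CC f) {p : ℝ≥0∞} (hp1 : 1 < p) (hp2 : p ≠ ⊤) :
    eLpNorm f p volume = ENNReal.ofReal ((∫ x, |f x| ^ p.toReal) ^ p.toReal⁻¹) := by
  have hp0 : p ≠ 0 := (zero_lt_one.trans hp1).ne'
  exact (hf.cont.memLp_of_hasCompactSupport hf.cs).eLpNorm_eq_integral_rpow_norm hp0 hp2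

lemma hess_eL {p : ℝ≥0∞} (hp1 : 1 < p) (hp2 : p ≠ ⊤) (d : ℕ) :
    ∃ C : ℝ≥0, ∀ (u : Euc d → ℝ), ContDiff ℝ (⊤ : ℕ∞) u → HasCompactSupport u → ∀ i j,
      eLpNorm (pd i (pd j u)) p volume ≤ C * eLpNorm (lap u) p volume := by
  have hp0 : p ≠ 0 := (zero_lt_one.trans hp1).ne'
  have hr1 : 1 < p.toReal := by
    rw [← ENNReal.toReal_one]; exact (ENNReal.toReal_lt_toReal (by simp) hp2).2 hp1
  obtain ⟨C, hC, H⟩ := hess_main hr1 d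
  refine ⟨(C ^ p.toReal⁻¹).toNNReal, fun u hu hc i j => ?_⟩
  have c0 : ∀ i j, CC (pd i (pd j u)) := fun i j => ⟨(pd_sm (pd_sm hu j) i).continuous, pd_cs (pd_cs hc j) i⟩
  have c1 : CC (lap u) := CC.sum Finset.univ fun i => c0 i i
  rw [(c0 i j).eL hp1 hp2, c1.eL hp1 hp2]
  change _ ≤ ENNReal.ofReal _ * _
  have hI : 0 ≤ ∫ x, |lap u x| ^ p.toReal := integral_nonneg fun x => by positivity
  rw [← ENNReal.ofReal_mul (by positivity), ← Real.mul_rpow hC.le hI]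
  refine ENNReal.ofReal_le_ofReal (Real.rpow_le_rpow (integral_nonneg fun x => by positivity) (H u hu hc i j) (by positivity))
end

end


section


section cut
open scoped Manifold ContDiff
variable {d : ℕ}

lemma exists_cut {K U : Set (Euc d)} (hK : IsCompact K) (hU : IsOpen U) (hKU : K ⊆ U) :
    ∃ η : Euc d → ℝ, ContDiff ℝ (⊤ : ℕ∞) η ∧ HasCompactSupport η ∧ tsupport η ⊆ U ∧
      (∀ x ∈ K, ∀ᶠ y in 𝓝 x, η y = 1) ∧ ∀ x, 0 ≤ η x ∧ η x ≤ 1 := by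
  obtain ⟨L, hL, hKL, hLU⟩ := exists_compact_between hK hU hKU
  obtain ⟨f, h0, h1, h2⟩ := exists_contMDiffMap_zero_one_nhds_of_isClosed (𝓘(ℝ, Euc d)) (n := (⊤ : ℕ∞))
    (isOpen_interior (s := L)).isClosed_compl hK.isClosed
    (Set.disjoint_left.2 fun x hx hx' => hx (hKL hx'))
  have hts : tsupport f ⊆ L := by
    refine closure_minimal ?_ hL.isClosed
    intro x hx
    by_contra hxL
    have : x ∈ (interior L)ᶜ := fun h => hxL (interior_subset h)
    exact hx (h0.self_of_nhdsSet x this)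
  refine ⟨f, f.contMDiff.contDiff, ?_, hts.trans hLU, fun x hx => ?_, fun x => h2 x⟩
  · exact HasCompactSupport.of_support_subset_isCompact hL ((subset_tsupport _).trans hts)
  · exact (eventually_nhdsSet_iff_forall.1 h1) x hx

lemma pd_congr {f g : Euc d → ℝ} {x : Euc d} (h : f =ᶠ[𝓝 x] g) (i : Fin d) : pd i f =ᶠ[𝓝 x] pd i g := by
  filter_upwards [h.fderiv (𝕜 := ℝ)] with y hy
  rw [pd, pd, hy]

lemma pd_mul {f g : Euc d → ℝ} (hf : Differentiable ℝ f) (hg : Differentiable ℝ g) (i : Fin d) :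
    pd i (fun x => f x * g x) = fun x => f x * pd i g x + g x * pd i f x := by
  ext x
  rw [pd, fderiv_fun_mul (hf x) (hg x)]
  simp [pd]

lemma pd_add {f g : Euc d → ℝ} (hf : Differentiable ℝ f) (hg : Differentiable ℝ g) (i : Fin d) :
    pd i (fun x => f x + g x) = fun x => pd i f x + pd i g x := by
  ext x
  rw [pd, fderiv_fun_add (hf x) (hg x)]
  simp [pd]

lemma pd_comp {f : Euc d → ℝ} {g : ℝ → ℝ} (hg : Differentiable ℝ g) (hf : Differentiable ℝ f) (i : Fin d) :
    pd i (fun x => g (f x)) = fun x => deriv g (f x) * pd i f x := by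
  ext x
  have := ((hg (f x)).hasDerivAt.comp_hasFDerivAt x (hf x).hasFDerivAt).fderiv
  rw [pd]
  change fderiv ℝ (g ∘ f) x _ = _
  rw [this]
  simp [pd]

lemma lap_sm {w : Euc d → ℝ} (hw : ContDiff ℝ (⊤ : ℕ∞) w) : ContDiff ℝ (⊤ : ℕ∞) (lap w) := by
  have : lap w = fun x => ∑ i, pd i (pd i w) x := rfl
  rw [this]
  exact ContDiff.sum fun i _ => pd_sm (pd_sm hw i) i

lemma lap_mul {f g : Euc d → ℝ} (hf : ContDiff ℝ (⊤ : ℕ∞) f) (hg : ContDiff ℝ (⊤ : ℕ∞) g) (x : Euc d) :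
    lap (fun x => f x * g x) x = f x * lap g x + g x * lap f x + ∑ i, 2 * (pd i f x * pd i g x) := by
  simp only [lap, Finset.mul_sum, ← Finset.sum_add_distrib]
  refine Finset.sum_congr rfl fun i _ => ?_
  have hd1 : Differentiable ℝ (fun x => f x * pd i g x) := (sm_diff hf).mul (sm_diff (pd_sm hg i))
  have hd2 : Differentiable ℝ (fun x => g x * pd i f x) := (sm_diff hg).mul (sm_diff (pd_sm hf i))
  rw [pd_mul (sm_diff hf) (sm_diff hg), pd_add hd1 hd2,
    pd_mul (sm_diff hf) (sm_diff (pd_sm hg i)), pd_mul (sm_diff hg) (sm_diff (pd_sm hf i))]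
  ring

lemma st_bounds : ∃ B : ℝ, 1 ≤ B ∧ (∀ t, |deriv Real.smoothTransition t| ≤ B) ∧
    ∀ t, |deriv (deriv Real.smoothTransition) t| ≤ B := by
  have hsm : ContDiff ℝ (⊤ : ℕ∞) Real.smoothTransition := Real.smoothTransition.contDiff
  have hsm1 : ContDiff ℝ (⊤ : ℕ∞) (deriv Real.smoothTransition) := by
    have := (contDiff_infty_iff_deriv (𝕜 := ℝ) (f := Real.smoothTransition)).1 hsm
    exact this.2
  have hsm2 : ContDiff ℝ (⊤ : ℕ∞) (deriv (deriv Real.smoothTransition)) := by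
    have := (contDiff_infty_iff_deriv (𝕜 := ℝ) (f := deriv Real.smoothTransition)).1 hsm1
    exact this.2
  have hcs : HasCompactSupport (deriv Real.smoothTransition) := by
    refine HasCompactSupport.intro (isCompact_Icc (a := (0:ℝ)) (b := 1)) fun t ht => ?_
    simp only [Set.mem_Icc, not_and_or, not_le] at ht
    rcases ht with ht | ht
    · have : Real.smoothTransition =ᶠ[𝓝 t] fun _ => 0 := by
        filter_upwards [gt_mem_nhds ht] with y hy
        exact Real.smoothTransition.zero_of_nonpos hy.le
      rw [this.deriv_eq]; simp
    · have : Real.smoothTransition =ᶠ[𝓝 t] fun _ => 1 := by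
        filter_upwards [lt_mem_nhds ht] with y hy
        exact Real.smoothTransition.one_of_one_le hy.le
      rw [this.deriv_eq]; simp
  obtain ⟨B1, h1⟩ := hcs.exists_bound_of_continuous hsm1.continuous
  obtain ⟨B2, h2⟩ := hcs.deriv.exists_bound_of_continuous hsm2.continuous
  refine ⟨max 1 (max B1 B2), le_max_left _ _, fun t => (h1 t).trans ?_, fun t => (h2 t).trans ?_⟩
  · exact (le_max_left _ _).trans (le_max_right _ _)
  · exact (le_max_right _ _).trans (le_max_right _ _)

/-- nested cutoffs -/
lemma exists_cuts {K U : Set (Euc d)} (hK : IsCompact K) (hU : IsOpen U) (hKU : K ⊆ U) :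
    ∃ (S : Set (Euc d)) (A : ℝ) (η : ℕ → Euc d → ℝ), IsCompact S ∧ S ⊆ U ∧ 1 ≤ A ∧
      (∀ j, ContDiff ℝ (⊤ : ℕ∞) (η j)) ∧ (∀ j x, |η j x| ≤ 1) ∧ (∀ j, tsupport (η j) ⊆ S) ∧
      (∀ j i x, |pd i (η j) x| ≤ A * 4 ^ j) ∧ (∀ j x, |lap (η j) x| ≤ A * 16 ^ j) ∧
      (∀ x ∈ K, ∀ᶠ y in 𝓝 x, η 0 y = 1) ∧
      (∀ j, ∀ x ∈ tsupport (η j), ∀ᶠ y in 𝓝 x, η (j + 1) y = 1) := by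
  obtain ⟨φ, hφ, hφc, hφU, hφ1, hφ01⟩ := exists_cut hK hU hKU
  obtain ⟨B, hB1, hB, hB2⟩ := st_bounds
  have hb1 : ∀ i, ∃ M, 0 ≤ M ∧ ∀ x, |pd i φ x| ≤ M := fun i =>
    CC.bdd ⟨(pd_sm hφ i).continuous, pd_cs hφc i⟩
  have hb2 : ∀ i, ∃ M, 0 ≤ M ∧ ∀ x, |pd i (pd i φ) x| ≤ M := fun i =>
    CC.bdd ⟨(pd_sm (pd_sm hφ i) i).continuous, pd_cs (pd_cs hφc i) i⟩
  choose M1 hM10 hM1 using hb1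
  choose M2 hM20 hM2 using hb2
  set η : ℕ → Euc d → ℝ := fun j x => Real.smoothTransition (2 * 4 ^ j * φ x - 1) with hη
  have hsm : ContDiff ℝ (⊤ : ℕ∞) Real.smoothTransition := Real.smoothTransition.contDiff
  have hsm1 : ContDiff ℝ (⊤ : ℕ∞) (deriv Real.smoothTransition) :=
    ((contDiff_infty_iff_deriv (𝕜 := ℝ) (f := Real.smoothTransition)).1 hsm).2
  have hst : Differentiable ℝ Real.smoothTransition := hsm.differentiable (by simp)
  have hst1 : Differentiable ℝ (deriv Real.smoothTransition) := hsm1.differentiable (by simp)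
  have hηs : ∀ j, ContDiff ℝ (⊤ : ℕ∞) (η j) := fun j => hsm.comp ((contDiff_const.mul hφ).sub contDiff_const)
  have haff : ∀ j i, pd i (fun x => 2 * 4 ^ j * φ x - 1) = fun x => 2 * 4 ^ j * pd i φ x := by
    intro j i
    ext x
    rw [pd, fderiv_sub_const, fderiv_const_mul (sm_diff hφ x)]
    simp [pd]
  have haffd : ∀ j : ℕ, Differentiable ℝ (fun x => 2 * 4 ^ j * φ x - 1) := fun j =>
    ((sm_diff hφ).const_mul _).sub_const _
  have hp1 : ∀ j i, pd i (η j) = fun x => deriv Real.smoothTransition (2 * 4 ^ j * φ x - 1) * (2 * 4 ^ j * pd i φ x) := by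
    intro j i
    rw [hη]
    simp only
    rw [pd_comp hst (haffd j), haff]
  have hp2 : ∀ j i, pd i (pd i (η j)) = fun x => deriv Real.smoothTransition (2 * 4 ^ j * φ x - 1) * (2 * 4 ^ j * pd i (pd i φ) x)
      + (2 * 4 ^ j * pd i φ x) * (deriv (deriv Real.smoothTransition) (2 * 4 ^ j * φ x - 1) * (2 * 4 ^ j * pd i φ x)) := by
    intro j i
    have hd1 : Differentiable ℝ (fun x => deriv Real.smoothTransition (2 * 4 ^ j * φ x - 1)) := hst1.comp (haffd j)
    have hd2 : Differentiable ℝ (fun x => 2 * 4 ^ j * pd i φ x) := (sm_diff (pd_sm hφ i)).const_mul _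
    rw [hp1, pd_mul hd1 hd2, pd_comp hst1 (haffd j), haff]
    ext x
    congr 2
    rw [pd, fderiv_const_mul (sm_diff (pd_sm hφ i) x)]
    simp [pd]
  set A : ℝ := 1 + ∑ i, 2 * B * M1 i + ∑ i, (2 * B * M2 i + 4 * B * M1 i ^ 2) with hA
  have hB0 : 0 ≤ B := by linarith
  have hs1 : 0 ≤ ∑ i, 2 * B * M1 i := Finset.sum_nonneg fun i _ => by have := hM10 i; positivity
  have hs2 : 0 ≤ ∑ i, (2 * B * M2 i + 4 * B * M1 i ^ 2) := Finset.sum_nonneg fun i _ => by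
    have := hM10 i; have := hM20 i; positivity
  have h4 : ∀ j : ℕ, (1:ℝ) ≤ 4 ^ j := fun j => one_le_pow₀ (by norm_num)
  have h416 : ∀ j : ℕ, (16:ℝ) ^ j = 4 ^ j * 4 ^ j := fun j => by rw [← mul_pow]; norm_num
  refine ⟨tsupport φ, A, η, hφc, hφU, by linarith, hηs, ?_, ?_, ?_, ?_, ?_, ?_⟩
  · intro j x
    rw [abs_of_nonneg (Real.smoothTransition.nonneg _)]
    exact Real.smoothTransition.le_one _
  · intro j
    refine closure_mono fun x hx => ?_
    by_contra h
    simp only [Function.mem_support, not_not] at h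
    apply hx
    simp only [hη, h]
    exact Real.smoothTransition.zero_of_nonpos (by norm_num)
  · intro j i x
    rw [hp1]
    simp only
    rw [abs_mul, abs_mul, abs_of_pos (by positivity : (0:ℝ) < 2 * 4 ^ j)]
    have h5 : |deriv Real.smoothTransition (2 * 4 ^ j * φ x - 1)| * (2 * 4 ^ j * |pd i φ x|) ≤ B * (2 * 4 ^ j * M1 i) := by
      gcongr
      · exact hB _
      · exact hM1 i x
    refine h5.trans ?_
    have h6 : 2 * B * M1 i ≤ ∑ i, 2 * B * M1 i := Finset.single_le_sum (f := fun i => 2 * B * M1 i) (fun i _ => by have := hM10 i; positivity) (Finset.mem_univ i)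
    have : B * (2 * 4 ^ j * M1 i) = (2 * B * M1 i) * 4 ^ j := by ring
    rw [this]
    gcongr
    linarith
  · intro j x
    rw [lap]
    refine (Finset.abs_sum_le_sum_abs _ _).trans ?_
    have h7 : ∀ i, |pd i (pd i (η j)) x| ≤ (2 * B * M2 i + 4 * B * M1 i ^ 2) * 16 ^ j := by
      intro i
      rw [hp2]
      simp only
      refine (abs_add_le _ _).trans ?_
      have a0 : ∀ y : ℝ, |2 * 4 ^ j * y| = 2 * 4 ^ j * |y| := fun y => by
        rw [abs_mul, abs_of_pos (by positivity : (0:ℝ) < 2 * 4 ^ j)]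
      rw [abs_mul (deriv Real.smoothTransition (2 * 4 ^ j * φ x - 1)), abs_mul (2 * 4 ^ j * pd i φ x),
        abs_mul (deriv (deriv Real.smoothTransition) (2 * 4 ^ j * φ x - 1)), a0, a0]
      have h5 : |deriv Real.smoothTransition (2 * 4 ^ j * φ x - 1)| * (2 * 4 ^ j * |pd i (pd i φ) x|) ≤ B * (2 * 16 ^ j * M2 i) := by
        gcongr
        · exact hB _
        · norm_num
        · exact hM2 i x
      have h6 : 2 * 4 ^ j * |pd i φ x| * (|deriv (deriv Real.smoothTransition) (2 * 4 ^ j * φ x - 1)| * (2 * 4 ^ j * |pd i φ x|)) ≤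
          2 * 4 ^ j * M1 i * (B * (2 * 4 ^ j * M1 i)) := by
        have := hM10 i
        gcongr
        · exact hM1 i x
        · exact hB2 _
        · exact hM1 i x
      refine (add_le_add h5 h6).trans (le_of_eq ?_)
      rw [h416]; ring
    refine (Finset.sum_le_sum fun i _ => h7 i).trans ?_
    rw [← Finset.sum_mul]
    gcongr
    linarith
  · intro x hx
    filter_upwards [hφ1 x hx] with y hy
    simp only [hη, hy]
    exact Real.smoothTransition.one_of_one_le (by norm_num)
  · intro j x hx
    have hx2 : (1:ℝ) ≤ 2 * 4 ^ j * φ x := by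
      have hcl : IsClosed {y : Euc d | (1:ℝ) ≤ 2 * 4 ^ j * φ y} := isClosed_le continuous_const (continuous_const.mul hφ.continuous)
      refine closure_minimal (fun y hy => ?_) hcl hx
      simp only [Set.mem_ofPred_eq]
      by_contra hlt
      push Not at hlt
      exact hy (Real.smoothTransition.zero_of_nonpos (by linarith))
    have hlt : (1:ℝ) < 4 ^ (j+1) * φ x := by
      rw [pow_succ]; nlinarith
    have hc : Continuous fun y => (4:ℝ) ^ (j+1) * φ y := continuous_const.mul hφ.continuous
    filter_upwards [hc.continuousAt.eventually (lt_mem_nhds hlt)] with y hy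
    simp only [hη]
    exact Real.smoothTransition.one_of_one_le (by nlinarith)

end cut

lemma iter_absorb {x : ℕ → ℝ} {B M : ℝ} (h1 : ∀ j, x j ≤ x (j+1) / 32 + 16 ^ j * B)
    (h2 : ∀ j, x j ≤ 16 ^ j * M) : x 0 ≤ 2 * B := by
  have h3 : ∀ n, x 0 ≤ (1/32) ^ n * x n + (2 - 2 * (1/2)^n) * B := by
    intro n
    induction n with
    | zero => simp
    | succ n ih =>
      refine ih.trans ?_
      have := mul_le_mul_of_nonneg_left (h1 n) (by positivity : (0:ℝ) ≤ (1/32)^n)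
      have e : (1/32 : ℝ)^n * 16^n = (1/2)^n := by rw [← mul_pow]; norm_num
      have e2 : (1/32 : ℝ) ^ n * (x (n+1) / 32 + 16 ^ n * B) = (1/32)^(n+1) * x (n+1) + ((1/32)^n * 16^n) * B := by
        rw [pow_succ]; ring
      rw [e2, e] at this
      rw [pow_succ (1/2 : ℝ)]
      linarith
  have h4 : ∀ n, x 0 ≤ (1/2) ^ n * M + (2 - 2 * (1/2)^n) * B := by
    intro n
    refine (h3 n).trans ?_
    have := mul_le_mul_of_nonneg_left (h2 n) (by positivity : (0:ℝ) ≤ (1/32)^n)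
    rw [← mul_assoc, ← mul_pow] at this
    norm_num at this ⊢
    linarith
  have ht : Tendsto (fun n : ℕ => (1/2 : ℝ) ^ n * M + (2 - 2 * (1/2)^n) * B) atTop (𝓝 (0 * M + (2 - 2 * 0) * B)) := by
    have h0 : Tendsto (fun n : ℕ => (1/2 : ℝ) ^ n) atTop (𝓝 0) := tendsto_pow_atTop_nhds_zero_of_lt_one (by norm_num) (by norm_num)
    exact (h0.mul_const M).add ((tendsto_const_nhds.sub (h0.const_mul 2)).mul_const B)
  have := ge_of_tendsto' ht h4
  linarith

end


section


lemma iter_absorb_enn {x : ℕ → ℝ≥0∞} {B M : ℝ≥0∞} (hM : M ≠ ⊤)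
    (h1 : ∀ j, x j ≤ ENNReal.ofReal (1/32) * x (j+1) + ENNReal.ofReal (16 ^ j) * B)
    (h2 : ∀ j, x j ≤ ENNReal.ofReal (16 ^ j) * M) : x 0 ≤ 2 * B := by
  by_cases hB : B = ⊤
  · simp [hB]
  have hx : ∀ j, x j ≠ ⊤ := fun j => ((h2 j).trans_lt (ENNReal.mul_lt_top ENNReal.ofReal_lt_top hM.lt_top)).ne
  have := iter_absorb (x := fun j => (x j).toReal) (B := B.toReal) (M := M.toReal) ?_ ?_
  · rw [← ENNReal.toReal_le_toReal (hx 0) (ENNReal.mul_ne_top (by simp) hB)]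
    simpa using this
  · intro j
    have := ENNReal.toReal_mono (ENNReal.add_ne_top.2 ⟨ENNReal.mul_ne_top ENNReal.ofReal_ne_top (hx _), ENNReal.mul_ne_top ENNReal.ofReal_ne_top hB⟩) (h1 j)
    rw [ENNReal.toReal_add (ENNReal.mul_ne_top ENNReal.ofReal_ne_top (hx _)) (ENNReal.mul_ne_top ENNReal.ofReal_ne_top hB),
      ENNReal.toReal_mul, ENNReal.toReal_mul, ENNReal.toReal_ofReal (by positivity), ENNReal.toReal_ofReal (by positivity)] at this
    linarith
  · intro j
    have := ENNReal.toReal_mono (ENNReal.mul_ne_top ENNReal.ofReal_ne_top hM) (h2 j)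
    rwa [ENNReal.toReal_mul, ENNReal.toReal_ofReal (by positivity)] at this

section
variable {d : ℕ} {p : ℝ≥0∞}

lemma nb {S : Set (Euc d)} (hS : IsCompact S) {a b : Euc d → ℝ} {c : ℝ} (ha : ∀ x, |a x| ≤ c)
    (has : tsupport a ⊆ S) : eLpNorm (fun x => a x * b x) p volume ≤ ENNReal.ofReal c * eLpNorm b p (volume.restrict S) := by
  rw [← eLpNorm_indicator_eq_eLpNorm_restrict hS.measurableSet]
  refine eLpNorm_le_mul_eLpNorm_of_ae_le_mul (Eventually.of_forall fun x => ?_) p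
  by_cases hx : x ∈ S
  · rw [Set.indicator_of_mem hx, norm_mul]
    exact mul_le_mul_of_nonneg_right (ha x) (norm_nonneg _)
  · have : a x = 0 := image_eq_zero_of_notMem_tsupport fun h => hx (has h)
    simp [this, Set.indicator_of_notMem hx]

lemma fin_on {S : Set (Euc d)} (hS : IsCompact S) {b : Euc d → ℝ} (hb : Continuous b) :
    eLpNorm b p (volume.restrict S) ≠ ⊤ := by
  have : IsFiniteMeasure (volume.restrict S : Measure (Euc d)) := ⟨by simpa using hS.measure_lt_top⟩
  obtain ⟨M, hM⟩ := hS.exists_bound_of_continuousOn hb.continuousOn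
  exact (MemLp.of_bound hb.aestronglyMeasurable M ((ae_restrict_iff' hS.measurableSet).2 (Eventually.of_forall hM))).2.ne

lemma pd_tsupport {f : Euc d → ℝ} (i : Fin d) : tsupport (pd i f) ⊆ tsupport f := by
  refine closure_minimal (fun x hx => ?_) (isClosed_tsupport f)
  by_contra h
  have h0 : f =ᶠ[𝓝 x] 0 := notMem_tsupport_iff_eventuallyEq.1 h
  have := (pd_congr h0 i).eq_of_nhds
  apply hx
  rw [this, pd]
  simp

lemma lap_tsupport {f : Euc d → ℝ} : tsupport (lap f) ⊆ tsupport f := by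
  refine closure_minimal (fun x hx => ?_) (isClosed_tsupport f)
  by_contra h
  apply hx
  rw [lap]
  exact Finset.sum_eq_zero fun i _ => image_eq_zero_of_notMem_tsupport fun h' => h (pd_tsupport i (pd_tsupport i h'))

lemma lap_cut_bound (hp1 : 1 ≤ p) {S : Set (Euc d)} (hS : IsCompact S) {η w : Euc d → ℝ} {A1 A2 : ℝ}
    (hη : ContDiff ℝ (⊤ : ℕ∞) η) (hw : ContDiff ℝ (⊤ : ℕ∞) w) (h0 : ∀ x, |η x| ≤ 1)
    (h1 : ∀ i x, |pd i η x| ≤ A1) (h2 : ∀ x, |lap η x| ≤ A2) (hs : tsupport η ⊆ S)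
    (g : Fin d → Euc d → ℝ) (hg : ∀ i, Continuous (g i)) (hgg : ∀ i x, pd i η x * pd i w x = pd i η x * g i x) :
    eLpNorm (lap (fun x => η x * w x)) p volume ≤ eLpNorm (lap w) p (volume.restrict S) +
      ENNReal.ofReal A2 * eLpNorm w p (volume.restrict S) +
      ∑ i, ENNReal.ofReal (2 * A1) * eLpNorm (g i) p (volume.restrict S) := by
  have e : lap (fun x => η x * w x) = fun x => (η x * lap w x + lap η x * w x) + ∑ i, (2 * pd i η x) * g i x := by
    ext x
    rw [lap_mul hη hw]
    simp_rw [hgg, mul_assoc]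
    ring
  have c1 : Continuous fun x => η x * lap w x := hη.continuous.mul (lap_sm hw).continuous
  have c2 : Continuous fun x => lap η x * w x := (lap_sm hη).continuous.mul hw.continuous
  have c3 : ∀ i, Continuous fun x => (2 * pd i η x) * g i x := fun i => (continuous_const.mul (pd_sm hη i).continuous).mul (hg i)
  rw [e]
  refine (eLpNorm_add_le (c1.add c2).aestronglyMeasurable (continuous_finsetSum _ fun i _ => c3 i).aestronglyMeasurable hp1).trans ?_
  refine add_le_add ((eLpNorm_add_le c1.aestronglyMeasurable c2.aestronglyMeasurable hp1).trans (add_le_add ?_ ?_)) ?_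
  · simpa using nb (p := p) (b := lap w) hS h0 hs
  · exact nb hS h2 (lap_tsupport.trans hs)
  · have e2 : (fun x => ∑ i, (2 * pd i η x) * g i x) = ∑ i, fun x => (2 * pd i η x) * g i x := by
      ext x; simp
    rw [e2]
    refine (eLpNorm_sum_le (fun i _ => (c3 i).aestronglyMeasurable) hp1).trans (Finset.sum_le_sum fun i _ => ?_)
    refine nb hS (fun x => ?_) ?_
    · rw [abs_mul, abs_two]; linarith [h1 i x]
    · refine (closure_mono fun x hx => ?_).trans ((pd_tsupport i).trans hs)
      intro h
      exact hx (by simp [h])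

/-- Interior `W^{2,p}` estimate for smooth functions. -/
lemma lemC (hp1 : 1 < p) (hp2 : p ≠ ⊤) {K U : Set (Euc d)} (hK : IsCompact K) (hU : IsOpen U) (hKU : K ⊆ U) :
    ∃ C : ℝ≥0, ∀ w : Euc d → ℝ, ContDiff ℝ (⊤ : ℕ∞) w → ∀ i,
      eLpNorm (pd i w) p (volume.restrict K) ≤ C * (eLpNorm w p (volume.restrict U) + eLpNorm (lap w) p (volume.restrict U)) ∧
      ∀ l, eLpNorm (pd i (pd l w)) p (volume.restrict K) ≤ C * (eLpNorm w p (volume.restrict U) + eLpNorm (lap w) p (volume.restrict U)) := by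
  obtain ⟨S, A, η, hS, hSU, hA, hη, h01, hsS, hη1, hη2, hηK, hηj⟩ := exists_cuts hK hU hKU
  obtain ⟨C, hC⟩ := hess_eL hp1 hp2 d
  have hA0 : 0 < A := by linarith
  set θ : ℝ := 1 / (64 * A * d * C + 1) with hθ
  have hθ0 : 0 < θ := by positivity
  have hθ1 : 64 * A * d * C * θ ≤ 1 := by
    rw [hθ, mul_one_div, div_le_one (by positivity)]; linarith
  set Q : ℝ := A + d * (2 * A * (2 * θ⁻¹)) with hQ
  have hQ0 : 0 ≤ Q := by positivity
  refine ⟨2 + C * (2 * (1 + Q.toNNReal)), fun w hw => ?_⟩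
  set W : ℕ → Euc d → ℝ := fun j x => η j x * w x with hW
  have hWs : ∀ j, ContDiff ℝ (⊤ : ℕ∞) (W j) := fun j => (hη j).mul hw
  have hηc : ∀ j, HasCompactSupport (η j) := fun j => HasCompactSupport.of_support_subset_isCompact hS ((subset_tsupport _).trans (hsS j))
  have hWc : ∀ j, HasCompactSupport (W j) := fun j => (hηc j).mul_right
  have hWn : ∀ j, eLpNorm (W j) p volume ≤ eLpNorm w p (volume.restrict S) := fun j => by
    simpa using nb (p := p) (b := w) hS (h01 j) (hsS j)
  set N := fun j => eLpNorm (lap (W j)) p volume with hN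
  set F := eLpNorm (lap w) p (volume.restrict S) with hF
  set E := eLpNorm w p (volume.restrict S) with hE
  have hn0 : N 0 ≤ 2 * (F + ENNReal.ofReal Q * E) := by
    refine iter_absorb_enn (x := N) (M := F + ENNReal.ofReal A * E + ∑ i, ENNReal.ofReal (2 * A) * eLpNorm (pd i w) p (volume.restrict S)) ?_ ?_ ?_
    · refine ENNReal.add_ne_top.2 ⟨ENNReal.add_ne_top.2 ⟨fin_on hS (lap_sm hw).continuous,
        ENNReal.mul_ne_top ENNReal.ofReal_ne_top (fin_on hS hw.continuous)⟩, ?_⟩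
      exact ENNReal.sum_ne_top.2 fun i _ => ENNReal.mul_ne_top ENNReal.ofReal_ne_top (fin_on hS (pd_sm hw i).continuous)
    · intro j
      have key := lap_cut_bound hp1.le hS (hη j) hw (h01 j) (hη1 j) (hη2 j) (hsS j) (fun i => pd i (W (j+1)))
        (fun i => (pd_sm (hWs (j+1)) i).continuous) (fun i x => ?_)
      swap
      · by_cases hx : x ∈ tsupport (η j)
        · have : w =ᶠ[𝓝 x] W (j+1) := by
            filter_upwards [hηj j x hx] with y hy
            simp [hW, hy]
          rw [(pd_congr this i).eq_of_nhds]
        · have : pd i (η j) x = 0 := image_eq_zero_of_notMem_tsupport fun h => hx (pd_tsupport i h)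
          simp [this]
      have hh : 0 < θ / 4 ^ j := by positivity
      have hi : ∀ i, eLpNorm (pd i (W (j+1))) p (volume.restrict S) ≤ ENNReal.ofReal (2 * (θ / 4 ^ j)⁻¹) * E +
          ENNReal.ofReal (θ / 4 ^ j) * (C * N (j+1)) := fun i => by
        refine (eLpNorm_mono_measure _ Measure.restrict_le_self).trans ((interp hp1 hp2 (hWs (j+1)) i hh).trans ?_)
        gcongr
        · exact hWn _
        · exact hC _ (hWs _) (hWc _) i i
      refine key.trans ?_
      have k2 : ∑ i : Fin d, ENNReal.ofReal (2 * (A * 4 ^ j)) * eLpNorm (pd i (W (j+1))) p (volume.restrict S) ≤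
         ∑ i : Fin d, ENNReal.ofReal (2 * (A * 4 ^ j)) * (ENNReal.ofReal (2 * (θ / 4 ^ j)⁻¹) * E +
          ENNReal.ofReal (θ / 4 ^ j) * (C * N (j+1))) := by
        gcongr with i
        exact hi i
      rw [Finset.sum_const, Finset.card_univ, Fintype.card_fin, nsmul_eq_mul] at k2
      have c1 : (d : ℝ≥0∞) * (ENNReal.ofReal (2 * (A * 4 ^ j)) * (ENNReal.ofReal (θ / 4 ^ j) * C)) ≤ ENNReal.ofReal (1/32) := by
        rw [← ENNReal.ofReal_natCast, ← ENNReal.ofReal_coe_nnreal (p := C), ← ENNReal.ofReal_mul (by positivity), ← ENNReal.ofReal_mul (by positivity),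
          ← ENNReal.ofReal_mul (by positivity)]
        apply ENNReal.ofReal_le_ofReal
        have : (d : ℝ) * (2 * (A * 4 ^ j) * (θ / 4 ^ j * C)) = 64 * A * d * C * θ / 32 := by
          field_simp; ring
        rw [this]; linarith
      have c2 : ENNReal.ofReal (A * 16 ^ j) + (d : ℝ≥0∞) * (ENNReal.ofReal (2 * (A * 4 ^ j)) * ENNReal.ofReal (2 * (θ / 4 ^ j)⁻¹)) ≤
          ENNReal.ofReal (16 ^ j) * ENNReal.ofReal Q := by
        rw [← ENNReal.ofReal_natCast, ← ENNReal.ofReal_mul (by positivity), ← ENNReal.ofReal_mul (by positivity),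
          ← ENNReal.ofReal_mul (by positivity), ← ENNReal.ofReal_add (by positivity) (by positivity)]
        apply ENNReal.ofReal_le_ofReal
        apply le_of_eq
        have h416 : (16:ℝ) ^ j = 4 ^ j * 4 ^ j := by rw [← mul_pow]; norm_num
        rw [hQ, h416]
        field_simp
      have c3 : (1 : ℝ≥0∞) ≤ ENNReal.ofReal (16 ^ j) := by
        rw [ENNReal.one_le_ofReal]; exact one_le_pow₀ (by norm_num)
      calc F + ENNReal.ofReal (A * 16 ^ j) * E + ∑ i : Fin d, ENNReal.ofReal (2 * (A * 4 ^ j)) * eLpNorm (pd i (W (j+1))) p (volume.restrict S)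
          ≤ F + ENNReal.ofReal (A * 16 ^ j) * E + (d : ℝ≥0∞) * (ENNReal.ofReal (2 * (A * 4 ^ j)) * (ENNReal.ofReal (2 * (θ / 4 ^ j)⁻¹) * E +
          ENNReal.ofReal (θ / 4 ^ j) * (C * N (j+1)))) := by gcongr
        _ = ((d : ℝ≥0∞) * (ENNReal.ofReal (2 * (A * 4 ^ j)) * (ENNReal.ofReal (θ / 4 ^ j) * C))) * N (j+1) + (1 * F +
          (ENNReal.ofReal (A * 16 ^ j) + (d : ℝ≥0∞) * (ENNReal.ofReal (2 * (A * 4 ^ j)) * ENNReal.ofReal (2 * (θ / 4 ^ j)⁻¹))) * E) := by ring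
        _ ≤ ENNReal.ofReal (1/32) * N (j+1) + (ENNReal.ofReal (16 ^ j) * F + (ENNReal.ofReal (16 ^ j) * ENNReal.ofReal Q) * E) := by gcongr
        _ = _ := by ring
    · intro j
      refine (lap_cut_bound hp1.le hS (hη j) hw (h01 j) (hη1 j) (hη2 j) (hsS j) (fun i => pd i w)
        (fun i => (pd_sm hw i).continuous) (fun i x => rfl)).trans ?_
      have c3 : (1 : ℝ≥0∞) ≤ ENNReal.ofReal (16 ^ j) := by
        rw [ENNReal.one_le_ofReal]; exact one_le_pow₀ (by norm_num)
      rw [mul_add, mul_add, Finset.mul_sum]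
      refine add_le_add (add_le_add ?_ ?_) (Finset.sum_le_sum fun i _ => ?_)
      · exact le_mul_of_one_le_left (by simp) c3
      · rw [← mul_assoc, ← ENNReal.ofReal_mul (by positivity), mul_comm A]
      · rw [← mul_assoc (ENNReal.ofReal (16 ^ j)), ← ENNReal.ofReal_mul (by positivity)]
        gcongr ENNReal.ofReal ?_ * _
        have : (4:ℝ)^j ≤ 16^j := by gcongr; norm_num
        nlinarith
  have hEU : E ≤ eLpNorm w p (volume.restrict U) := eLpNorm_mono_measure _ (Measure.restrict_mono hSU le_rfl)
  have hFU : F ≤ eLpNorm (lap w) p (volume.restrict U) := eLpNorm_mono_measure _ (Measure.restrict_mono hSU le_rfl)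
  have hWK : ∀ x ∈ K, w =ᶠ[𝓝 x] W 0 := fun x hx => by
    filter_upwards [hηK x hx] with y hy
    simp [hW, hy]
  have hCN : C * N 0 ≤ (C * (2 * (1 + Q.toNNReal)) : ℝ≥0) * (eLpNorm w p (volume.restrict U) + eLpNorm (lap w) p (volume.restrict U)) := by
    calc C * N 0 ≤ C * (2 * (F + ENNReal.ofReal Q * E)) := by gcongr
      _ ≤ C * (2 * ((1 + ENNReal.ofReal Q) * F + (1 + ENNReal.ofReal Q) * E)) := by
        gcongr
        · exact le_mul_of_one_le_left (by simp) (by simp)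
        · simp
      _ = (C * (2 * (1 + ENNReal.ofReal Q))) * (E + F) := by ring
      _ ≤ _ := by
        push_cast
        rw [ENNReal.ofReal]
        gcongr
  have h2 : ∀ i l, eLpNorm (pd i (pd l (W 0))) p volume ≤ (C * (2 * (1 + Q.toNNReal)) : ℝ≥0) * (eLpNorm w p (volume.restrict U) + eLpNorm (lap w) p (volume.restrict U)) :=
    fun i l => (hC _ (hWs 0) (hWc 0) i l).trans hCN
  intro i
  constructor
  · rw [eLpNorm_congr_ae (g := pd i (W 0)) ((ae_restrict_iff' hK.measurableSet).2 (Eventually.of_forall fun x hx => (pd_congr (hWK x hx) i).eq_of_nhds))]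
    refine (eLpNorm_mono_measure _ Measure.restrict_le_self).trans ((interp hp1 hp2 (hWs 0) i one_pos).trans ?_)
    rw [ENNReal.coe_add, add_mul]
    refine add_le_add ?_ ?_
    · have : ENNReal.ofReal (2 * 1⁻¹) = ((2:ℝ≥0) : ℝ≥0∞) := by norm_num
      rw [this]
      gcongr
      exact (hWn 0).trans (hEU.trans le_self_add)
    · simpa using h2 i i
  · intro l
    rw [eLpNorm_congr_ae (g := pd i (pd l (W 0))) ((ae_restrict_iff' hK.measurableSet).2 (Eventually.of_forall fun x hx => (pd_congr (pd_congr (hWK x hx) l) i).eq_of_nhds))]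
    refine (eLpNorm_mono_measure _ Measure.restrict_le_self).trans ((h2 i l).trans ?_)
    gcongr
    exact le_add_self
end

end


section


section
variable {d : ℕ} {p : ℝ≥0∞}

lemma pd_lap {w : Euc d → ℝ} (hw : ContDiff ℝ (⊤ : ℕ∞) w) (i : Fin d) : lap (pd i w) = pd i (lap w) := by
  ext x
  have e : lap w = fun x => ∑ j, pd j (pd j w) x := rfl
  rw [e, lap]
  rw [show pd i (fun x => ∑ j, pd j (pd j w) x) x = ∑ j, pd i (pd j (pd j w)) x by
    rw [pd, fderiv_fun_sum fun j _ => (sm_diff (pd_sm (pd_sm hw j) j)) x]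
    simp [pd]]
  refine Finset.sum_congr rfl fun j _ => ?_
  rw [pd_comm hw j i, pd_comm (pd_sm hw j) j i]

lemma iterPD_sm {w : Euc d → ℝ} (hw : ContDiff ℝ (⊤ : ℕ∞) w) {m : ℕ} (a : Fin m → Fin d) : ContDiff ℝ (⊤ : ℕ∞) (iterPD a w) := by
  induction m generalizing w with
  | zero => exact hw
  | succ m ih => exact ih (pd_sm hw (a 0)) _

/-- right hand side -/
noncomputable def rhsD (U : Set (Euc d)) (p : ℝ≥0∞) (k : ℕ) (f : Euc d → ℝ) : ℝ≥0∞ :=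
  ∑ j ∈ Finset.range (k+1), ∑ b : Fin j → Fin d, eLpNorm (iterPD b f) p (volume.restrict U)

lemma rhsD_term {U V : Set (Euc d)} (hVU : V ⊆ U) {k j : ℕ} (hj : j ≤ k) (b : Fin j → Fin d) (f : Euc d → ℝ) :
    eLpNorm (iterPD b f) p (volume.restrict V) ≤ rhsD U p k f := by
  refine (eLpNorm_mono_measure _ (Measure.restrict_mono hVU le_rfl)).trans ?_
  refine (Finset.single_le_sum (f := fun b : Fin j → Fin d => eLpNorm (iterPD b f) p (volume.restrict U)) (fun _ _ => zero_le) (Finset.mem_univ b)).trans ?_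
  exact Finset.single_le_sum (f := fun j => ∑ b : Fin j → Fin d, eLpNorm (iterPD b f) p (volume.restrict U)) (fun _ _ => zero_le)
    (Finset.mem_range.2 (Nat.lt_succ_of_le hj))

lemma lemD (hp1 : 1 < p) (hp2 : p ≠ ⊤) (k : ℕ) {K U : Set (Euc d)} (hK : IsCompact K) (hU : IsOpen U) (hKU : K ⊆ U) :
    ∃ C : ℝ≥0, ∀ w : Euc d → ℝ, ContDiff ℝ (⊤ : ℕ∞) w → ∀ m ≤ k + 2, ∀ a : Fin m → Fin d,
      eLpNorm (iterPD a w) p (volume.restrict K) ≤ C * (eLpNorm w p (volume.restrict U) + rhsD U p k (lap w)) := by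
  induction k generalizing K U with
  | zero =>
    obtain ⟨C, hC⟩ := lemC hp1 hp2 hK hU hKU
    refine ⟨1 + C, fun w hw m hm a => ?_⟩
    have h0 : eLpNorm (lap w) p (volume.restrict U) ≤ rhsD U p 0 (lap w) :=
      rhsD_term (j := 0) subset_rfl le_rfl Fin.elim0 (lap w)
    have h1 : C * (eLpNorm w p (volume.restrict U) + eLpNorm (lap w) p (volume.restrict U)) ≤
        (1 + C : ℝ≥0) * (eLpNorm w p (volume.restrict U) + rhsD U p 0 (lap w)) := by
      push_cast
      gcongr
      simp
    match m, hm, a with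
    | 0, _, a =>
      change eLpNorm w p _ ≤ _
      push_cast
      rw [add_mul, one_mul]
      exact (eLpNorm_mono_measure _ (Measure.restrict_mono hKU le_rfl)).trans (le_self_add.trans le_self_add)
    | 1, _, a => exact ((hC w hw (a 0)).1).trans h1
    | 2, _, a => exact ((hC w hw (a 1)).2 (a 0)).trans h1
  | succ k ih =>
    obtain ⟨L, hL, hKL, hLU⟩ := exists_compact_between hK hU hKU
    obtain ⟨C1, hC1⟩ := ih hK isOpen_interior hKL
    obtain ⟨C2, hC2⟩ := lemC hp1 hp2 hL hU hLU
    set N : ℝ≥0 := ∑ j ∈ Finset.range (k+1), ∑ b : Fin j → Fin d, 1 with hN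
    refine ⟨1 + C1 * (C2 + N), fun w hw m hm a => ?_⟩
    set T := eLpNorm w p (volume.restrict U) + rhsD U p (k+1) (lap w) with hT
    match m, hm, a with
    | 0, _, a =>
      change eLpNorm w p _ ≤ _
      push_cast
      rw [add_mul, one_mul]
      exact (eLpNorm_mono_measure _ (Measure.restrict_mono hKU le_rfl)).trans (le_self_add.trans le_self_add)
    | n+1, hm, a =>
      change eLpNorm (iterPD (fun i => a i.succ) (pd (a 0) w)) p _ ≤ _
      refine (hC1 (pd (a 0) w) (pd_sm hw _) n (by omega) _).trans ?_
      have h1 : eLpNorm (pd (a 0) w) p (volume.restrict (interior L)) ≤ C2 * T := by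
        refine (eLpNorm_mono_measure _ (Measure.restrict_mono interior_subset le_rfl)).trans ((hC2 w hw (a 0)).1.trans ?_)
        gcongr
        rw [hT]
        gcongr
        exact rhsD_term (j := 0) subset_rfl (Nat.zero_le _) Fin.elim0 (lap w)
      have h2 : rhsD (interior L) p k (lap (pd (a 0) w)) ≤ N * T := by
        rw [pd_lap hw, rhsD, hN]
        push_cast
        rw [Finset.sum_mul]
        refine Finset.sum_le_sum fun j hj => ?_
        have : ∀ b : Fin j → Fin d, eLpNorm (iterPD b (pd (a 0) (lap w))) p (volume.restrict (interior L)) ≤ T := fun b => by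
          have : iterPD b (pd (a 0) (lap w)) = iterPD (Fin.cons (a 0) b : Fin (j+1) → Fin d) (lap w) := rfl
          rw [this, hT]
          refine (rhsD_term (interior_subset.trans hLU) ?_ _ _).trans le_add_self
          have := Finset.mem_range.1 hj
          omega
        refine (Finset.sum_le_sum fun b _ => this b).trans ?_
        simp
      calc C1 * (eLpNorm (pd (a 0) w) p (volume.restrict (interior L)) + rhsD (interior L) p k (lap (pd (a 0) w)))
          ≤ C1 * (C2 * T + N * T) := by gcongr
        _ = (C1 * (C2 + N)) * T := by ring
        _ ≤ _ := by
          push_cast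
          gcongr
          exact le_add_self
end

end


section


section
variable {d : ℕ} {p : ℝ≥0∞}

noncomputable def Mo (ρ g : Euc d → ℝ) (x : Euc d) : ℝ := ∫ y, g y * ρ (x - y)

structure Moll (ε : ℝ) (ρ : Euc d → ℝ) : Prop where
  sm : ContDiff ℝ (⊤ : ℕ∞) ρ
  nn : ∀ x, 0 ≤ ρ x
  int : ∫ x, ρ x = 1
  supp : tsupport ρ ⊆ Metric.closedBall 0 ε

lemma Moll.cs {ε : ℝ} {ρ : Euc d → ℝ} (h : Moll ε ρ) : HasCompactSupport ρ :=
  HasCompactSupport.of_support_subset_isCompact (isCompact_closedBall 0 ε) ((subset_tsupport _).trans h.supp)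

lemma exists_moll {ε : ℝ} (hε : 0 < ε) : ∃ ρ : Euc d → ℝ, Moll ε ρ := by
  let φ : ContDiffBump (0 : Euc d) := ⟨ε / 2, ε, by linarith, by linarith⟩
  exact ⟨φ.normed volume, φ.contDiff_normed, φ.nonneg_normed, φ.integral_normed, by rw [φ.tsupport_normed_eq]⟩

lemma Mo_conv (ρ g : Euc d → ℝ) : Mo ρ g = convolution g ρ (ContinuousLinearMap.mul ℝ ℝ) volume := by
  ext x
  simp [Mo, convolution_def]

lemma Mo_sm {ρ g : Euc d → ℝ} (hρ : ContDiff ℝ (⊤ : ℕ∞) ρ) (hc : HasCompactSupport ρ) (hg : LocallyIntegrable g volume) :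
    ContDiff ℝ (⊤ : ℕ∞) (Mo ρ g) := by
  rw [Mo_conv]
  exact hc.contDiff_convolution_right _ hg hρ

lemma Mo_pd {ρ g : Euc d → ℝ} (hρ : ContDiff ℝ (⊤ : ℕ∞) ρ) (hc : HasCompactSupport ρ) (hg : LocallyIntegrable g volume) (i : Fin d) :
    pd i (Mo ρ g) = Mo (pd i ρ) g := by
  ext x
  have h1 : ContDiff ℝ 1 ρ := hρ.of_le (by exact_mod_cast le_top)
  rw [pd, Mo_conv, (hc.hasFDerivAt_convolution_right (ContinuousLinearMap.mul ℝ ℝ) hg h1 x).fderiv,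
    convolution_precompR_apply _ hg (hc.fderiv ℝ) (h1.continuous_fderiv (by norm_num)), Mo_conv]
  rfl

lemma iterPD_cs {w : Euc d → ℝ} (hw : HasCompactSupport w) {m : ℕ} (a : Fin m → Fin d) : HasCompactSupport (iterPD a w) := by
  induction m generalizing w with
  | zero => exact hw
  | succ m ih => exact ih (pd_cs hw (a 0)) _

lemma Mo_iterPD {ρ g : Euc d → ℝ} (hρ : ContDiff ℝ (⊤ : ℕ∞) ρ) (hc : HasCompactSupport ρ) (hg : LocallyIntegrable g volume)
    {m : ℕ} (a : Fin m → Fin d) : iterPD a (Mo ρ g) = Mo (iterPD a ρ) g := by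
  induction m generalizing ρ with
  | zero => rfl
  | succ m ih =>
    change iterPD _ (pd (a 0) (Mo ρ g)) = Mo (iterPD _ (pd (a 0) ρ)) g
    rw [Mo_pd hρ hc hg, ih (pd_sm hρ _) (pd_cs hc _)]

lemma Mo_int {ρ g : Euc d → ℝ} (hρ : Continuous ρ) (hc : HasCompactSupport ρ) (hg : LocallyIntegrable g volume) (x : Euc d) :
    Integrable (fun y => g y * ρ (x - y)) volume := by
  have := hc.convolutionExists_right (ContinuousLinearMap.mul ℝ ℝ) hg hρ x
  simpa [ConvolutionExistsAt] using this

lemma Mo_sub {ρ g h : Euc d → ℝ} (hρ : Continuous ρ) (hc : HasCompactSupport ρ) (hg : LocallyIntegrable g volume)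
    (hh : LocallyIntegrable h volume) : Mo ρ (g - h) = Mo ρ g - Mo ρ h := by
  ext x
  rw [Pi.sub_apply, Mo, Mo, Mo, ← integral_sub (Mo_int hρ hc hg x) (Mo_int hρ hc hh x)]
  refine integral_congr_ae (Eventually.of_forall fun y => ?_)
  simp [sub_mul]

lemma Mo_lap {ρ g : Euc d → ℝ} (hρ : ContDiff ℝ (⊤ : ℕ∞) ρ) (hc : HasCompactSupport ρ) (hg : LocallyIntegrable g volume) :
    lap (Mo ρ g) = Mo (lap ρ) g := by
  ext x
  rw [lap]
  simp_rw [Mo_pd hρ hc hg, Mo_pd (pd_sm hρ _) (pd_cs hc _) hg]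
  simp only [Mo]
  rw [← integral_finsetSum _ fun i _ => Mo_int (pd_sm (pd_sm hρ i) i).continuous (pd_cs (pd_cs hc i) i) hg x]
  simp [lap, Finset.mul_sum]

lemma Mo_contr (hp1 : 1 < p) (hp2 : p ≠ ⊤) {ε : ℝ} {ρ : Euc d → ℝ} (h : Moll ε ρ) {g : Euc d → ℝ} (hg : AEStronglyMeasurable g volume) :
    eLpNorm (Mo ρ g) p volume ≤ eLpNorm g p volume := by
  have e1 : Mo ρ g = Mo ρ (hg.mk g) := by
    ext x
    exact integral_congr_ae (by filter_upwards [hg.ae_eq_mk] with y hy; rw [hy])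
  rw [e1, eLpNorm_congr_ae hg.ae_eq_mk]
  set G := hg.mk g
  have hG : Measurable G := hg.stronglyMeasurable_mk.measurable
  have hρm : Measurable fun y => ‖ρ y‖ₑ := h.sm.continuous.measurable.enorm
  have hμ : ∫⁻ y, ‖ρ y‖ₑ = 1 := by
    have h1 := ofReal_integral_norm_eq_lintegral_enorm (h.sm.continuous.integrable_of_hasCompactSupport h.cs : Integrable ρ volume)
    rw [← h1]
    simp_rw [Real.norm_of_nonneg (h.nn _)]
    simp [h.int]
  set μ : Measure (Euc d) := volume.withDensity fun y => ‖ρ y‖ₑ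
  have hμu : μ Set.univ = 1 := by simp [μ, hμ]
  have : IsFiniteMeasure μ := ⟨by simp [hμu]⟩
  have key := mink hp1 hp2 μ (fun y => -y) measurable_neg (F := fun x => ‖G x‖ₑ) hG.enorm
  rw [hμu, one_mul, eLpNorm_enorm] at key
  refine le_trans ?_ key
  refine eLpNorm_mono_enorm fun x => ?_
  have hm : Measurable fun y => ‖G (x + -y)‖ₑ := hG.enorm.comp (f := fun y => x + -y) (measurable_const.add measurable_neg)
  rw [enorm_eq_self, lintegral_withDensity_eq_lintegral_mul _ hρm hm]
  rw [Mo, ← integral_sub_left_eq_self _ volume x]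
  refine (enorm_integral_le_lintegral_enorm _).trans (le_of_eq ?_)
  refine lintegral_congr fun y => ?_
  simp [enorm_mul, mul_comm, sub_eq_add_neg]

lemma Mo_cc (hp1 : 1 < p) {h : Euc d → ℝ} (hc : Continuous h) (hs : HasCompactSupport h)
    {ρ : ℕ → Euc d → ℝ} {ε : ℕ → ℝ} (hρ : ∀ n, Moll (ε n) (ρ n)) (hε : Tendsto ε atTop (𝓝 0)) :
    Tendsto (fun n => eLpNorm (Mo (ρ n) h - h) p volume) atTop (𝓝 0) := by
  set L := Metric.cthickening 1 (tsupport h) with hL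
  have hLc : IsCompact L := hs.cthickening
  have hV : (volume L) ^ p.toReal⁻¹ ≠ ⊤ := ENNReal.rpow_ne_top_of_nonneg (by positivity) hLc.measure_lt_top.ne
  have hbound : ∀ δ > 0, ∀ᶠ n in atTop, eLpNorm (Mo (ρ n) h - h) p volume ≤ (volume L) ^ p.toReal⁻¹ * ENNReal.ofReal δ := by
    intro δ hδ
    obtain ⟨r, hr, hru⟩ := Metric.uniformContinuous_iff.1 (hs.uniformContinuous_of_continuous hc) δ hδ
    filter_upwards [hε.eventually (gt_mem_nhds hr), hε.eventually (gt_mem_nhds one_pos)] with n hn hn1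
    have hz : ∀ x y, ρ n (x - y) ≠ 0 → dist y x ≤ ε n := fun x y hxy => by
      have := (hρ n).supp (subset_tsupport _ hxy)
      rw [mem_closedBall_zero_iff] at this
      rwa [dist_comm, dist_eq_norm]
    have h1 : ∀ x, ‖(Mo (ρ n) h - h) x‖ ≤ δ := by
      intro x
      have i1 : Integrable (fun y => ρ n (x - y)) volume := by
        have := Mo_int (g := fun _ => (1:ℝ)) (hρ n).sm.continuous (hρ n).cs (continuous_const.locallyIntegrable) x
        simpa using this
      have e1 : ∫ y, ρ n (x - y) = 1 := by rw [integral_sub_left_eq_self (ρ n) volume x, (hρ n).int]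
      have e : (Mo (ρ n) h - h) x = ∫ y, (h y - h x) * ρ n (x - y) := by
        simp_rw [sub_mul]
        rw [integral_sub (Mo_int (hρ n).sm.continuous (hρ n).cs hc.locallyIntegrable x) (i1.const_mul _), integral_const_mul, e1]
        simp [Mo]
      rw [e]
      refine (norm_integral_le_of_norm_le (i1.const_mul δ) (Eventually.of_forall fun y => ?_)).trans (by rw [integral_const_mul, e1, mul_one])
      rw [norm_mul, Real.norm_of_nonneg ((hρ n).nn _)]
      by_cases hxy : ρ n (x - y) = 0
      · simp [hxy]
      · refine mul_le_mul_of_nonneg_right ?_ ((hρ n).nn _)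
        have := hru ((hz x y hxy).trans_lt hn)
        rw [Real.dist_eq] at this
        exact this.le
    have h2 : Function.support (Mo (ρ n) h - h) ⊆ L := by
      intro x hx
      by_contra hxL
      have hx0 : ∀ y, dist y x ≤ 1 → h y = 0 := fun y hy => by
        by_contra hy0
        exact hxL (Metric.mem_cthickening_of_dist_le x y 1 _ (subset_tsupport _ hy0) (by rwa [dist_comm]))
      apply hx
      rw [Pi.sub_apply, hx0 x (by simp), sub_zero, Mo]
      refine integral_eq_zero_of_ae (Eventually.of_forall fun y => ?_)
      by_cases hxy : ρ n (x - y) = 0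
      · simp [hxy]
      · simp [hx0 y ((hz x y hxy).trans hn1.le)]
    rw [← eLpNorm_restrict_eq_of_support_subset h2]
    have := eLpNorm_le_of_ae_bound (p := p) (μ := volume.restrict L) (Eventually.of_forall h1)
    simpa using this
  refine ENNReal.tendsto_nhds_zero.2 fun η hη => ?_
  by_cases hη' : η = ⊤
  · simp [hη']
  obtain ⟨δ, hδ, hδη⟩ : ∃ δ : ℝ, 0 < δ ∧ (volume L) ^ p.toReal⁻¹ * ENNReal.ofReal δ ≤ η := by
    refine ⟨η.toReal / ((volume L ^ p.toReal⁻¹).toReal + 1), ?_, ?_⟩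
    · have := ENNReal.toReal_pos hη.ne' hη'
      positivity
    · rw [← ENNReal.ofReal_toReal hV, ← ENNReal.ofReal_mul (by positivity)]
      refine ENNReal.ofReal_le_of_le_toReal ?_
      simp only [ENNReal.toReal_ofReal_mul, ENNReal.toReal_nonneg, ENNReal.toReal_ofReal]
      rw [mul_div_assoc', div_le_iff₀ (by positivity)]
      nlinarith [ENNReal.toReal_nonneg (a := η), ENNReal.toReal_nonneg (a := volume L ^ p.toReal⁻¹)]
  filter_upwards [hbound δ hδ] with n hn
  exact hn.trans hδη

lemma Mo_tendsto (hp1 : 1 < p) (hp2 : p ≠ ⊤) {g : Euc d → ℝ} (hg : MemLp g p volume)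
    {ρ : ℕ → Euc d → ℝ} {ε : ℕ → ℝ} (hρ : ∀ n, Moll (ε n) (ρ n)) (hε : Tendsto ε atTop (𝓝 0)) :
    Tendsto (fun n => eLpNorm (Mo (ρ n) g - g) p volume) atTop (𝓝 0) := by
  refine ENNReal.tendsto_nhds_zero.2 fun η hη => ?_
  have hη3 : η / 3 ≠ 0 := by simp [hη.ne']
  obtain ⟨h, hs, hgh, hc, hh⟩ := hg.exists_hasCompactSupport_eLpNorm_sub_le hp2 hη3
  filter_upwards [ENNReal.tendsto_nhds_zero.1 (Mo_cc hp1 hc hs hρ hε) (η / 3) (pos_iff_ne_zero.2 hη3)] with n hn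
  have hgl := hg.locallyIntegrable hp1.le
  have e : Mo (ρ n) g - g = (Mo (ρ n) (g - h) + (Mo (ρ n) h - h)) + (h - g) := by
    rw [Mo_sub (hρ n).sm.continuous (hρ n).cs hgl hc.locallyIntegrable]
    ring
  have m1 : AEStronglyMeasurable (Mo (ρ n) (g - h)) volume :=
    (Mo_sm (hρ n).sm (hρ n).cs (hgl.sub hc.locallyIntegrable)).continuous.aestronglyMeasurable
  have m2 : AEStronglyMeasurable (Mo (ρ n) h - h) volume :=
    ((Mo_sm (hρ n).sm (hρ n).cs hc.locallyIntegrable).continuous.sub hc).aestronglyMeasurable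
  rw [e]
  calc _ ≤ eLpNorm (Mo (ρ n) (g - h)) p volume + eLpNorm (Mo (ρ n) h - h) p volume + eLpNorm (h - g) p volume :=
        (eLpNorm_add_le (m1.add m2) (hh.1.sub hg.1) hp1.le).trans (add_le_add_left (eLpNorm_add_le m1 m2 hp1.le) _)
    _ ≤ η / 3 + η / 3 + η / 3 := by
      gcongr
      · exact (Mo_contr hp1 hp2 (hρ n) (hg.1.sub hh.1)).trans hgh
      · rw [eLpNorm_sub_comm]; exact hgh
    _ = η := ENNReal.add_thirds η
end

end


section


section
variable {d : ℕ} {p : ℝ≥0∞}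

lemma pd_refl {ρ : Euc d → ℝ} (hρ : Differentiable ℝ ρ) (x : Euc d) (c : ℝ) (i : Fin d) :
    pd i (fun y => c * ρ (x - y)) = fun y => (-c) * pd i ρ (x - y) := by
  ext y
  have h1 : HasFDerivAt (fun y : Euc d => x - y) (-(ContinuousLinearMap.id ℝ (Euc d))) y := (hasFDerivAt_id y).const_sub x
  have h2 : HasFDerivAt (fun y : Euc d => ρ (x - y)) ((fderiv ℝ ρ (x - y)).comp (-(ContinuousLinearMap.id ℝ (Euc d)))) y :=
    (hρ (x - y)).hasFDerivAt.comp y h1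
  rw [pd, (h2.const_mul c).fderiv]
  simp [pd]

lemma iterPD_refl {ρ : Euc d → ℝ} (hρ : ContDiff ℝ (⊤ : ℕ∞) ρ) (x : Euc d) (c : ℝ) {m : ℕ} (a : Fin m → Fin d) :
    iterPD a (fun y => c * ρ (x - y)) = fun y => (-1) ^ m * c * iterPD a ρ (x - y) := by
  induction m generalizing ρ c with
  | zero => simp [iterPD]
  | succ m ih =>
    change iterPD _ (pd (a 0) _) = fun y => _ * iterPD _ (pd (a 0) ρ) (x - y)
    rw [pd_refl (sm_diff hρ), ih (pd_sm hρ _)]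
    ext y
    ring

lemma lap_refl {ρ : Euc d → ℝ} (hρ : ContDiff ℝ (⊤ : ℕ∞) ρ) (x : Euc d) :
    lap (fun y => ρ (x - y)) = fun y => lap ρ (x - y) := by
  ext y
  simp only [lap]
  refine Finset.sum_congr rfl fun i _ => ?_
  have h := pd_refl (sm_diff hρ) x 1 i
  have h2 := pd_refl (sm_diff (pd_sm hρ i)) x (-1) i
  simp only [one_mul] at h
  rw [h, h2]
  simp

lemma Moll.test {Ω : Set (Euc d)} {ε : ℝ} {ρ : Euc d → ℝ} (h : Moll ε ρ) {x : Euc d} (hx : Metric.closedBall x ε ⊆ Ω) :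
    IsTestFun Ω (fun y => ρ (x - y)) := by
  have hs : tsupport (fun y => ρ (x - y)) ⊆ Metric.closedBall x ε := by
    refine closure_minimal (fun y hy => ?_) Metric.isClosed_closedBall
    have := h.supp (subset_tsupport _ hy)
    rw [mem_closedBall_zero_iff] at this
    rwa [Metric.mem_closedBall, dist_comm, dist_eq_norm]
  exact ⟨h.sm.comp (contDiff_const.sub contDiff_id),
    HasCompactSupport.of_support_subset_isCompact (isCompact_closedBall x ε) ((subset_tsupport _).trans hs), hs.trans hx⟩

lemma Mo_ind {Ω : Set (Euc d)} (hΩ : IsOpen Ω) (ρ g : Euc d → ℝ) (x : Euc d) :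
    Mo ρ (Ω.indicator g) x = ∫ y in Ω, g y * ρ (x - y) := by
  rw [Mo, ← integral_indicator hΩ.measurableSet]
  refine integral_congr_ae (Eventually.of_forall fun y => ?_)
  by_cases hy : y ∈ Ω <;> simp [hy]

lemma moll_weak {Ω : Set (Euc d)} (hΩ : IsOpen Ω) {m : ℕ} {g : Euc d → ℝ} {v : (Fin m → Fin d) → Euc d → ℝ} (H : HasWeakDerivs Ω m g v)
    {ε : ℝ} {ρ : Euc d → ℝ} (h : Moll ε ρ) {x : Euc d} (hx : Metric.closedBall x ε ⊆ Ω) (a : Fin m → Fin d) :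
    Mo (iterPD a ρ) (Ω.indicator g) x = Mo ρ (Ω.indicator (v a)) x := by
  have h1 := H a _ (h.test hx)
  have h2 := iterPD_refl h.sm x 1 a
  simp only [one_mul, mul_one] at h2
  rw [h2] at h1
  rw [Mo_ind hΩ, Mo_ind hΩ]
  have e : (fun y => g y * ((-1) ^ m * iterPD a ρ (x - y))) = fun y => (-1)^m * (g y * iterPD a ρ (x - y)) := by
    ext y; ring
  rw [e, integral_const_mul] at h1
  exact mul_left_cancel₀ (pow_ne_zero m (by norm_num)) h1

lemma moll_lap {Ω : Set (Euc d)} (hΩ : IsOpen Ω) {u f : Euc d → ℝ} (H : IsWeakLap Ω u f)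
    {ε : ℝ} {ρ : Euc d → ℝ} (h : Moll ε ρ) {x : Euc d} (hx : Metric.closedBall x ε ⊆ Ω) :
    Mo (lap ρ) (Ω.indicator u) x = Mo ρ (Ω.indicator f) x := by
  have h1 := H _ (h.test hx)
  rw [lap_refl h.sm] at h1
  rw [Mo_ind hΩ, Mo_ind hΩ]
  exact h1

lemma pd_sub {f g : Euc d → ℝ} (hf : Differentiable ℝ f) (hg : Differentiable ℝ g) (i : Fin d) :
    pd i (f - g) = pd i f - pd i g := by
  ext x
  rw [pd, fderiv_sub (hf x) (hg x)]
  simp [pd]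

lemma iterPD_sub {f g : Euc d → ℝ} (hf : ContDiff ℝ (⊤ : ℕ∞) f) (hg : ContDiff ℝ (⊤ : ℕ∞) g) {m : ℕ} (a : Fin m → Fin d) :
    iterPD a (f - g) = iterPD a f - iterPD a g := by
  induction m generalizing f g with
  | zero => rfl
  | succ m ih =>
    change iterPD _ (pd (a 0) (f - g)) = iterPD _ (pd (a 0) f) - iterPD _ (pd (a 0) g)
    rw [pd_sub (sm_diff hf) (sm_diff hg), ih (pd_sm hf _) (pd_sm hg _)]

lemma lap_sub {f g : Euc d → ℝ} (hf : ContDiff ℝ (⊤ : ℕ∞) f) (hg : ContDiff ℝ (⊤ : ℕ∞) g) :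
    lap (f - g) = lap f - lap g := by
  ext x
  simp only [lap, Pi.sub_apply, ← Finset.sum_sub_distrib]
  refine Finset.sum_congr rfl fun i _ => ?_
  rw [pd_sub (sm_diff hf) (sm_diff hg), pd_sub (sm_diff (pd_sm hf _)) (sm_diff (pd_sm hg _))]
  rfl

lemma iterPD_congr {f g : Euc d → ℝ} {x : Euc d} (h : f =ᶠ[𝓝 x] g) {m : ℕ} (a : Fin m → Fin d) : iterPD a f =ᶠ[𝓝 x] iterPD a g := by
  induction m generalizing f g with
  | zero => exact h
  | succ m ih => exact ih (pd_congr h _) _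

lemma pd_iterPD {w : Euc d → ℝ} (hw : ContDiff ℝ (⊤ : ℕ∞) w) (i : Fin d) {m : ℕ} (a : Fin m → Fin d) :
    iterPD a (pd i w) = pd i (iterPD a w) := by
  induction m generalizing w with
  | zero => rfl
  | succ m ih =>
    change iterPD _ (pd (a 0) (pd i w)) = pd i (iterPD _ (pd (a 0) w))
    rw [← ih (pd_sm hw _)]
    congr 1
    ext x
    rw [pd_comm hw]

lemma ibp_full {w φ : Euc d → ℝ} (hw : ContDiff ℝ (⊤ : ℕ∞) w) (hφ : ContDiff ℝ (⊤ : ℕ∞) φ) (hc : HasCompactSupport φ)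
    {m : ℕ} (a : Fin m → Fin d) : ∫ x, w x * iterPD a φ x = (-1) ^ m * ∫ x, iterPD a w x * φ x := by
  induction m generalizing φ with
  | zero => simp [iterPD]
  | succ m ih =>
    change ∫ x, w x * iterPD _ (pd (a 0) φ) x = _ * ∫ x, iterPD _ (pd (a 0) w) x * φ x
    rw [ih (pd_sm hφ _) (pd_cs hc _), pd_iterPD hw]
    set W := iterPD (fun i => a i.succ) w with hW
    have hWs : ContDiff ℝ (⊤ : ℕ∞) W := iterPD_sm hw _
    have := integral_mul_fderiv_eq_neg_fderiv_mul_of_integrable (μ := (volume : Measure (Euc d))) (f := W) (g := φ) (v := EuclideanSpace.single (a 0) (1:ℝ))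
      (((pd_sm hWs (a 0)).continuous.mul hφ.continuous).integrable_of_hasCompactSupport hc.mul_left)
      ((hWs.continuous.mul (pd_sm hφ (a 0)).continuous).integrable_of_hasCompactSupport (pd_cs hc _).mul_left)
      ((hWs.continuous.mul hφ.continuous).integrable_of_hasCompactSupport hc.mul_left) (fun x _ => sm_diff hWs x) (fun x _ => sm_diff hφ x)
    change ∫ x, W x * pd (a 0) φ x = - ∫ x, pd (a 0) W x * φ x at this
    rw [this]
    ring

lemma iterPD_tsupport {w : Euc d → ℝ} {m : ℕ} (a : Fin m → Fin d) : tsupport (iterPD a w) ⊆ tsupport w := by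
  induction m generalizing w with
  | zero => exact subset_rfl
  | succ m ih => exact (ih _).trans (pd_tsupport _)

lemma ibp {Ω : Set (Euc d)} {w : Euc d → ℝ} (hw : ContDiff ℝ (⊤ : ℕ∞) w) (m : ℕ) :
    HasWeakDerivs Ω m w (fun a => iterPD a w) := by
  intro a φ hφ
  rw [setIntegral_eq_integral_of_forall_compl_eq_zero, setIntegral_eq_integral_of_forall_compl_eq_zero]
  · exact ibp_full hw hφ.1 hφ.2.1 a
  · intro x hx
    rw [image_eq_zero_of_notMem_tsupport fun h => hx (hφ.2.2 h), mul_zero]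
  · intro x hx
    rw [image_eq_zero_of_notMem_tsupport fun h => hx (hφ.2.2 (iterPD_tsupport a h)), mul_zero]

lemma pair_lim (hp1 : 1 < p) {μ : Measure (Euc d)} [IsFiniteMeasure μ] {g : ℕ → Euc d → ℝ} {G ψ : Euc d → ℝ}
    (hg : ∀ n, MemLp (g n) p μ) (hG : MemLp G p μ) (h : Tendsto (fun n => eLpNorm (g n - G) p μ) atTop (𝓝 0))
    (hψ : Continuous ψ) (hc : HasCompactSupport ψ) :
    Tendsto (fun n => ∫ x, g n x * ψ x ∂μ) atTop (𝓝 (∫ x, G x * ψ x ∂μ)) := by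
  obtain ⟨M, hM⟩ := hc.exists_bound_of_continuous hψ
  have hi : ∀ {f : Euc d → ℝ}, MemLp f p μ → Integrable (fun x => f x * ψ x) μ := fun {f} hf => by
    have := (hf.integrable hp1.le).bdd_mul hψ.aestronglyMeasurable (Eventually.of_forall hM)
    simpa [mul_comm] using this
  refine tendsto_integral_of_L1' _ (hi hG).1 (Eventually.of_forall fun n => hi (hg n)) ?_
  have hb : ∀ n, eLpNorm ((fun x => g n x * ψ x) - fun x => G x * ψ x) 1 μ ≤
      ENNReal.ofReal M * (eLpNorm (g n - G) p μ * μ Set.univ ^ (1 / (1:ℝ≥0∞).toReal - 1 / p.toReal)) := fun n => by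
    refine (eLpNorm_le_mul_eLpNorm_of_ae_le_mul (g := g n - G) (c := M) (Eventually.of_forall fun x => ?_) 1).trans ?_
    · simp only [Pi.sub_apply]
      rw [← sub_mul, norm_mul, mul_comm]
      exact mul_le_mul_of_nonneg_right (hM x) (norm_nonneg _)
    · gcongr
      exact eLpNorm_le_eLpNorm_mul_rpow_measure_univ hp1.le ((hg n).1.sub hG.1)
  have hfin : μ Set.univ ^ (1 / (1:ℝ≥0∞).toReal - 1 / p.toReal) ≠ ⊤ := by
    refine ENNReal.rpow_ne_top_of_nonneg ?_ (measure_ne_top _ _)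
    by_cases hpt : p = ⊤
    · simp [hpt]
    have : 1 ≤ p.toReal := by
      rw [← ENNReal.toReal_one]; exact ENNReal.toReal_mono hpt hp1.le
    simp only [ENNReal.toReal_one, one_div, inv_one, sub_nonneg]
    exact inv_le_one_of_one_le₀ this
  refine tendsto_of_tendsto_of_tendsto_of_le_of_le tendsto_const_nhds ?_ (fun _ => zero_le) hb
  have h2 := ENNReal.Tendsto.const_mul (a := ENNReal.ofReal M) (ENNReal.Tendsto.mul_const h (Or.inr hfin)) (Or.inr ENNReal.ofReal_ne_top)
  simpa using h2
end

end


section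


section
variable {d : ℕ} {p : ℝ≥0∞}

lemma lp_limit (hp1 : 1 < p) {μ : Measure (Euc d)} {D : ℕ → Euc d → ℝ} (hD : ∀ n, MemLp (D n) p μ)
    {e : ℕ → ℝ≥0∞} (he : Tendsto e atTop (𝓝 0)) {C : ℝ≥0} (h : ∀ n m, eLpNorm (D n - D m) p μ ≤ C * (e n + e m)) :
    ∃ v, MemLp v p μ ∧ Tendsto (fun n => eLpNorm (D n - v) p μ) atTop (𝓝 0) := by
  have : Fact (1 ≤ p) := ⟨hp1.le⟩
  have hc : CauchySeq fun n => (hD n).toLp (D n) := by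
    rw [Lp.cauchySeq_Lp_iff_cauchySeq_eLpNorm]
    have hb : ∀ q : ℕ × ℕ, eLpNorm (⇑((hD q.1).toLp (D q.1)) - ⇑((hD q.2).toLp (D q.2))) p μ ≤ C * (e q.1 + e q.2) := fun q => by
      rw [eLpNorm_congr_ae ((hD q.1).coeFn_toLp.sub (hD q.2).coeFn_toLp)]
      exact h _ _
    refine tendsto_of_tendsto_of_tendsto_of_le_of_le tendsto_const_nhds ?_ (fun _ => zero_le) hb
    rw [← prod_atTop_atTop_eq]
    have h2 := ENNReal.Tendsto.const_mul (a := (C : ℝ≥0∞)) ((he.comp tendsto_fst).add (he.comp tendsto_snd)) (Or.inr ENNReal.coe_ne_top)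
      (f := (atTop : Filter ℕ) ×ˢ (atTop : Filter ℕ))
    simpa using h2
  obtain ⟨v, hv⟩ := cauchySeq_tendsto_of_complete hc
  refine ⟨v, Lp.memLp v, ?_⟩
  rw [Lp.tendsto_Lp_iff_tendsto_eLpNorm'] at hv
  refine hv.congr fun n => eLpNorm_congr_ae ?_
  exact (hD n).coeFn_toLp.sub EventuallyEq.rfl

/-- The core theorem, for genuine `L^p` functions. -/
lemma core (hp1 : 1 < p) (hp2 : p ≠ ⊤) (k : ℕ) {Ω Ω' : Set (Euc d)} (hΩ : IsOpen Ω)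
    (hsub : closure Ω' ⊆ Ω) (hcpt : IsCompact (closure Ω')) :
    ∃ C : ℝ≥0, ∀ (u f : Euc d → ℝ) (F : ∀ m, (Fin m → Fin d) → Euc d → ℝ), MemLp u p (volume.restrict Ω) →
      MemLp f p (volume.restrict Ω) → (∀ m ≤ k, HasWeakDerivs Ω m f (F m) ∧ ∀ a, MemLp (F m a) p (volume.restrict Ω)) →
      IsWeakLap Ω u f → ∀ m ≤ k + 2, ∃ v, HasWeakDerivs Ω' m u v ∧ (∀ a, MemLp (v a) p (volume.restrict Ω')) ∧
        ∀ a, eLpNorm (v a) p (volume.restrict Ω') ≤ C * (eLpNorm u p (volume.restrict Ω) +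
          ∑ j ∈ Finset.range (k+1), ∑ b : Fin j → Fin d, eLpNorm (F j b) p (volume.restrict Ω)) := by
  obtain ⟨L, hL, hKL, hLΩ⟩ := exists_compact_between hcpt hΩ hsub
  set U := interior L with hU
  have hUo : IsOpen U := isOpen_interior
  obtain ⟨C, hC⟩ := lemD hp1 hp2 k hcpt hUo hKL
  obtain ⟨δ, hδ, hδΩ⟩ := hL.exists_cthickening_subset_open hΩ hLΩ
  have hball : ∀ x ∈ U, Metric.closedBall x δ ⊆ Ω := fun x hx y hy =>
    hδΩ (Metric.mem_cthickening_of_dist_le y x δ _ (interior_subset hx) hy)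
  set ε : ℕ → ℝ := fun n => δ / (n + 1) with hε
  have hε0 : ∀ n, 0 < ε n := fun n => by positivity
  have hεδ : ∀ n, ε n ≤ δ := fun n => div_le_self hδ.le (by linarith [(Nat.cast_nonneg n : (0:ℝ) ≤ n)])
  have hεt : Tendsto ε atTop (𝓝 0) := by
    have := (tendsto_one_div_add_atTop_nhds_zero_nat (𝕜 := ℝ)).const_mul δ
    simpa [hε, div_eq_mul_inv] using this
  choose ρ hρ using fun n => exists_moll (d := d) (hε0 n)
  refine ⟨C, fun u f F hu hf hF hlap m hm => ?_⟩
  have hΩm := hΩ.measurableSet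
  have hKm : volume.restrict Ω' ≤ volume.restrict (closure Ω') := Measure.restrict_mono subset_closure le_rfl
  set ub := Ω.indicator u with hub
  have hubL : MemLp ub p volume := (memLp_indicator_iff_restrict hΩm).2 hu
  have hfbL : MemLp (Ω.indicator f) p volume := (memLp_indicator_iff_restrict hΩm).2 hf
  have hFbL : ∀ j ≤ k, ∀ b, MemLp (Ω.indicator (F j b)) p volume := fun j hj b => (memLp_indicator_iff_restrict hΩm).2 ((hF j hj).2 b)
  set w : ℕ → Euc d → ℝ := fun n => Mo (ρ n) ub with hw
  have hws : ∀ n, ContDiff ℝ (⊤ : ℕ∞) (w n) := fun n => Mo_sm (hρ n).sm (hρ n).cs (hubL.locallyIntegrable hp1.le)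
  have hderiv : ∀ n, ∀ j ≤ k, ∀ b : Fin j → Fin d, ∀ x ∈ U, iterPD b (lap (w n)) x = Mo (ρ n) (Ω.indicator (F j b)) x := by
    intro n j hj b x hx
    have hb : ∀ y ∈ U, Metric.closedBall y (ε n) ⊆ Ω := fun y hy => (Metric.closedBall_subset_closedBall (hεδ n)).trans (hball y hy)
    have h1 : lap (w n) =ᶠ[𝓝 x] Mo (ρ n) (Ω.indicator f) := by
      filter_upwards [hUo.mem_nhds hx] with y hy
      rw [hw]
      simp only
      rw [Mo_lap (hρ n).sm (hρ n).cs (hubL.locallyIntegrable hp1.le)]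
      exact moll_lap hΩ hlap (hρ n) (hb y hy)
    rw [(iterPD_congr h1 b).eq_of_nhds, Mo_iterPD (hρ n).sm (hρ n).cs (hfbL.locallyIntegrable hp1.le)]
    exact moll_weak hΩ (hF j hj).1 (hρ n) (hb x hx) b
  set R := eLpNorm u p (volume.restrict Ω) + ∑ j ∈ Finset.range (k+1), ∑ b : Fin j → Fin d, eLpNorm (F j b) p (volume.restrict Ω) with hR
  have hle : ∀ g : Euc d → ℝ, AEStronglyMeasurable (Ω.indicator g) volume → ∀ n, eLpNorm (Mo (ρ n) (Ω.indicator g)) p (volume.restrict U) ≤ eLpNorm g p (volume.restrict Ω) := by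
    intro g hg n
    refine (eLpNorm_mono_measure _ Measure.restrict_le_self).trans ((Mo_contr hp1 hp2 (hρ n) hg).trans ?_)
    rw [eLpNorm_indicator_eq_eLpNorm_restrict hΩm]
  have hbd : ∀ n, ∀ a : Fin m → Fin d, eLpNorm (iterPD a (w n)) p (volume.restrict (closure Ω')) ≤ C * R := by
    intro n a
    refine (hC (w n) (hws n) m hm a).trans ?_
    rw [hR, rhsD]
    gcongr with j hj b _
    · exact hle u hubL.1 n
    · have hj' : j ≤ k := by have := Finset.mem_range.1 hj; omega
      rw [eLpNorm_congr_ae ((ae_restrict_iff' hUo.measurableSet).2 (Eventually.of_forall (hderiv n j hj' b)))]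
      exact hle _ (hFbL j hj' b).1 n
  set e : ℕ → ℝ≥0∞ := fun n => eLpNorm (w n - ub) p volume + ∑ j ∈ Finset.range (k+1), ∑ b : Fin j → Fin d,
    eLpNorm (Mo (ρ n) (Ω.indicator (F j b)) - Ω.indicator (F j b)) p volume with he
  have het : Tendsto e atTop (𝓝 0) := by
    have : Tendsto e atTop (𝓝 (0 + ∑ j ∈ Finset.range (k+1), ∑ b : Fin j → Fin d, 0)) := by
      refine (Mo_tendsto hp1 hp2 hubL hρ hεt).add (tendsto_finsetSum _ fun j hj => tendsto_finsetSum _ fun b _ => ?_)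
      have hj' : j ≤ k := by have := Finset.mem_range.1 hj; omega
      exact Mo_tendsto hp1 hp2 (hFbL j hj' b) hρ hεt
    simpa using this
  have hsubm : ∀ {g : Euc d → ℝ}, MemLp g p volume → ∀ n m, eLpNorm (Mo (ρ n) g - Mo (ρ m) g) p (volume.restrict U) ≤
      eLpNorm (Mo (ρ n) g - g) p volume + eLpNorm (Mo (ρ m) g - g) p volume := by
    intro g hg n m
    have hm : ∀ n, AEStronglyMeasurable (Mo (ρ n) g) volume := fun n =>
      (Mo_sm (hρ n).sm (hρ n).cs (hg.locallyIntegrable hp1.le)).continuous.aestronglyMeasurable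
    refine (eLpNorm_mono_measure _ Measure.restrict_le_self).trans ?_
    have e1 : Mo (ρ n) g - Mo (ρ m) g = (Mo (ρ n) g - g) - (Mo (ρ m) g - g) := by ring
    rw [e1]
    exact eLpNorm_sub_le ((hm n).sub hg.1) ((hm m).sub hg.1) hp1.le
  have hcau : ∀ a : Fin m → Fin d, ∀ n l, eLpNorm (iterPD a (w n) - iterPD a (w l)) p (volume.restrict Ω') ≤ C * (e n + e l) := by
    intro a n l
    refine (eLpNorm_mono_measure _ hKm).trans ?_
    rw [← iterPD_sub (hws n) (hws l)]
    refine (hC (w n - w l) ((hws n).sub (hws l)) m hm a).trans ?_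
    have : e n + e l = (eLpNorm (w n - ub) p volume + eLpNorm (w l - ub) p volume) + ∑ j ∈ Finset.range (k+1), ∑ b : Fin j → Fin d,
        (eLpNorm (Mo (ρ n) (Ω.indicator (F j b)) - Ω.indicator (F j b)) p volume + eLpNorm (Mo (ρ l) (Ω.indicator (F j b)) - Ω.indicator (F j b)) p volume) := by
      simp only [he, Finset.sum_add_distrib]
      ring
    rw [this, rhsD]
    gcongr with j hj b _
    · exact hsubm hubL n l
    · have hj' : j ≤ k := by have := Finset.mem_range.1 hj; omega
      have e2 : ∀ x ∈ U, iterPD b (lap (w n - w l)) x = (Mo (ρ n) (Ω.indicator (F j b)) - Mo (ρ l) (Ω.indicator (F j b))) x := by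
        intro x hx
        rw [lap_sub (hws n) (hws l), iterPD_sub (lap_sm (hws n)) (lap_sm (hws l)), Pi.sub_apply, Pi.sub_apply, hderiv n j hj' b x hx, hderiv l j hj' b x hx]
      rw [eLpNorm_congr_ae ((ae_restrict_iff' hUo.measurableSet).2 (Eventually.of_forall e2))]
      exact hsubm (hFbL j hj' b) n l
  have hmem : ∀ a : Fin m → Fin d, ∀ n, MemLp (iterPD a (w n)) p (volume.restrict Ω') := fun a n =>
    ⟨(iterPD_sm (hws n) a).continuous.aestronglyMeasurable,
      (eLpNorm_mono_measure _ hKm).trans_lt (fin_on hcpt (iterPD_sm (hws n) a).continuous).lt_top⟩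
  choose v hv hvt using fun a => lp_limit hp1 (hmem a) het (hcau a)
  have hfin : IsFiniteMeasure (volume.restrict Ω') := ⟨by
    simpa using (measure_mono subset_closure).trans_lt hcpt.measure_lt_top⟩
  have hΩ'Ω : volume.restrict Ω' ≤ volume.restrict Ω := Measure.restrict_mono (subset_closure.trans hsub) le_rfl
  have hwu : Tendsto (fun n => eLpNorm (w n - u) p (volume.restrict Ω')) atTop (𝓝 0) := by
    refine tendsto_of_tendsto_of_tendsto_of_le_of_le tendsto_const_nhds het (fun _ => zero_le) fun n => ?_
    have : eLpNorm (w n - u) p (volume.restrict Ω) = eLpNorm (w n - ub) p (volume.restrict Ω) := by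
      refine eLpNorm_congr_ae ((ae_restrict_iff' hΩm).2 (Eventually.of_forall fun x hx => ?_))
      simp [hub, hx]
    refine (eLpNorm_mono_measure _ hΩ'Ω).trans ?_
    rw [this]
    exact (eLpNorm_mono_measure _ Measure.restrict_le_self).trans le_self_add
  refine ⟨v, ?_, hv, ?_⟩
  · intro a φ hφ
    have t1 := pair_lim hp1 (μ := volume.restrict Ω') (g := w) (G := u) (ψ := iterPD a φ)
      (fun n => ⟨(hws n).continuous.aestronglyMeasurable, (eLpNorm_mono_measure _ hKm).trans_lt (fin_on hcpt (hws n).continuous).lt_top⟩)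
      (hu.mono_measure hΩ'Ω) hwu (iterPD_sm hφ.1 a).continuous (iterPD_cs hφ.2.1 a)
    have t2 := (pair_lim hp1 (hmem a) (hv a) (hvt a) hφ.1.continuous hφ.2.1).const_mul ((-1:ℝ) ^ m)
    refine tendsto_nhds_unique t1 (t2.congr fun n => ?_)
    exact (ibp (hws n) m a φ hφ).symm
  · intro a
    have hle2 : ∀ n, eLpNorm (v a) p (volume.restrict Ω') ≤ eLpNorm (iterPD a (w n) - v a) p (volume.restrict Ω') + C * R := by
      intro n
      have e1 : v a = iterPD a (w n) - (iterPD a (w n) - v a) := by ring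
      calc eLpNorm (v a) p (volume.restrict Ω') = eLpNorm (iterPD a (w n) - (iterPD a (w n) - v a)) p (volume.restrict Ω') := by rw [← e1]
        _ ≤ eLpNorm (iterPD a (w n)) p (volume.restrict Ω') + eLpNorm (iterPD a (w n) - v a) p (volume.restrict Ω') :=
          eLpNorm_sub_le (hmem a n).1 ((hmem a n).1.sub (hv a).1) hp1.le
        _ ≤ _ := by
          rw [add_comm]
          gcongr
          exact (eLpNorm_mono_measure _ hKm).trans (hbd n a)
    have := ge_of_tendsto' ((hvt a).add_const (C * R)) hle2
    simpa using this
end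

end


section


section
variable {d : ℕ} {p : ℝ≥0∞}

lemma junk_li {Ω : Set (Euc d)} (hΩ : IsOpen Ω) {g φ : Euc d → ℝ} (hg : LocallyIntegrableOn g Ω) (hφ : IsTestFun Ω φ) :
    IntegrableOn (fun x => g x * φ x) Ω := by
  have h1 : IntegrableOn (fun x => g x * φ x) (tsupport φ) :=
    (hg.integrableOn_compact_subset hφ.2.2 hφ.2.1).mul_continuousOn hφ.1.continuous.continuousOn hφ.2.1
  refine h1.of_forall_sdiff_eq_zero hΩ.measurableSet fun x hx => ?_
  rw [image_eq_zero_of_notMem_tsupport hx.2, mul_zero]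

lemma junk_not {Ω : Set (Euc d)} {g φ : Euc d → ℝ} {x₀ : Euc d}
    (hg : ¬ IntegrableAtFilter g (𝓝[Ω] x₀)) (hφ : IsTestFun Ω φ) (h0 : φ x₀ ≠ 0) :
    ∫ x in Ω, g x * φ x = 0 := by
  apply integral_undef
  intro hi
  apply hg
  have hc := hφ.1.continuous
  have hinv : ContinuousAt (fun x => (φ x)⁻¹) x₀ := hc.continuousAt.inv₀ h0
  have hU : {x | φ x ≠ 0} ∈ 𝓝 x₀ := (isOpen_ne_fun hc continuous_const).mem_nhds h0
  obtain ⟨r, hr, hrU⟩ := Metric.nhds_basis_closedBall.mem_iff.1 hU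
  refine ⟨Ω ∩ Metric.closedBall x₀ r, inter_mem_nhdsWithin _ (Metric.closedBall_mem_nhds _ hr), ?_⟩
  have h1 : IntegrableOn (fun x => g x * φ x) (Metric.closedBall x₀ r) (volume.restrict Ω) := Integrable.integrableOn hi
  have h2 := h1.mul_continuousOn (g' := fun x => (φ x)⁻¹) (hc.continuousOn.inv₀ fun x hx => hrU hx) (isCompact_closedBall _ _)
  have h3 : IntegrableOn g (Metric.closedBall x₀ r) (volume.restrict Ω) := by
    refine h2.congr_fun (fun x hx => ?_) measurableSet_closedBall
    have : φ x ≠ 0 := hrU hx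
    simp only
    field_simp
  rw [IntegrableOn, Measure.restrict_restrict measurableSet_closedBall, Set.inter_comm] at h3
  exact h3

lemma junk_dom {Ω : Set (Euc d)} (hΩ : IsOpen Ω) {g G : Euc d → ℝ} (hG : IntegrableOn G Ω)
    (h : ∀ φ, IsTestFun Ω φ → ∫ x in Ω, g x * φ x = ∫ x in Ω, G x * φ x) :
    ∀ᵐ x ∂(volume.restrict Ω), ‖G x‖ ≤ ‖g x‖ := by
  have hGl : LocallyIntegrableOn G Ω := hG.locallyIntegrableOn
  have off : ∀ (F φ : Euc d → ℝ), IsTestFun Ω φ → ∫ x, φ x • F x = ∫ x in Ω, F x * φ x := fun F φ hφ => by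
    rw [setIntegral_eq_integral_of_forall_compl_eq_zero]
    · simp [mul_comm]
    · intro x hx
      rw [image_eq_zero_of_notMem_tsupport fun hx' => hx (hφ.2.2 hx'), mul_zero]
  by_cases hg : LocallyIntegrableOn g Ω
  · have := hΩ.ae_eq_zero_of_integral_contDiff_smul_eq_zero (f := g - G) (μ := volume) (hg.sub hGl) (fun φ h1 h2 h3 => by
      have hφ : IsTestFun Ω φ := ⟨h1, h2, h3⟩
      rw [off _ _ hφ]
      simp only [Pi.sub_apply, sub_mul]
      rw [integral_sub (junk_li hΩ hg hφ) (junk_li hΩ hGl hφ), h φ hφ, sub_self])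
    rw [← ae_restrict_iff' hΩ.measurableSet] at this
    filter_upwards [this] with x hx
    rw [sub_eq_zero.1 hx]
  · obtain ⟨x₀, hx₀, hn⟩ : ∃ x₀ ∈ Ω, ¬ IntegrableAtFilter g (𝓝[Ω] x₀) := by
      by_contra hh; push Not at hh; exact hg hh
    obtain ⟨η, h1, h2, h3, h4, -⟩ := exists_cut (isCompact_singleton (x := x₀)) hΩ (by simpa using hx₀)
    have hη : IsTestFun Ω η := ⟨h1, h2, h3⟩
    have hη0 : η x₀ = 1 := (h4 x₀ rfl).self_of_nhds
    have key : ∀ φ, IsTestFun Ω φ → ∫ x in Ω, G x * φ x = 0 := by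
      intro φ hφ
      by_cases h0 : φ x₀ = 0
      · have hs : IsTestFun Ω (η + φ) := ⟨h1.add hφ.1, h2.add hφ.2.1, (tsupport_add η φ).trans (Set.union_subset h3 hφ.2.2)⟩
        have e1 := (h _ hs).symm.trans (junk_not hn hs (by simp [hη0, h0]))
        have e2 := (h _ hη).symm.trans (junk_not hn hη (by simp [hη0]))
        simp only [Pi.add_apply, mul_add] at e1
        rw [integral_add (junk_li hΩ hGl hη) (junk_li hΩ hGl hφ), e2, zero_add] at e1
        exact e1
      · exact (h _ hφ).symm.trans (junk_not hn hφ h0)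
    have := hΩ.ae_eq_zero_of_integral_contDiff_smul_eq_zero (μ := volume) hGl (fun φ h1 h2 h3 => by
      rw [off _ _ ⟨h1, h2, h3⟩, key φ ⟨h1, h2, h3⟩])
    rw [← ae_restrict_iff' hΩ.measurableSet] at this
    filter_upwards [this] with x hx
    rw [hx]; simp

lemma IsTestFun.iterPD {Ω : Set (Euc d)} {φ : Euc d → ℝ} (hφ : IsTestFun Ω φ) {m : ℕ} (a : Fin m → Fin d) :
    IsTestFun Ω (iterPD a φ) :=
  ⟨iterPD_sm hφ.1 a, hφ.2.1.mono' (subset_tsupport _ |>.trans (iterPD_tsupport a)), (iterPD_tsupport a).trans hφ.2.2⟩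

lemma IsTestFun.lap {Ω : Set (Euc d)} {φ : Euc d → ℝ} (hφ : IsTestFun Ω φ) : IsTestFun Ω (lap φ) :=
  ⟨lap_sm hφ.1, hφ.2.1.mono' (subset_tsupport _ |>.trans lap_tsupport), lap_tsupport.trans hφ.2.2⟩

lemma assembly (k : ℕ) (Ω : Set (Euc d)) (hΩ : IsOpen Ω) (hb : Bornology.IsBounded Ω)
    (hp1 : 1 < p) (hp2 : p ≠ ⊤) (Ω' : Set (Euc d)) (hsub : closure Ω' ⊆ Ω) (hcpt : IsCompact (closure Ω')) :
    ∃ C : ℝ, 0 < C ∧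
      ∀ u f : Euc d → ℝ, MemW Ω p 2 u → MemW Ω p k f →
        IsWeakLap Ω u f →
        MemW Ω' p (k + 2) u ∧
        ∃ v, HasWeakDerivs Ω' (k + 2) u v ∧
          ∀ g : (m : ℕ) → (Fin m → Fin d) → Euc d → ℝ,
            (∀ m, m ≤ k → HasWeakDerivs Ω m f (g m)) →
            DkNorm Ω' p v ≤ ENNReal.ofReal C *
              (eLpNorm u p (volume.restrict Ω) +
                ∑ m ∈ Finset.range (k + 1), DkNorm Ω p (g m)) := by
  obtain ⟨C, hC⟩ := core hp1 hp2 k hΩ hsub hcpt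
  set N : ℝ≥0 := ∑ j ∈ Finset.range (k+1), (d:ℝ≥0) ^ j with hN
  set A : ℝ≥0 := (d:ℝ≥0)^(k+2) * (C * (1 + N)) with hA
  refine ⟨A + 1, by positivity, fun u f hu hf hlap => ?_⟩
  have : IsFiniteMeasure (volume.restrict Ω) := ⟨by simpa using hb.measure_lt_top⟩
  obtain ⟨v0, hv0, hv0L⟩ := hu 0 (by omega)
  set a0 : Fin 0 → Fin d := Fin.elim0 with ha0
  set w := v0 a0 with hw
  have hwu : ∀ φ, IsTestFun Ω φ → ∫ x in Ω, u x * φ x = ∫ x in Ω, w x * φ x := fun φ hφ => by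
    simpa [iterPD] using hv0 a0 φ hφ
  choose F0 hF0 hF0L using hf
  set F : ∀ m, (Fin m → Fin d) → Euc d → ℝ := fun m a => if h : m ≤ k then F0 m h a else 0 with hF
  have hFw : ∀ m ≤ k, HasWeakDerivs Ω m f (F m) := fun m hm => by
    have : F m = F0 m hm := by ext a; simp [hF, hm]
    rw [this]; exact hF0 m hm
  have hFL : ∀ m ≤ k, ∀ a, MemLp (F m a) p (volume.restrict Ω) := fun m hm a => by
    have : F m = F0 m hm := by ext a; simp [hF, hm]
    rw [this]; exact hF0L m hm a
  set q := F 0 a0 with hq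
  have hqf : ∀ φ, IsTestFun Ω φ → ∫ x in Ω, f x * φ x = ∫ x in Ω, q x * φ x := fun φ hφ => by
    simpa [iterPD] using hFw 0 (Nat.zero_le _) a0 φ hφ
  have hcore := hC w q F (hv0L a0) (hFL 0 (Nat.zero_le _) a0)
    (fun m hm => ⟨fun a φ hφ => by rw [← hqf _ (hφ.iterPD a)]; exact hFw m hm a φ hφ, hFL m hm⟩)
    (fun φ hφ => by rw [← hwu _ hφ.lap, ← hqf _ hφ]; exact hlap φ hφ)
  have hΩ'Ω : Ω' ⊆ Ω := subset_closure.trans hsub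
  have hres : ∀ (g φ : Euc d → ℝ), IsTestFun Ω' φ → ∫ x in Ω', g x * φ x = ∫ x in Ω, g x * φ x := fun g φ hφ => by
    rw [setIntegral_eq_integral_of_forall_compl_eq_zero, setIntegral_eq_integral_of_forall_compl_eq_zero]
    · intro x hx
      rw [image_eq_zero_of_notMem_tsupport fun hx' => hx (hΩ'Ω (hφ.2.2 hx')), mul_zero]
    · intro x hx
      rw [image_eq_zero_of_notMem_tsupport fun hx' => hx (hφ.2.2 hx'), mul_zero]
  have hup : ∀ φ, IsTestFun Ω' φ → ∫ x in Ω', u x * φ x = ∫ x in Ω', w x * φ x := fun φ hφ => by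
    rw [hres _ _ hφ, hres _ _ hφ, hwu φ ⟨hφ.1, hφ.2.1, hφ.2.2.trans hΩ'Ω⟩]
  have htr : ∀ m v, HasWeakDerivs Ω' m w v → HasWeakDerivs Ω' m u v := fun m v hv a φ hφ => by
    rw [hup _ (hφ.iterPD a)]; exact hv a φ hφ
  refine ⟨fun m hm => ?_, ?_⟩
  · obtain ⟨v, h1, h2, -⟩ := hcore m hm
    exact ⟨v, htr m v h1, h2⟩
  obtain ⟨v, h1, h2, h3⟩ := hcore (k+2) le_rfl
  refine ⟨v, htr _ v h1, fun g hg => ?_⟩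
  set R := eLpNorm u p (volume.restrict Ω) + ∑ m ∈ Finset.range (k + 1), DkNorm Ω p (g m) with hR
  have hwn : eLpNorm w p (volume.restrict Ω) ≤ eLpNorm u p (volume.restrict Ω) :=
    eLpNorm_mono_ae (junk_dom hΩ ((hv0L a0).integrable hp1.le) hwu)
  have hFn : ∀ j ≤ k, ∀ b, eLpNorm (F j b) p (volume.restrict Ω) ≤ DkNorm Ω p (g j) := fun j hj b => by
    have hd := junk_dom hΩ (g := g j b) ((hFL j hj b).integrable hp1.le) (fun φ hφ => by
      have e := (hg j hj b φ hφ).symm.trans (hFw j hj b φ hφ)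
      exact mul_left_cancel₀ (pow_ne_zero _ (by norm_num)) e)
    refine eLpNorm_mono_ae (hd.mono fun x hx => hx.trans ?_)
    rw [Real.norm_eq_abs, Real.norm_eq_abs]
    refine le_trans ?_ (le_abs_self _)
    exact Finset.single_le_sum (f := fun b => |g j b x|) (fun _ _ => abs_nonneg _) (Finset.mem_univ b)
  have hS : ∑ j ∈ Finset.range (k+1), ∑ b : Fin j → Fin d, eLpNorm (F j b) p (volume.restrict Ω) ≤ N * R := by
    rw [hN]; push_cast; rw [Finset.sum_mul]
    refine Finset.sum_le_sum fun j hj => ?_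
    have hj' : j ≤ k := by simpa [Nat.lt_succ_iff] using hj
    calc _ ≤ ∑ b : Fin j → Fin d, R := Finset.sum_le_sum fun b _ => (hFn j hj' b).trans
            ((Finset.single_le_sum (f := fun m => DkNorm Ω p (g m)) (fun _ _ => zero_le) hj).trans le_add_self)
      _ = _ := by simp
  have hva : ∀ a, eLpNorm (v a) p (volume.restrict Ω') ≤ ((C * (1 + N) : ℝ≥0) : ℝ≥0∞) * R := fun a => by
    refine (h3 a).trans ?_
    push_cast
    rw [mul_assoc, add_mul, one_mul]
    gcongr
    exact hwn.trans le_self_add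
  have hD : DkNorm Ω' p v ≤ ∑ a, eLpNorm (v a) p (volume.restrict Ω') := by
    have : Dmag v = fun x => ∑ a, |v a x| := rfl
    rw [DkNorm, this]
    refine (eL_sum hp1 Finset.univ (F := fun a x => |v a x|) (fun a _ => (h2 a).1.norm)).trans ?_
    exact Finset.sum_le_sum fun a _ => le_of_eq (eLpNorm_norm (v a))
  calc _ ≤ ∑ a, eLpNorm (v a) p (volume.restrict Ω') := hD
    _ ≤ ∑ a : Fin (k+2) → Fin d, ((C * (1 + N) : ℝ≥0) : ℝ≥0∞) * R := Finset.sum_le_sum fun a _ => hva a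
    _ = (A : ℝ≥0∞) * R := by rw [hA]; push_cast; simp [mul_assoc]
    _ ≤ _ := by
      gcongr
      rw [ENNReal.ofReal_add (by positivity) (by norm_num), ENNReal.ofReal_coe_nnreal]
      exact le_self_add
end

end

/-- Interior higher elliptic regularity: if `u ∈ W^{2,p}(Ω)`
solves `Δu = f` with `f ∈ W^{k,p}(Ω)`, then for every subdomain `Ω' ⊂⊂ Ω` one has
`u ∈ W^{k+2,p}(Ω')` and
`‖D^{k+2}u‖_{L^p(Ω')} ≤ C(‖u‖_{L^p(Ω)} + ‖f‖_{W^{k,p}(Ω)})`. -/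
theorem elliptic_interior_higher_regularity
    (d k : ℕ) (Ω : Set (Euc d)) (hΩ : IsBoundedDomain Ω)
    (p : ℝ≥0∞) (hp1 : 1 < p) (hp2 : p ≠ ⊤)
    (Ω' : Set (Euc d)) (hΩ' : IsOpen Ω') (hΩ'c : IsConnected Ω')
    (hsub : closure Ω' ⊆ Ω) (hcpt : IsCompact (closure Ω')) :
    ∃ C : ℝ, 0 < C ∧
      ∀ u f : Euc d → ℝ, MemW Ω p 2 u → MemW Ω p k f →
        IsWeakLap Ω u f →
        MemW Ω' p (k + 2) u ∧
        ∃ v, HasWeakDerivs Ω' (k + 2) u v ∧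
          ∀ g : (m : ℕ) → (Fin m → Fin d) → Euc d → ℝ,
            (∀ m, m ≤ k → HasWeakDerivs Ω m f (g m)) →
            DkNorm Ω' p v ≤ ENNReal.ofReal C *
              (eLpNorm u p (volume.restrict Ω) +
                ∑ m ∈ Finset.range (k + 1), DkNorm Ω p (g m)) := by
  exact assembly k Ω hΩ.1 hΩ.2.2 hp1 hp2 Ω' hsub hcpt
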